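/- arXiv:1810.11046 — 7 statements merged into one kernel-verified Lean document; each statement's English description precedes it below -/
import Mathlib

section
/- Let N ≥ 3 be an integer, α ≥ 0 a real number, and p_α = (N+2+2α)/(N-2). The function U_α(r) = (1 + r^{2+α}/((N+α)(N-2)))^{-(N-2)/(2+α)} satisfies U_α(0) = 1, 0 < U_α(r) ≤ 1 for all r ≥ 0, and solves the radial Hénon equation U_α''(r) + ((N-1)/r) U_α'(r) + r^{α} U_α(r)^{p_α} = 0 for every r > 0. -/
open Real Filter Set Topology

/-- Derivative of a real power of `1 + r ^ s / k` at a positive point. -/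
lemma hasDerivAt_one_add_rpow_div_rpow {s k r : ℝ} (m : ℝ) (hk : 0 < k) (hr : 0 < r) :
    HasDerivAt (fun x : ℝ => (1 + x ^ s / k) ^ m)
      (s * r ^ (s - 1) / k * m * (1 + r ^ s / k) ^ (m - 1)) r := by
  have hf : HasDerivAt (fun x : ℝ => 1 + x ^ s / k) (s * r ^ (s - 1) / k) r :=
    ((Real.hasDerivAt_rpow_const (Or.inl hr.ne')).div_const k).const_add 1
  exact hf.rpow_const (Or.inl (by positivity))

/-- For an integer `N ≥ 3`, real `α ≥ 0` and `p_α = (N+2+2α)/(N-2)`, the function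
`U_α(r) = (1 + r^{2+α}/((N+α)(N-2)))^(-(N-2)/(2+α))` satisfies `U_α(0) = 1`, `0 < U_α ≤ 1` on
`[0,∞)`, and solves the radial Hénon equation `U'' + ((N-1)/r) U' + r^α U^{p_α} = 0` for `r > 0`. -/
theorem stmt1 (N : ℕ) (hN : 3 ≤ N) (α : ℝ) (hα : 0 ≤ α)
    (pα : ℝ) (hpα : pα = ((N : ℝ) + 2 + 2 * α) / ((N : ℝ) - 2))
    (U : ℝ → ℝ)
    (hU : ∀ r, U r = (1 + r ^ (2 + α) / (((N : ℝ) + α) * ((N : ℝ) - 2))) ^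
      (-((N : ℝ) - 2) / (2 + α))) :
    U 0 = 1 ∧
    (∀ r ≥ (0 : ℝ), 0 < U r ∧ U r ≤ 1) ∧
    (∀ r > (0 : ℝ),
      deriv (deriv U) r + (((N : ℝ) - 1) / r) * deriv U r + r ^ α * U r ^ pα = 0) := by
  have hN' : (3 : ℝ) ≤ N := by exact_mod_cast hN
  have hN2 : 0 < (N : ℝ) - 2 := by linarith
  have hNα : 0 < (N : ℝ) + α := by linarith
  have hs : 0 < 2 + α := by linarith
  have hk : 0 < ((N : ℝ) + α) * ((N : ℝ) - 2) := mul_pos hNα hN2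
  refine ⟨by simp [hU, Real.zero_rpow hs.ne'], fun r hr => ?_, fun r hr => ?_⟩
  · have hpow : 0 ≤ r ^ (2 + α) / (((N : ℝ) + α) * ((N : ℝ) - 2)) :=
      div_nonneg (Real.rpow_nonneg hr _) hk.le
    rw [hU]
    refine ⟨Real.rpow_pos_of_pos (by linarith) _, ?_⟩
    exact Real.rpow_le_one_of_one_le_of_nonpos (by linarith)
      (div_nonpos_of_nonpos_of_nonneg (by linarith) hs.le)
  · set m : ℝ := -((N : ℝ) - 2) / (2 + α) with hm
    set k : ℝ := ((N : ℝ) + α) * ((N : ℝ) - 2) with hkdef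
    have hderiv : ∀ x > 0, deriv U x =
        -(1 / ((N : ℝ) + α)) * (x ^ (1 + α) * (1 + x ^ (2 + α) / k) ^ (m - 1)) := by
      intro x hx
      rw [funext hU, (hasDerivAt_one_add_rpow_div_rpow m hk hx).deriv,
        show 2 + α - 1 = 1 + α by ring]
      have hcoef : (2 + α) / k * m = -(1 / ((N : ℝ) + α)) := by
        rw [hm, hkdef]
        field_simp
      rw [← hcoef]
      ring
    have hderiv2 := (((Real.hasDerivAt_rpow_const (p := 1 + α) (Or.inl hr.ne')).mul
      (hasDerivAt_one_add_rpow_div_rpow (s := 2 + α) (m - 1) hk hr)).const_mul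
        (-(1 / ((N : ℝ) + α)))).congr_of_eventuallyEq
          ((eventually_gt_nhds hr).mono hderiv)
    have hf : 0 < 1 + r ^ (2 + α) / k := by positivity
    have hUp : U r ^ pα = (1 + r ^ (2 + α) / k) ^ (m - 1 - 1) := by
      rw [hU, ← Real.rpow_mul hf.le]
      congr 1
      rw [hm, hpα]
      field_simp
      ring
    have hfpow : (1 + r ^ (2 + α) / k) ^ (m - 1) =
        (1 + r ^ (2 + α) / k) ^ (m - 1 - 1) * (1 + r ^ (2 + α) / k) := by
      rw [← Real.rpow_add_one hf.ne']
      congr 1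
      ring
    have hr1 : r ^ (1 + α) = r * r ^ α := by rw [Real.rpow_add hr, Real.rpow_one]
    have hr2 : r ^ (2 + α) = r ^ 2 * r ^ α := by rw [Real.rpow_add hr, Real.rpow_two]
    rw [hderiv2.deriv, hderiv r hr, hUp, hfpow, show 2 + α - 1 = 1 + α by ring,
      show 1 + α - 1 = α by ring, hr1]
    generalize (1 + r ^ (2 + α) / k) ^ (m - 1 - 1) = A
    rw [hr2, hm, hkdef]
    field_simp
    ring
end

section
/- Let N ≥ 3 be an integer, α ≥ 0, p > 1, and set M = 2(N+α)/(2+α). If u : (0,1) → ℝ is a C² solution of the radial Hénon equation u''(r) + ((N-1)/r) u'(r) + r^{α}|u(r)|^{p-1}u(r) = 0 on (0,1), then the function v defined by v(t) = (2/(2+α))^{2/(p-1)} u(t^{2/(2+α)}) is a C² solution of the generalized radial Lane–Emden equation v''(t) + ((M-1)/t) v'(t) + |v(t)|^{p-1}v(t) = 0 on (0,1); in particular v vanishes at t exactly when u vanishes at r = t^{2/(2+α)}. -/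
open Real Filter Set Topology

/-- A positive real power maps the open unit interval to itself. -/
lemma rpow_mem_Ioo_zero_one {β t : ℝ} (hβ : 0 < β) (ht : t ∈ Ioo (0 : ℝ) 1) :
    t ^ β ∈ Ioo (0 : ℝ) 1 :=
  ⟨rpow_pos_of_pos ht.1 β, rpow_lt_one ht.1.le ht.2 hβ⟩

/-- Chain rule for `t ↦ f (t ^ β)`, with the derivative of the power written as `β t ^ β / t`. -/
lemma HasDerivAt.comp_rpow_const {f : ℝ → ℝ} {f' β t : ℝ} (ht : 0 < t)
    (hf : HasDerivAt f f' (t ^ β)) :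
    HasDerivAt (fun s => f (s ^ β)) (f' * (β * t ^ β / t)) t := by
  have h := hf.comp t (Real.hasDerivAt_rpow_const (p := β) (Or.inl ht.ne'))
  rwa [rpow_sub_one ht.ne', ← mul_div_assoc] at h

/-- The second derivative of `t ↦ c * u (t ^ β)`. -/
lemma hasDerivAt_deriv_const_mul_comp_rpow {u : ℝ → ℝ} {β c t : ℝ} (hβ : 0 < β)
    (hu : ContDiffOn ℝ 2 u (Ioo 0 1)) (ht : t ∈ Ioo (0 : ℝ) 1) :
    HasDerivAt (deriv fun s => c * u (s ^ β))
      (c * (deriv (deriv u) (t ^ β) * (β * t ^ β / t) ^ 2 +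
        deriv u (t ^ β) * (β * (β - 1) * t ^ β / t ^ 2))) t := by
  have hu₁ : ∀ r ∈ Ioo (0 : ℝ) 1, HasDerivAt u (deriv u r) r := fun r hr =>
    ((hu.differentiableOn (by norm_num)).differentiableAt (isOpen_Ioo.mem_nhds hr)).hasDerivAt
  have hu₂ : HasDerivAt (deriv u) (deriv (deriv u) (t ^ β)) (t ^ β) :=
    (((hu.deriv_of_isOpen (m := 1) isOpen_Ioo (by norm_num)).differentiableOn
      (by norm_num)).differentiableAt
        (isOpen_Ioo.mem_nhds (rpow_mem_Ioo_zero_one hβ ht))).hasDerivAt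
  have hderiv : (deriv fun s => c * u (s ^ β)) =ᶠ[𝓝 t]
      fun s => c * (deriv u (s ^ β) * (β * s ^ β / s)) := by
    filter_upwards [isOpen_Ioo.mem_nhds ht] with s hs
    exact (((hu₁ _ (rpow_mem_Ioo_zero_one hβ hs)).comp_rpow_const hs.1).const_mul c).deriv
  refine HasDerivAt.congr_of_eventuallyEq ?_ hderiv
  have ht₀ : t ≠ 0 := ht.1.ne'
  have hpow : HasDerivAt (fun s : ℝ => s ^ β) (1 * (β * t ^ β / t)) t :=
    (hasDerivAt_id (t ^ β)).comp_rpow_const ht.1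
  refine (((hu₂.comp_rpow_const ht.1).mul
    ((hpow.const_mul β).div (hasDerivAt_id t) ht₀)).const_mul c).congr_deriv ?_
  simp only [Pi.div_apply, id]
  field_simp

/-- change of variables `v(t) = (2/(2+α))^{2/(p-1)} u(t^{2/(2+α)})` turns a C²
solution of the radial Hénon equation on `(0,1)` into a C² solution of the generalized radial
Lane–Emden equation in dimension `M = 2(N+α)/(2+α)` on `(0,1)`; `v` vanishes at `t` iff `u`
vanishes at `r = t^{2/(2+α)}`. -/
theorem stmt4 (N : ℕ) (hN : 3 ≤ N) (α p : ℝ) (hα : 0 ≤ α) (hp : 1 < p)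
    (M : ℝ) (hM : M = 2 * ((N : ℝ) + α) / (2 + α))
    (u : ℝ → ℝ) (hu : ContDiffOn ℝ 2 u (Set.Ioo 0 1))
    (hode : ∀ r ∈ Set.Ioo (0 : ℝ) 1,
      deriv (deriv u) r + (((N : ℝ) - 1) / r) * deriv u r + r ^ α * |u r| ^ (p - 1) * u r = 0)
    (v : ℝ → ℝ) (hv : ∀ t, v t = (2 / (2 + α)) ^ (2 / (p - 1)) * u (t ^ (2 / (2 + α)))) :
    ContDiffOn ℝ 2 v (Set.Ioo 0 1) ∧
    (∀ t ∈ Set.Ioo (0 : ℝ) 1,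
      deriv (deriv v) t + ((M - 1) / t) * deriv v t + |v t| ^ (p - 1) * v t = 0) ∧
    (∀ t ∈ Set.Ioo (0 : ℝ) 1, (v t = 0 ↔ u (t ^ (2 / (2 + α))) = 0)) := by
  have hα₂ : 0 < 2 + α := by linarith
  have hp₁ : p - 1 ≠ 0 := by linarith
  have hβ : 0 < 2 / (2 + α) := by positivity
  have hβα : α = 2 / (2 / (2 + α)) - 2 := by field_simp; ring
  have hMβ : M = 2 / (2 + α) * (N + α) := by rw [hM]; ring
  clear hM
  generalize 2 / (2 + α) = β at *
  have hc : 0 < β ^ (2 / (p - 1)) := rpow_pos_of_pos hβ _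
  have hcp : (β ^ (2 / (p - 1))) ^ (p - 1) = β ^ 2 := by
    rw [← rpow_mul hβ.le, div_mul_cancel₀ _ hp₁, rpow_two]
  generalize β ^ (2 / (p - 1)) = c at *
  obtain rfl : v = fun t => c * u (t ^ β) := funext hv
  refine ⟨?_, fun t ht => ?_, fun t _ => by simp [hc.ne']⟩
  · refine contDiffOn_const.mul (hu.comp ?_ fun t ht => rpow_mem_Ioo_zero_one hβ ht)
    exact contDiffOn_id.rpow_const_of_ne fun t ht => ht.1.ne'
  · have hr := rpow_mem_Ioo_zero_one hβ ht
    have hu₁ : HasDerivAt u (deriv u (t ^ β)) (t ^ β) :=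
      ((hu.differentiableOn (by norm_num)).differentiableAt (isOpen_Ioo.mem_nhds hr)).hasDerivAt
    have hrα : (t ^ β) ^ α = t ^ 2 / (t ^ β) ^ 2 := by
      have hexp : β * α = 2 - β * 2 := by rw [hβα]; field_simp
      rw [← rpow_mul ht.1.le, hexp, rpow_sub ht.1, rpow_mul ht.1.le, rpow_two, rpow_two]
    have h := hode _ hr
    beta_reduce
    rw [(hasDerivAt_deriv_const_mul_comp_rpow hβ hu ht).deriv,
      ((hu₁.comp_rpow_const ht.1).const_mul c).deriv, abs_mul, abs_of_pos hc,
      mul_rpow hc.le (abs_nonneg _), hcp]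
    rw [hrα] at h
    have ht₀ : t ≠ 0 := ht.1.ne'
    have hr₀ : t ^ β ≠ 0 := hr.1.ne'
    have hβM : M - 1 = β * (N - 1) + 1 - β := by
      rw [hMβ, hβα]; field_simp; ring
    rw [hβM]
    generalize t ^ β = r at *
    refine Eq.trans ?_ (mul_eq_zero_of_right (c * β ^ 2 * r ^ 2 / t ^ 2) h)
    field_simp
    ring
end

section
/- Let M > 2 be real and 1 < p ≤ 2M/(M-2). Let v ∈ C¹([0,1)) ∩ C²((0,1)) solve -(t^{M-1} v'(t))' = t^{M-1} |v(t)|^{p-1} v(t) on (0,1) with v'(0) = 0, and suppose B := ∫_0^1 t^{M-1} |v(t)|^{2M/(M-2)} dt < ∞. Then for every t ∈ (0,1), |v'(t)| ≤ M^{θ - 1} B^{θ} t^{1 - p(M-2)/2}, where θ = p(M-2)/(2M). -/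
open Real Filter Set Topology

/-- Hölder's inequality for a geometric mean of two nonnegative continuous functions. -/
theorem integral_geom_mean_le {f g : ℝ → ℝ} {t θ A B : ℝ} (ht : 0 ≤ t)
    (hf : ContinuousOn f (Icc 0 t)) (hg : ContinuousOn g (Icc 0 t))
    (hf0 : ∀ s ∈ Icc 0 t, 0 ≤ f s) (hg0 : ∀ s ∈ Icc 0 t, 0 ≤ g s)
    (hθ0 : 0 < θ) (hθ1 : θ ≤ 1) (hA : 0 < A) (hfA : ∫ s in (0 : ℝ)..t, f s ≤ A)
    (hgB : ∫ s in (0 : ℝ)..t, g s ≤ B) :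
    ∫ s in (0 : ℝ)..t, f s ^ (1 - θ) * g s ^ θ ≤ A ^ (1 - θ) * B ^ θ := by
  have hB0 : 0 ≤ B := (intervalIntegral.integral_nonneg ht hg0).trans hgB
  have hfi : IntervalIntegrable f MeasureTheory.volume 0 t :=
    ContinuousOn.intervalIntegrable (by rwa [uIcc_of_le ht])
  have hgi : IntervalIntegrable g MeasureTheory.volume 0 t :=
    ContinuousOn.intervalIntegrable (by rwa [uIcc_of_le ht])
  have hi : IntervalIntegrable (fun s => f s ^ (1 - θ) * g s ^ θ) MeasureTheory.volume 0 t := by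
    apply ContinuousOn.intervalIntegrable
    rw [uIcc_of_le ht]
    exact (hf.rpow_const fun s _ => Or.inr (by linarith)).mul
      (hg.rpow_const fun s _ => Or.inr hθ0.le)
  have key : ∀ C > B, ∫ s in (0 : ℝ)..t, f s ^ (1 - θ) * g s ^ θ ≤ A ^ (1 - θ) * C ^ θ := by
    intro C hC
    have hC0 : 0 < C := hB0.trans_lt hC
    have hK : 0 < A ^ (1 - θ) * C ^ θ := by positivity
    calc ∫ s in (0 : ℝ)..t, f s ^ (1 - θ) * g s ^ θ
        ≤ ∫ s in (0 : ℝ)..t, A ^ (1 - θ) * C ^ θ * ((1 - θ) / A * f s + θ / C * g s) := by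
          refine intervalIntegral.integral_mono_on ht hi
            (((hfi.const_mul _).add (hgi.const_mul _)).const_mul _) fun s hs => ?_
          have h := Real.geom_mean_le_arith_mean2_weighted (w₁ := 1 - θ) (w₂ := θ)
            (by linarith) hθ0.le (div_nonneg (hf0 s hs) hA.le) (div_nonneg (hg0 s hs) hC0.le)
            (by ring)
          rw [Real.div_rpow (hf0 s hs) hA.le, Real.div_rpow (hg0 s hs) hC0.le, div_mul_div_comm,
            div_le_iff₀ hK] at h
          calc _ ≤ _ := h
            _ = _ := by ring
      _ = A ^ (1 - θ) * C ^ θ *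
            ((1 - θ) / A * (∫ s in (0 : ℝ)..t, f s) + θ / C * ∫ s in (0 : ℝ)..t, g s) := by
          rw [intervalIntegral.integral_const_mul,
            intervalIntegral.integral_add (hfi.const_mul _) (hgi.const_mul _),
            intervalIntegral.integral_const_mul, intervalIntegral.integral_const_mul]
      _ ≤ A ^ (1 - θ) * C ^ θ * ((1 - θ) / A * A + θ / C * C) := by
          have h1 : 0 ≤ (1 - θ) / A := div_nonneg (by linarith) hA.le
          have h2 : 0 ≤ θ / C := by positivity
          have h3 : ∫ s in (0 : ℝ)..t, g s ≤ C := hgB.trans hC.le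
          gcongr
      _ = A ^ (1 - θ) * C ^ θ := by
          rw [div_mul_cancel₀ _ hA.ne', div_mul_cancel₀ _ hC0.ne']
          ring
  have hlim : Tendsto (fun C : ℝ => A ^ (1 - θ) * C ^ θ) (𝓝[>] B) (𝓝 (A ^ (1 - θ) * B ^ θ)) :=
    ((Real.continuousAt_rpow_const B θ (Or.inr hθ0.le)).const_mul _).mono_left nhdsWithin_le_nhds
  exact ge_of_tendsto hlim (eventually_mem_nhdsWithin.mono key)

/-- A solution of the Lane–Emden equation that is `C¹` up to the origin satisfies the integrated
equation. -/
theorem rpow_mul_deriv_eq_neg_integral {M p : ℝ} (hM : 1 < M) (hp : 1 < p) {v : ℝ → ℝ}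
    (hv1 : ContDiffOn ℝ 1 v (Ico 0 1)) (hv2 : ContDiffOn ℝ 2 v (Ioo 0 1))
    (hode : ∀ t ∈ Ioo (0 : ℝ) 1,
      -(deriv (fun s : ℝ => s ^ (M - 1) * deriv v s) t) = t ^ (M - 1) * |v t| ^ (p - 1) * v t)
    {t : ℝ} (ht : t ∈ Ioo (0 : ℝ) 1) :
    t ^ (M - 1) * deriv v t = -∫ s in (0 : ℝ)..t, s ^ (M - 1) * |v s| ^ (p - 1) * v s := by
  have hsub : Icc 0 t ⊆ Ico (0 : ℝ) 1 := fun s hs => ⟨hs.1, hs.2.trans_lt ht.2⟩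
  have hvc : ContinuousOn v (Icc 0 t) := hv1.continuousOn.mono hsub
  have hgc : ContinuousOn (derivWithin v (Ico 0 1)) (Icc 0 t) :=
    (hv1.continuousOn_derivWithin (uniqueDiffOn_Ico 0 1) le_rfl).mono hsub
  have hpow : ContinuousOn (fun s : ℝ => s ^ (M - 1)) (Icc 0 t) :=
    continuousOn_id.rpow_const fun s _ => Or.inr (by linarith)
  have hgd : ∀ s ∈ Ioo (0 : ℝ) 1, derivWithin v (Ico 0 1) s = deriv v s := fun s hs =>
    derivWithin_of_mem_nhds (Ico_mem_nhds hs.1 hs.2)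
  have hderiv : ∀ s ∈ Ioo 0 t, HasDerivAt (fun s : ℝ => s ^ (M - 1) * derivWithin v (Ico 0 1) s)
      (-(s ^ (M - 1) * |v s| ^ (p - 1) * v s)) s := by
    intro s hs
    have hs1 : s ∈ Ioo (0 : ℝ) 1 := ⟨hs.1, hs.2.trans ht.2⟩
    have hnhds : Ioo (0 : ℝ) 1 ∈ 𝓝 s := Ioo_mem_nhds hs1.1 hs1.2
    have hd2 : DifferentiableAt ℝ (deriv v) s :=
      ((hv2.deriv_of_isOpen (m := 1) isOpen_Ioo (by norm_num)).differentiableOn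
        (by norm_num)).differentiableAt hnhds
    have hd : DifferentiableAt ℝ (fun s : ℝ => s ^ (M - 1) * deriv v s) s :=
      (Real.differentiableAt_rpow_const_of_ne _ hs.1.ne').mul hd2
    have h := hd.hasDerivAt
    rw [neg_eq_iff_eq_neg.mp (hode s hs1)] at h
    refine h.congr_of_eventuallyEq ?_
    filter_upwards [hnhds] with x hx
    rw [hgd x hx]
  have hint : IntervalIntegrable (fun s => -(s ^ (M - 1) * |v s| ^ (p - 1) * v s))
      MeasureTheory.volume 0 t := by
    apply ContinuousOn.intervalIntegrable
    rw [uIcc_of_le ht.1.le]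
    exact ((hpow.mul (hvc.abs.rpow_const fun s _ => Or.inr (by linarith))).mul hvc).neg
  have h := intervalIntegral.integral_eq_sub_of_hasDerivAt_of_le
    (f := fun s : ℝ => s ^ (M - 1) * derivWithin v (Ico 0 1) s)
    ht.1.le (hpow.mul hgc) hderiv hint
  rw [intervalIntegral.integral_neg] at h
  simp only [hgd t ht, Real.zero_rpow (show M - 1 ≠ 0 by linarith), zero_mul, sub_zero] at h
  exact h.symm

/-- gradient estimate. If `v ∈ C¹([0,1)) ∩ C²((0,1))` solves the generalized
Lane–Emden equation on `(0,1)` with `v'(0) = 0` and `B = ∫_0^1 t^{M-1}|v|^{2M/(M-2)} dt < ∞`,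
then `|v'(t)| ≤ M^{θ-1} B^θ t^{1 - p(M-2)/2}` on `(0,1)`, where `θ = p(M-2)/(2M)`. -/
theorem stmt7 (M p : ℝ) (hM : 2 < M) (hp1 : 1 < p) (hp2 : p ≤ 2 * M / (M - 2))
    (v : ℝ → ℝ)
    (hv1 : ContDiffOn ℝ 1 v (Set.Ico 0 1)) (hv2 : ContDiffOn ℝ 2 v (Set.Ioo 0 1))
    (hode : ∀ t ∈ Set.Ioo (0 : ℝ) 1,
      -(deriv (fun s : ℝ => s ^ (M - 1) * deriv v s) t) = t ^ (M - 1) * |v t| ^ (p - 1) * v t)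
    (hd0 : deriv v 0 = 0)
    (hBfin : IntervalIntegrable (fun t : ℝ => t ^ (M - 1) * |v t| ^ (2 * M / (M - 2)))
      MeasureTheory.volume 0 1)
    (B : ℝ) (hB : B = ∫ t in (0 : ℝ)..1, t ^ (M - 1) * |v t| ^ (2 * M / (M - 2))) :
    ∀ t ∈ Set.Ioo (0 : ℝ) 1,
      |deriv v t| ≤ M ^ (p * (M - 2) / (2 * M) - 1) * B ^ (p * (M - 2) / (2 * M))
        * t ^ (1 - p * (M - 2) / 2) := by
  intro t ht
  have hM0 : 0 < M := by linarith
  have hM2 : 0 < M - 2 := by linarith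
  have hsub : Icc 0 t ⊆ Ico (0 : ℝ) 1 := fun s hs => ⟨hs.1, hs.2.trans_lt ht.2⟩
  have hvc : ContinuousOn v (Icc 0 t) := hv1.continuousOn.mono hsub
  set q := 2 * M / (M - 2) with hq
  set θ := p * (M - 2) / (2 * M) with hθ
  have hq0 : 0 < q := by positivity
  have hθ0 : 0 < θ := by positivity
  have hθ1 : θ ≤ 1 := by
    rw [hq, le_div_iff₀ hM2] at hp2
    rw [hθ, div_le_one (by positivity)]
    exact hp2
  have hqθ : q * θ = p := by
    rw [hq, hθ]
    field_simp
  have hpow : ContinuousOn (fun s : ℝ => s ^ (M - 1)) (Icc 0 t) :=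
    continuousOn_id.rpow_const fun s _ => Or.inr (by linarith)
  have hfint : ∫ s in (0 : ℝ)..t, s ^ (M - 1) = t ^ M / M := by
    rw [integral_rpow (Or.inl (by linarith)), sub_add_cancel, Real.zero_rpow hM0.ne', sub_zero]
  have hgB : ∫ s in (0 : ℝ)..t, s ^ (M - 1) * |v s| ^ q ≤ B := by
    rw [hB]
    refine intervalIntegral.integral_mono_interval le_rfl ht.1.le ht.2.le ?_ hBfin
    filter_upwards [MeasureTheory.ae_restrict_mem measurableSet_Ioc] with s hs
    exact mul_nonneg (Real.rpow_nonneg hs.1.le _) (Real.rpow_nonneg (abs_nonneg _) _)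
  have hHolder := integral_geom_mean_le (f := fun s : ℝ => s ^ (M - 1))
    (g := fun s => s ^ (M - 1) * |v s| ^ q) ht.1.le hpow
    (hpow.mul (hvc.abs.rpow_const fun s _ => Or.inr hq0.le))
    (fun s hs => Real.rpow_nonneg hs.1 _)
    (fun s hs => mul_nonneg (Real.rpow_nonneg hs.1 _) (Real.rpow_nonneg (abs_nonneg _) _))
    hθ0 hθ1 (div_pos (Real.rpow_pos_of_pos ht.1 M) hM0) hfint.le hgB
  have hflux : t ^ (M - 1) * |deriv v t| ≤ (t ^ M / M) ^ (1 - θ) * B ^ θ := by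
    have htpos : 0 < t ^ (M - 1) := Real.rpow_pos_of_pos ht.1 _
    rw [← abs_of_pos htpos, ← abs_mul,
      rpow_mul_deriv_eq_neg_integral (by linarith) hp1 hv1 hv2 hode ht, abs_neg]
    refine ((intervalIntegral.abs_integral_le_integral_abs ht.1.le).trans_eq ?_).trans hHolder
    refine intervalIntegral.integral_congr fun s hs => ?_
    rw [uIcc_of_le ht.1.le] at hs
    have hs0 : 0 ≤ s ^ (M - 1) := Real.rpow_nonneg hs.1 _
    have hv0 := abs_nonneg (v s)
    simp only [abs_mul, abs_of_nonneg hs0, abs_of_nonneg (Real.rpow_nonneg hv0 (p - 1))]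
    rw [Real.mul_rpow hs0 (Real.rpow_nonneg hv0 q), ← Real.rpow_mul hv0, hqθ, ← mul_assoc,
      ← Real.rpow_add' hs0 (by norm_num), sub_add_cancel, Real.rpow_one, mul_assoc]
    nth_rw 2 [← Real.rpow_one |v s|]
    rw [← Real.rpow_add' hv0 (by linarith), sub_add_cancel]
  have hexp : M * (1 - θ) = (M - 1) + (1 - p * (M - 2) / 2) := by
    rw [hθ]
    field_simp
    ring
  rw [Real.div_rpow (Real.rpow_nonneg ht.1.le _) hM0.le, ← Real.rpow_mul ht.1.le, hexp,
    Real.rpow_add ht.1, div_eq_mul_inv, ← Real.rpow_neg hM0.le, neg_sub] at hflux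
  refine le_of_mul_le_mul_left (hflux.trans_eq ?_) (Real.rpow_pos_of_pos ht.1 (M - 1))
  ring
end

section
/- Let M > 2 be real, p_M = (M+2)/(M-2), and m ≥ 2 an integer. For each p ∈ (1, p_M) let v_p be a C² solution on [0,1] of the generalized Lane–Emden equation with exponent p having exactly m nodal zones, with v_p(0) > 0, v_p'(0) = 0, v_p(1) = 0, and assume the uniform energy bound: there exist C > 0 and δ > 0 such that ∫_0^1 t^{M-1} v_p'(t)² dt ≤ C for all p ∈ (p_M − δ, p_M). Then, as p → p_M⁻, for every i = 1, …, m−1 the extremal values satisfy 𝓜_{i,p} → +∞ and the zeros and extremal points satisfy t_{i,p} → 0 and s_{i,p} → 0. -/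
open Real Filter Set Topology

/-- `v` solves the generalized radial Lane–Emden equation on `(0,1)` with derivative `u`,
both continuous up to the boundary. -/
structure IsLaneEmden (M p : ℝ) (v u : ℝ → ℝ) : Prop where
  continuousOn : ContinuousOn v (Icc 0 1)
  continuousOn_deriv : ContinuousOn u (Icc 0 1)
  hasDerivAt : ∀ x ∈ Ioo (0 : ℝ) 1, HasDerivAt v (u x) x
  hasDerivAt_deriv : ∀ x ∈ Ioo (0 : ℝ) 1,
    HasDerivAt u (-((M - 1) / x * u x) - |v x| ^ (p - 1) * v x) x

/-- A `C²` solution of the divergence-form equation satisfies `IsLaneEmden`. -/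
theorem IsLaneEmden.of_contDiffOn {M p : ℝ} {v : ℝ → ℝ}
    (hreg : ContDiffOn ℝ 2 v (Icc 0 1))
    (hode : ∀ x ∈ Ioo (0 : ℝ) 1,
      -(deriv (fun y : ℝ => y ^ (M - 1) * deriv v y) x) = x ^ (M - 1) * |v x| ^ (p - 1) * v x) :
    IsLaneEmden M p v (derivWithin v (Icc 0 1)) := by
  have hnhds : ∀ x ∈ Ioo (0 : ℝ) 1, Icc (0 : ℝ) 1 ∈ 𝓝 x := fun x hx => Icc_mem_nhds hx.1 hx.2
  have hu : ContDiffOn ℝ 1 (derivWithin v (Icc 0 1)) (Icc 0 1) :=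
    hreg.derivWithin (uniqueDiffOn_Icc one_pos) (by norm_num)
  have hd : ∀ x ∈ Ioo (0 : ℝ) 1, deriv v x = derivWithin v (Icc 0 1) x :=
    fun x hx => (derivWithin_of_mem_nhds (hnhds x hx)).symm
  refine ⟨hreg.continuousOn, hu.continuousOn, fun x hx => ?_, fun x hx => ?_⟩
  · rw [← hd x hx]
    exact ((hreg.differentiableOn (by norm_num)).differentiableAt (hnhds x hx)).hasDerivAt
  · have hu' := ((hu.differentiableOn (by norm_num)).differentiableAt (hnhds x hx)).hasDerivAt
    have hprod := (hasDerivAt_rpow_const (p := M - 1) (Or.inl hx.1.ne')).mul hu'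
    have heq : (fun y : ℝ => y ^ (M - 1) * deriv v y) =ᶠ[𝓝 x]
        (fun y : ℝ => y ^ (M - 1)) * derivWithin v (Icc 0 1) := by
      filter_upwards [Ioo_mem_nhds hx.1 hx.2] with y hy
      simp [hd y hy]
    have h := hode x hx
    rw [heq.deriv_eq, hprod.deriv] at h
    have hpos : 0 < x ^ (M - 1) := rpow_pos_of_pos hx.1 _
    have hpow : x ^ (M - 1 - 1) = x ^ (M - 1) / x := rpow_sub_one hx.1.ne' _
    rw [hpow] at h
    refine HasDerivAt.congr_deriv hu' ?_
    have hx0 := hx.1.ne'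
    apply mul_left_cancel₀ hpos.ne'
    field_simp at h ⊢
    linear_combination -h

/-- In Emden–Fowler variables the nonlinearity is autonomous for `a = 2 / (p - 1)`. -/
theorem abs_rpow_mul_rpow_sub_one {a p x y : ℝ} (ha : a * (p - 1) = 2) (hx : 0 < x) :
    |x ^ a * y| ^ (p - 1) = x ^ 2 * |y| ^ (p - 1) := by
  rw [abs_mul, mul_rpow (abs_nonneg _) (abs_nonneg _), abs_of_pos (rpow_pos_of_pos hx _),
    ← rpow_mul hx.le, ha, rpow_two]

namespace IsLaneEmden

variable {M p : ℝ} {v u : ℝ → ℝ}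

/-- Derivative of the Emden–Fowler variable `x ^ a * v x`. -/
theorem hasDerivAt_emden (h : IsLaneEmden M p v u) (a : ℝ) {x : ℝ} (hx : x ∈ Ioo (0 : ℝ) 1) :
    HasDerivAt (fun y => y ^ a * v y) (x ^ a * (a * v x + x * u x) / x) x := by
  have := (hasDerivAt_rpow_const (p := a) (Or.inl hx.1.ne')).mul (h.hasDerivAt x hx)
  refine HasDerivAt.congr_deriv this ?_
  rw [rpow_sub_one hx.1.ne']
  have := hx.1.ne'
  field_simp

/-- The logarithmic derivative of the Emden–Fowler variable solves a first-order equation. -/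
theorem hasDerivAt_emden_logDeriv (h : IsLaneEmden M p v u) (a : ℝ) {x : ℝ}
    (hx : x ∈ Ioo (0 : ℝ) 1) :
    HasDerivAt (fun y => y ^ a * (a * v y + y * u y))
      (((2 * a - (M - 2)) * (x ^ a * (a * v x + x * u x)) + a * (M - 2 - a) * (x ^ a * v x)
        - x ^ 2 * |v x| ^ (p - 1) * (x ^ a * v x)) / x) x := by
  have := (hasDerivAt_rpow_const (p := a) (Or.inl hx.1.ne')).mul
    (((h.hasDerivAt x hx).const_mul a).add ((hasDerivAt_id x).mul (h.hasDerivAt_deriv x hx)))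
  refine HasDerivAt.congr_deriv this ?_
  rw [rpow_sub_one hx.1.ne']
  have := hx.1.ne'
  simp only [Pi.add_apply, Pi.mul_apply, id]
  field_simp
  ring

/-- The Emden–Fowler energy grows at most by the Dirichlet energy times `2 * a - (M - 2)`. -/
theorem sq_logDeriv_le (h : IsLaneEmden M p v u) {a C : ℝ} (hM : 2 < M) (hp : 1 < p)
    (ha : a * (p - 1) = 2) (hκ : 0 ≤ 2 * a - (M - 2))
    (hC : ∫ x in (0 : ℝ)..1, x ^ (M - 1) * u x ^ 2 ≤ C) {x : ℝ} (hx : x ∈ Icc (0 : ℝ) 1) :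
    (x ^ a * (a * v x + x * u x)) ^ 2 ≤ 2 * (2 * a - (M - 2)) * C
      + (a * (M - 2 - a) + 2 * (2 * a - (M - 2)) * a) * (x ^ a * v x) ^ 2 := by
  have ha0 : 0 < a := by linarith
  set κ := 2 * a - (M - 2) with hκdef
  set w : ℝ → ℝ := fun y => y ^ a * v y with hw
  set z : ℝ → ℝ := fun y => y ^ a * (a * v y + y * u y) with hz
  set f : ℝ → ℝ := fun y => y ^ (M - 1) * u y ^ 2 with hf
  set J : ℝ → ℝ := fun y => ∫ r in (0 : ℝ)..y, f r with hJ
  have hcpow : ContinuousOn (fun y : ℝ => y ^ a) (Icc 0 1) :=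
    (continuous_rpow_const ha0.le).continuousOn
  have hcf : ContinuousOn f (Icc 0 1) :=
    (continuous_rpow_const (by linarith)).continuousOn.mul (h.continuousOn_deriv.pow 2)
  have hif : ∀ y ∈ Icc (0 : ℝ) 1, IntervalIntegrable f MeasureTheory.volume 0 y := by
    intro y hy
    apply ContinuousOn.intervalIntegrable
    rw [uIcc_of_le hy.1]
    exact hcf.mono (Icc_subset_Icc_right hy.2)
  have hcw : ContinuousOn w (Icc 0 1) := hcpow.mul h.continuousOn
  have hcz : ContinuousOn z (Icc 0 1) := hcpow.mul
    ((continuousOn_const.mul h.continuousOn).add (continuousOn_id.mul h.continuousOn_deriv))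
  have hcJ : ContinuousOn J (Icc 0 1) := by
    have := intervalIntegral.continuousOn_primitive_interval (f := f) (a := 0) (b := 1)
      (μ := MeasureTheory.volume) (by
        rw [uIcc_of_le zero_le_one]; exact hcf.integrableOn_Icc)
    rwa [uIcc_of_le zero_le_one] at this
  have hJC : J x ≤ C := by
    refine le_trans ?_ hC
    apply intervalIntegral.integral_mono_interval le_rfl hx.1 hx.2 _ (hif 1 (by simp))
    filter_upwards [MeasureTheory.ae_restrict_mem measurableSet_Ioc] with y hy
    exact mul_nonneg (rpow_nonneg hy.1.le _) (sq_nonneg _)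
  set G : ℝ → ℝ := fun y => z y ^ 2 / 2 - a * (M - 2 - a) * w y ^ 2 / 2
    + |w y| ^ (p + 1) / (p + 1) - κ * a * w y ^ 2 - κ * J y with hG
  have hcG : ContinuousOn G (Icc 0 1) := by
    have h1 : ContinuousOn (fun y => |w y| ^ (p + 1)) (Icc 0 1) :=
      hcw.abs.rpow_const (fun _ _ => Or.inr (by linarith))
    fun_prop
  have hG' : ∀ y ∈ Ioo (0 : ℝ) 1, HasDerivAt G
      ((κ * z y ^ 2 - 2 * κ * a * w y * z y) / y - κ * f y) y := by
    intro y hy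
    have h1 : HasDerivAt w (z y / y) y := h.hasDerivAt_emden a hy
    have h2 : HasDerivAt z ((κ * z y + a * (M - 2 - a) * w y - |w y| ^ (p - 1) * w y) / y) y := by
      rw [show |w y| ^ (p - 1) = _ from abs_rpow_mul_rpow_sub_one ha hy.1]
      exact h.hasDerivAt_emden_logDeriv a hy
    have h3 : HasDerivAt (fun y => |w y| ^ (p + 1)) _ y :=
      (hasDerivAt_abs_rpow (w y) (p := p + 1) (by linarith)).comp y h1
    have h4 : HasDerivAt J (f y) y :=
      intervalIntegral.integral_hasDerivAt_right (hif y ⟨hy.1.le, hy.2.le⟩)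
        (hcf.mono Ioo_subset_Icc_self |>.stronglyMeasurableAtFilter isOpen_Ioo y hy)
        (hcf.continuousAt (Icc_mem_nhds hy.1 hy.2))
    have h5 := ((((h2.pow 2).div_const 2).sub
      (((h1.pow 2).const_mul (a * (M - 2 - a))).div_const 2)).add
      (h3.div_const (p + 1))).sub ((h1.pow 2).const_mul (κ * a)) |>.sub (h4.const_mul κ)
    refine HasDerivAt.congr_deriv h5 ?_
    have hy0 := hy.1.ne'
    have hp1 : p + 1 ≠ 0 := by linarith
    rw [show p + 1 - 2 = p - 1 by ring]
    field_simp
    push_cast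
    ring
  have hanti : AntitoneOn G (Icc 0 1) := by
    apply antitoneOn_of_deriv_nonpos (convex_Icc 0 1) hcG
    · rw [interior_Icc]
      exact fun y hy => (hG' y hy).differentiableAt.differentiableWithinAt
    · rw [interior_Icc]
      intro y hy
      rw [(hG' y hy).deriv]
      have hpow : (y ^ a) ^ 2 * y ≤ y ^ (M - 1) := by
        rw [← rpow_natCast, ← rpow_mul hy.1.le, ← rpow_add_one hy.1.ne']
        exact rpow_le_rpow_of_exponent_ge hy.1 hy.2.le (by push_cast; linarith)
      have hzy : z y = a * w y + y ^ a * y * u y := by simp only [hz, hw]; ring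
      have hle : (z y ^ 2 - 2 * a * w y * z y) / y ≤ f y := by
        rw [div_le_iff₀ hy.1, hzy]
        have := mul_le_mul_of_nonneg_right hpow (mul_nonneg (sq_nonneg (u y)) hy.1.le)
        simp only [hf]
        nlinarith [sq_nonneg (a * w y)]
      have := mul_le_mul_of_nonneg_left hle hκ
      have heq : (κ * z y ^ 2 - 2 * κ * a * w y * z y) / y
          = κ * ((z y ^ 2 - 2 * a * w y * z y) / y) := by ring
      linarith
  have hGx := hanti (left_mem_Icc.2 zero_le_one) hx hx.1
  have hG0 : G 0 = 0 := by
    simp [hG, hw, hz, hJ, zero_rpow ha0.ne', zero_rpow (show p + 1 ≠ 0 by linarith)]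
  rw [hG0] at hGx
  have hnn : 0 ≤ |w x| ^ (p + 1) / (p + 1) :=
    div_nonneg (rpow_nonneg (abs_nonneg _) _) (by linarith)
  have hκJ := mul_le_mul_of_nonneg_left hJC hκ
  change z x ^ 2 ≤ 2 * κ * C + (a * (M - 2 - a) + 2 * κ * a) * w x ^ 2
  simp only [hG] at hGx
  linarith

/-- Decay bound for the Emden–Fowler variable, integrated backwards from `v 1 = 0`. -/
theorem rpow_mul_abs_le (h : IsLaneEmden M p v u) {a C : ℝ} (hM : 2 < M) (hp : 1 < p)
    (ha : a * (p - 1) = 2) (hκ : 0 ≤ 2 * a - (M - 2)) (haM : a ≤ M - 2) (hκ1 : 2 * a - (M - 2) ≤ 1)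
    (hv1 : v 1 = 0) (hC : ∫ x in (0 : ℝ)..1, x ^ (M - 1) * u x ^ 2 ≤ C)
    {x : ℝ} (hx : x ∈ Ioc (0 : ℝ) 1) :
    (x ^ M * (x ^ a * |v x|)) ^ 2 ≤ 2 * (2 * a - (M - 2)) * C / M ^ 2 := by
  set A := 2 * (2 * a - (M - 2)) * C / M ^ 2 with hA
  have hM0 : 0 < M := by linarith
  have hC0 : 0 ≤ C := le_trans (intervalIntegral.integral_nonneg zero_le_one
    fun r hr => mul_nonneg (rpow_nonneg hr.1 _) (sq_nonneg _)) hC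
  have hA0 : 0 ≤ A := by positivity
  have hz : ∀ y ∈ Icc (0 : ℝ) 1,
      (y ^ a * (a * v y + y * u y)) ^ 2 ≤ M ^ 2 * (A + (y ^ a * v y) ^ 2) := by
    intro y hy
    refine (h.sq_logDeriv_le hM hp ha hκ hC hy).trans ?_
    have hAM : M ^ 2 * A = 2 * (2 * a - (M - 2)) * C := by rw [hA]; field_simp
    have : a * (M - 2 - a) + 2 * (2 * a - (M - 2)) * a ≤ M ^ 2 := by nlinarith
    nlinarith [mul_le_mul_of_nonneg_right this (sq_nonneg (y ^ a * v y))]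
  set H : ℝ → ℝ := fun y => y ^ (2 * M) * (A + (y ^ a * v y) ^ 2) with hH
  have hmono : MonotoneOn H (Icc x 1) := by
    have hH' : ∀ y ∈ Ioo x 1, HasDerivAt H (y ^ (2 * M) / y *
        (2 * M * (A + (y ^ a * v y) ^ 2)
          + 2 * (y ^ a * v y) * (y ^ a * (a * v y + y * u y)))) y := by
      intro y hy
      have hy0 : 0 < y := hx.1.trans hy.1
      have h1 := (hasDerivAt_rpow_const (p := 2 * M) (Or.inl hy0.ne')).mul
        (((h.hasDerivAt_emden a ⟨hy0, hy.2⟩).pow 2).const_add A)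
      refine HasDerivAt.congr_deriv h1 ?_
      rw [rpow_sub_one hy0.ne']
      have := hy0.ne'
      simp only [Pi.pow_apply]
      field_simp
      push_cast
      ring
    apply monotoneOn_of_deriv_nonneg (convex_Icc x 1)
    · intro y hy
      have hy0 : 0 < y := hx.1.trans_le hy.1
      have hv : ContinuousWithinAt v (Icc x 1) y :=
        (h.continuousOn y ⟨hy0.le, hy.2⟩).mono (Icc_subset_Icc_left hx.1.le)
      exact (continuousAt_rpow_const _ _ (Or.inl hy0.ne')).continuousWithinAt.mul
        (continuousWithinAt_const.add
          (((continuousAt_rpow_const _ _ (Or.inl hy0.ne')).continuousWithinAt.mul hv).pow 2))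
    · rw [interior_Icc]
      exact fun y hy => (hH' y hy).differentiableAt.differentiableWithinAt
    · rw [interior_Icc]
      intro y hy
      have hy0 : 0 < y := hx.1.trans hy.1
      rw [(hH' y hy).deriv]
      refine mul_nonneg (div_nonneg (rpow_nonneg hy0.le _) hy0.le) ?_
      have hzy := hz y ⟨hy0.le, hy.2.le⟩
      set W := y ^ a * v y
      set Z := y ^ a * (a * v y + y * u y)
      have hA1 : 0 ≤ M ^ 2 * A := by positivity
      have hsq : 0 ≤ (M * W + Z) ^ 2 := sq_nonneg _
      have : 0 ≤ M * (2 * M * (A + W ^ 2) + 2 * W * Z) := by nlinarith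
      exact nonneg_of_mul_nonneg_right this hM0
  have hx1 := hmono (left_mem_Icc.2 hx.2) (right_mem_Icc.2 hx.2) hx.2
  have hH1 : H 1 = A := by simp [hH, hv1]
  rw [hH1] at hx1
  have hpow : x ^ (2 * M) = (x ^ M) ^ 2 := by
    rw [← rpow_natCast, ← rpow_mul hx.1.le]; congr 1; push_cast; ring
  simp only [hH] at hx1
  rw [hpow] at hx1
  rw [mul_pow, mul_pow, sq_abs]
  nlinarith [mul_nonneg (sq_nonneg (x ^ M)) hA0]

/-- In a nodal zone away from the origin the Emden–Fowler variable cannot stay small. -/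
theorem exists_le_sq_mul_rpow (h : IsLaneEmden M p v u) {a l r σ : ℝ}
    (hl : 0 < l) (hlr : l < r) (hr : r ≤ 1) (hvl : v l = 0) (hvr : v r = 0)
    (hσ : ∀ x ∈ Ioo l r, 0 < σ * v x) :
    ∃ x ∈ Ioo l r, a * (M - 2 - a) ≤ x ^ 2 * |v x| ^ (p - 1) := by
  by_contra! hcon
  have hsub : ∀ x ∈ Ioo l r, x ∈ Ioo (0 : ℝ) 1 := fun x hx => ⟨hl.trans hx.1, hx.2.trans_le hr⟩
  set κ := 2 * a - (M - 2) with hκ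
  set w : ℝ → ℝ := fun y => σ * (y ^ a * v y) with hw
  set z : ℝ → ℝ := fun y => y ^ a * (a * v y + y * u y) with hz
  have hw' : ∀ x ∈ Ioo l r, HasDerivAt w (σ * (z x / x)) x :=
    fun x hx => (h.hasDerivAt_emden a (hsub x hx)).const_mul σ
  have hcw : ContinuousOn w (Icc l r) := by
    intro y hy
    have hy0 : 0 < y := hl.trans_le hy.1
    have hv : ContinuousWithinAt v (Icc l r) y :=
      (h.continuousOn y ⟨hy0.le, hy.2.trans hr⟩).mono (Icc_subset_Icc hl.le hr)
    exact continuousWithinAt_const.mul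
      ((continuousAt_rpow_const _ _ (Or.inl hy0.ne')).continuousWithinAt.mul hv)
  obtain ⟨c, hc, hc0⟩ := exists_hasDerivAt_eq_zero hlr hcw (by simp [hw, hvl, hvr]) hw'
  have hzc : σ * z c = 0 := by
    have := (hsub c hc).1.ne'
    field_simp at hc0
    simpa using hc0
  set q : ℝ → ℝ := fun y => y ^ (-κ) * (σ * z y) with hq
  have hq' : ∀ x ∈ Ioo l r, HasDerivAt q (x ^ (-κ) / x * (x ^ a * (σ * v x)) *
      (a * (M - 2 - a) - x ^ 2 * |v x| ^ (p - 1))) x := by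
    intro x hx
    have hx0 := (hsub x hx).1
    have h1 := (hasDerivAt_rpow_const (p := -κ) (Or.inl hx0.ne')).mul
      ((h.hasDerivAt_emden_logDeriv a (hsub x hx)).const_mul σ)
    refine HasDerivAt.congr_deriv h1 ?_
    rw [rpow_sub_one hx0.ne']
    have := hx0.ne'
    field_simp
    ring
  have hqmono : StrictMonoOn q (Ioo l r) := by
    apply strictMonoOn_of_deriv_pos (convex_Ioo l r)
      (fun x hx => (hq' x hx).continuousAt.continuousWithinAt)
    rw [interior_Ioo]
    intro x hx
    have hx0 := (hsub x hx).1
    rw [(hq' x hx).deriv]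
    have := sub_pos.2 (hcon x hx)
    have := hσ x hx
    have := rpow_pos_of_pos hx0 a
    have := rpow_pos_of_pos hx0 (-κ)
    positivity
  have hwmono : StrictMonoOn w (Icc c r) := by
    apply strictMonoOn_of_deriv_pos (convex_Icc c r) (hcw.mono (Icc_subset_Icc_left hc.1.le))
    rw [interior_Icc]
    intro x hx
    have hx' : x ∈ Ioo l r := ⟨hc.1.trans hx.1, hx.2⟩
    have hx0 := (hsub x hx').1
    rw [(hw' x hx').deriv]
    have hqx := hqmono hc hx' hx.1
    simp only [hq, hzc, mul_zero] at hqx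
    have := pos_of_mul_pos_right hqx (rpow_nonneg hx0.le _)
    rw [← mul_div_assoc]
    positivity
  have hlt := hwmono (left_mem_Icc.2 hc.2.le) (right_mem_Icc.2 hc.2.le) hc.2
  have hpos : 0 < w c := by
    have := mul_pos (rpow_pos_of_pos (hsub c hc).1 a) (hσ c hc)
    simp only [hw]
    linarith
  have hwr : w r = 0 := by simp [hw, hvr]
  linarith

/-- Concentration in a nodal zone `(l, r)` away from the origin, with extremal
point `s`: both `l` and `s` are at most `η`, and `|v s|` is large when `η` is small. -/
theorem nodal_zone_bounds (h : IsLaneEmden M p v u) {a c C η l r s σ : ℝ} (hM : 2 < M)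
    (hp : 1 < p) (ha : a * (p - 1) = 2) (hκ : 0 ≤ 2 * a - (M - 2)) (haM : a ≤ M - 2)
    (hκ1 : 2 * a - (M - 2) ≤ 1) (hc : 0 < c) (hc1 : c ≤ 1) (hcab : c ≤ a * (M - 2 - a))
    (hv1 : v 1 = 0) (hC : ∫ x in (0 : ℝ)..1, x ^ (M - 1) * u x ^ 2 ≤ C)
    (hη : 0 ≤ η) (hηC : 2 * (2 * a - (M - 2)) * C / M ^ 2 ≤ (c ^ M * η ^ (2 * M)) ^ 2)
    (hl : 0 < l) (hlr : l < r) (hr : r ≤ 1) (hvl : v l = 0) (hvr : v r = 0)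
    (hσ : ∀ x ∈ Ioo l r, 0 < σ * v x) (hs : s ∈ Ico l r)
    (hmax : ∀ x ∈ Icc l r, |v x| ≤ |v s|) :
    l ≤ η ∧ s ≤ η ∧ c ^ M ≤ η ^ ((M - 2) / 2) * |v s| := by
  have hM0 : 0 < M := by linarith
  have hcM : 0 < c ^ M := rpow_pos_of_pos hc M
  have hdecay : ∀ x ∈ Ioc (0 : ℝ) 1, x ^ M * (x ^ a * |v x|) ≤ c ^ M * η ^ (2 * M) := fun x hx =>
    abs_le_of_sq_le_sq' ((h.rpow_mul_abs_le hM hp ha hκ haM hκ1 hv1 hC hx).trans hηC)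
      (mul_nonneg hcM.le (rpow_nonneg hη _)) |>.2
  have hle : ∀ x ∈ Ioc (0 : ℝ) 1, x ^ (2 * M) * c ^ M ≤ c ^ M * η ^ (2 * M) → x ≤ η := by
    intro x hx hxη
    rw [mul_comm] at hxη
    exact (rpow_le_rpow_iff hx.1.le hη (by positivity)).1 (le_of_mul_le_mul_left hxη hcM)
  obtain ⟨x, hx, hxab⟩ := h.exists_le_sq_mul_rpow (a := a) hl hlr hr hvl hvr hσ
  have hx0 : x ∈ Ioc (0 : ℝ) 1 := ⟨hl.trans hx.1, hx.2.le.trans hr⟩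
  have hs0 : s ∈ Ioc (0 : ℝ) 1 := ⟨hl.trans_le hs.1, hs.2.le.trans hr⟩
  have hxa : 0 < x ^ a := rpow_pos_of_pos hx0.1 a
  have hwx : c ^ M ≤ x ^ a * |v x| := by
    have hw0 : 0 ≤ x ^ a * |v x| := by positivity
    have h1 : c ≤ (x ^ a * |v x|) ^ (p - 1) := by
      have := abs_rpow_mul_rpow_sub_one (y := v x) ha hx0.1
      rw [abs_mul, abs_of_pos hxa] at this
      rw [this]
      exact hcab.trans hxab
    have h2 : c ^ (a / 2) ≤ x ^ a * |v x| := by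
      have := rpow_le_rpow hc.le h1 (show 0 ≤ a / 2 by linarith)
      rwa [← rpow_mul hw0, show (p - 1) * (a / 2) = 1 by linarith, rpow_one] at this
    exact (rpow_le_rpow_of_exponent_ge hc hc1 (by linarith)).trans h2
  have hxs : |v x| ≤ |v s| := hmax x ⟨hx.1.le, hx.2.le⟩
  have hxη : x ≤ η := by
    refine hle x hx0 (le_trans ?_ (hdecay x hx0))
    exact mul_le_mul (rpow_le_rpow_of_exponent_ge hx0.1 hx0.2 (by linarith)) hwx hcM.le
      (rpow_nonneg hx0.1.le _)
  refine ⟨hx.1.le.trans hxη, ?_, ?_⟩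
  · refine hle s hs0 (le_trans ?_ (hdecay s hs0))
    have h1 : c ^ M ≤ |v s| := by
      refine hwx.trans (le_trans ?_ hxs)
      exact mul_le_of_le_one_left (abs_nonneg _) (rpow_le_one hx0.1.le hx0.2 (by linarith))
    rw [← mul_assoc, ← rpow_add hs0.1]
    exact mul_le_mul (rpow_le_rpow_of_exponent_ge hs0.1 hs0.2 (by linarith)) h1 hcM.le
      (rpow_nonneg hs0.1.le _)
  · refine hwx.trans (mul_le_mul ?_ hxs (abs_nonneg _) (rpow_nonneg hη _))
    exact (rpow_le_rpow_of_exponent_ge hx0.1 hx0.2 (by linarith)).trans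
      (rpow_le_rpow hx0.1.le hxη (by linarith))

end IsLaneEmden


/-- for a family `v_p` of C² solutions on `[0,1]` of the generalized Lane–Emden
equation with exponent `p ∈ (1, p_M)`, having exactly `m ≥ 2` nodal zones (zeros `t_{i,p}`,
extremal points `s_{i,p}`, extremal values `𝓜_{i,p}`), `v_p(0) > 0`, `v_p'(0) = 0`,
`v_p(1) = 0`, and a uniform energy bound near `p_M`, one has, as `p → p_M⁻`:
`𝓜_{i,p} → +∞`, `t_{i,p} → 0` and `s_{i,p} → 0` for every `i = 1, …, m-1`. -/
theorem stmt8 (M pM : ℝ) (hM : 2 < M) (hpM : pM = (M + 2) / (M - 2))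
    (m : ℕ) (hm : 2 ≤ m)
    (v : ℝ → ℝ → ℝ) (t s Mx : ℝ → ℕ → ℝ)
    (hreg : ∀ p ∈ Set.Ioo 1 pM, ContDiffOn ℝ 2 (v p) (Set.Icc 0 1))
    (hode : ∀ p ∈ Set.Ioo 1 pM, ∀ x ∈ Set.Ioo (0 : ℝ) 1,
      -(deriv (fun y : ℝ => y ^ (M - 1) * deriv (v p) y) x)
        = x ^ (M - 1) * |v p x| ^ (p - 1) * v p x)
    (hv0 : ∀ p ∈ Set.Ioo 1 pM, 0 < v p 0)
    (hd0 : ∀ p ∈ Set.Ioo 1 pM, deriv (v p) 0 = 0)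
    (hv1 : ∀ p ∈ Set.Ioo 1 pM, v p 1 = 0)
    (ht0 : ∀ p ∈ Set.Ioo 1 pM, t p 0 = 0)
    (htm : ∀ p ∈ Set.Ioo 1 pM, t p m = 1)
    (htmono : ∀ p ∈ Set.Ioo 1 pM, ∀ i < m, t p i < t p (i + 1))
    (htzero : ∀ p ∈ Set.Ioo 1 pM, ∀ i, 1 ≤ i → i ≤ m → v p (t p i) = 0)
    (hsign : ∀ p ∈ Set.Ioo 1 pM, ∀ i < m, ∀ x ∈ Set.Ioo (t p i) (t p (i + 1)),
      0 < (-1 : ℝ) ^ i * v p x)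
    (hs : ∀ p ∈ Set.Ioo 1 pM, ∀ i < m, s p i ∈ Set.Ico (t p i) (t p (i + 1)))
    (hMx : ∀ p ∈ Set.Ioo 1 pM, ∀ i < m, Mx p i = |v p (s p i)|)
    (hMxmax : ∀ p ∈ Set.Ioo 1 pM, ∀ i < m,
      ∀ x ∈ Set.Icc (t p i) (t p (i + 1)), |v p x| ≤ Mx p i)
    (C δ : ℝ) (hC : 0 < C) (hδ : 0 < δ)
    (henergy : ∀ p, pM - δ < p → 1 < p → p < pM →
      (∫ x in (0 : ℝ)..1, x ^ (M - 1) * (deriv (v p) x) ^ 2) ≤ C) :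
    ∀ i, 1 ≤ i → i ≤ m - 1 →
      Tendsto (fun p => Mx p i) (𝓝[<] pM) atTop ∧
      Tendsto (fun p => t p i) (𝓝[<] pM) (𝓝 0) ∧
      Tendsto (fun p => s p i) (𝓝[<] pM) (𝓝 0) := by
  have hM2 : 0 < M - 2 := by linarith
  have hM0 : 0 < M := by linarith
  have hpM1 : pM - 1 = 4 / (M - 2) := by rw [hpM]; field_simp; ring
  have hpM0 : 0 < pM - 1 := by rw [hpM1]; positivity
  set a : ℝ → ℝ := fun p => 2 / (p - 1) with ha
  set κ : ℝ → ℝ := fun p => 2 * a p - (M - 2) with hκ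
  set c : ℝ := min 1 ((M - 2) ^ 2 / 8) with hc
  have hc0 : 0 < c := by positivity
  set η : ℝ → ℝ := fun p => (√(2 * κ p * C / M ^ 2) / c ^ M) ^ (1 / (2 * M)) with hη
  have haM : a pM = (M - 2) / 2 := by simp only [ha, hpM1]; field_simp; norm_num
  have hacont : Tendsto a (𝓝[<] pM) (𝓝 ((M - 2) / 2)) := by
    rw [← haM]
    have : ContinuousAt a pM :=
      continuousAt_const.div (continuousAt_id.sub continuousAt_const) hpM0.ne'
    exact this.tendsto.mono_left nhdsWithin_le_nhds
  have hκlim : Tendsto κ (𝓝[<] pM) (𝓝 0) := by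
    have := (hacont.const_mul 2).sub_const (M - 2)
    simpa [mul_div_cancel₀] using this
  have hκpos : ∀ p ∈ Ioo 1 pM, 0 < κ p := by
    intro p hp
    have h1 : 0 < p - 1 := by linarith [hp.1]
    have h2 : a pM < a p := div_lt_div_of_pos_left two_pos h1 (by linarith [hp.2])
    simp only [hκ]
    linarith
  have hηpos : ∀ p ∈ Ioo 1 pM, 0 < η p := by
    intro p hp
    have := hκpos p hp
    have := rpow_pos_of_pos hc0 M
    positivity
  have hηlim : Tendsto η (𝓝[<] pM) (𝓝 0) := by
    have h1 : Tendsto (fun p => √(2 * κ p * C / M ^ 2) / c ^ M) (𝓝[<] pM) (𝓝 0) := by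
      have := (((hκlim.const_mul 2).mul_const C).div_const (M ^ 2)).sqrt.div_const (c ^ M)
      simpa using this
    have h2 := h1.rpow_const (p := 1 / (2 * M)) (Or.inr (by positivity))
    rwa [zero_rpow (by positivity)] at h2
  have hmem : ∀ᶠ p in 𝓝[<] pM, p ∈ Ioo 1 pM := Ioo_mem_nhdsLT (by linarith)
  intro i hi1 him
  have hbounds : ∀ᶠ p in 𝓝[<] pM, t p i ∈ Icc 0 (η p) ∧ s p i ∈ Icc 0 (η p) ∧
      c ^ M ≤ η p ^ ((M - 2) / 2) * Mx p i := by
    filter_upwards [hmem, Ioo_mem_nhdsLT (show pM - δ < pM by linarith),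
      hκlim.eventually_le_const one_pos,
      hacont.eventually_le_const (show (M - 2) / 2 < 3 * (M - 2) / 4 by linarith)]
      with p hp hpδ hκ1 ha34
    have hsol := IsLaneEmden.of_contDiffOn (hreg p hp) (hode p hp)
    have htlt : ∀ j k, j < k → k ≤ m → t p j < t p k := by
      intro j k hjk
      induction k, hjk using Nat.le_induction with
      | base => exact fun hk => htmono p hp j hk
      | succ k _ ih => exact fun hk => (ih (by lia)).trans (htmono p hp k hk)
    have htpos : 0 < t p i := by
      have := htlt 0 i hi1 (by lia)
      rwa [ht0 p hp] at this
    have htle : t p (i + 1) ≤ 1 := by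
      rcases (show i + 1 ≤ m by lia).eq_or_lt with heq | hlt
      · rw [heq, htm p hp]
      · have := htlt (i + 1) m hlt le_rfl
        rw [htm p hp] at this
        exact this.le
    have him' : i < m := by lia
    have hint : ∫ x in (0 : ℝ)..1, x ^ (M - 1) * derivWithin (v p) (Icc 0 1) x ^ 2 ≤ C := by
      refine le_trans (le_of_eq ?_) (henergy p hpδ.1 hp.1 hp.2)
      rw [intervalIntegral.integral_of_le zero_le_one, intervalIntegral.integral_of_le zero_le_one,
        MeasureTheory.integral_Ioc_eq_integral_Ioo, MeasureTheory.integral_Ioc_eq_integral_Ioo]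
      refine MeasureTheory.setIntegral_congr_fun measurableSet_Ioo fun x hx => ?_
      simp only [derivWithin_of_mem_nhds (Icc_mem_nhds hx.1 hx.2)]
    have hp1 : p - 1 ≠ 0 := by linarith [hp.1]
    have hκp := hκpos p hp
    have hηp := hηpos p hp
    have hηpow : c ^ M * η p ^ (2 * M) = √(2 * κ p * C / M ^ 2) := by
      have := rpow_pos_of_pos hc0 M
      simp only [hη]
      rw [← rpow_mul (by positivity), one_div_mul_cancel (by positivity), rpow_one]
      field_simp
    have hcab : c ≤ a p * (M - 2 - a p) := by
      refine (min_le_right _ _).trans ?_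
      have h1 : (M - 2) / 2 ≤ a p := by simp only [hκ] at hκp; linarith
      nlinarith
    obtain ⟨hb1, hb2, hb3⟩ := hsol.nodal_zone_bounds (a := a p) (c := c) (C := C) (η := η p)
      (s := s p i) hM hp.1 (div_mul_cancel₀ 2 hp1) hκp.le (by linarith) hκ1 hc0 (min_le_left _ _)
      hcab (hv1 p hp) hint hηp.le
      (by rw [hηpow, Real.sq_sqrt (by positivity)])
      htpos (htmono p hp i him') htle (htzero p hp i hi1 him'.le)
      (htzero p hp (i + 1) (by lia) him') (hsign p hp i him') (hs p hp i him')
      (fun x hx => hMx p hp i him' ▸ hMxmax p hp i him' x hx)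
    rw [hMx p hp i him']
    exact ⟨⟨htpos.le, hb1⟩, ⟨htpos.le.trans (hs p hp i him').1, hb2⟩, hb3⟩
  refine ⟨?_, ?_, ?_⟩
  · have hexp : 0 < (M - 2) / 2 := by linarith
    have hpow : Tendsto (fun p => η p ^ ((M - 2) / 2)) (𝓝[<] pM) (𝓝[>] 0) := by
      refine tendsto_nhdsWithin_iff.2 ⟨?_, ?_⟩
      · have := hηlim.rpow_const (p := (M - 2) / 2) (Or.inr hexp.le)
        rwa [zero_rpow hexp.ne'] at this
      · filter_upwards [hmem] with p hp using rpow_pos_of_pos (hηpos p hp) _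
    have hinv := (tendsto_inv_nhdsGT_zero.comp hpow).const_mul_atTop (rpow_pos_of_pos hc0 M)
    refine tendsto_atTop_mono' _ ?_ hinv
    filter_upwards [hbounds, hmem] with p hb hp
    rw [Function.comp_apply, ← div_eq_mul_inv,
      div_le_iff₀' (rpow_pos_of_pos (hηpos p hp) _)]
    exact hb.2.2
  · exact squeeze_zero' (hbounds.mono fun p hb => hb.1.1) (hbounds.mono fun p hb => hb.1.2) hηlim
  · exact squeeze_zero' (hbounds.mono fun p hb => hb.2.1.1)
      (hbounds.mono fun p hb => hb.2.1.2) hηlim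
end

section
/- Let M > 2 be real, p_M = (M+2)/(M-2), and m ≥ 2 an integer. For each p ∈ (1, p_M) let v_p be a C² solution on [0,1] of the generalized Lane–Emden equation with exponent p having exactly m nodal zones, with v_p(0) > 0, v_p'(0) = 0, v_p(1) = 0, and assume the uniform energy bound: there exist C > 0 and δ > 0 such that ∫_0^1 t^{M-1} v_p'(t)² dt ≤ C for all p ∈ (p_M − δ, p_M). Then for every i = 1, …, m−1 the rescaled functions ṽ_{i,p}(t) = |v_p(t / 𝓜̃_{i,p})| / 𝓜_{i,p}, defined for t ∈ (t_{i,p} 𝓜̃_{i,p}, t_{i+1,p} 𝓜̃_{i,p}), converge to V_M in C¹ locally on (0, +∞) as p → p_M⁻: for every compact K ⊂ (0,∞), eventually K ⊂ (t_{i,p} 𝓜̃_{i,p}, t_{i+1,p} 𝓜̃_{i,p}) and ṽ_{i,p} → V_M and ṽ_{i,p}' → V_M' uniformly on K. -/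
open Real Filter Set Topology

/-- The function `V_M`, the radial solution of the critical equation with `V_M 0 = 1`. -/
noncomputable def bubble (M x : ℝ) : ℝ := (1 + x ^ 2 / (M * (M - 2))) ^ (-(M - 2) / 2)

/-- The derivative of `bubble M`. -/
noncomputable def bubbleDeriv (M x : ℝ) : ℝ :=
  -(x / M) * (1 + x ^ 2 / (M * (M - 2))) ^ (-M / 2)

lemma one_le_bubble_base {M : ℝ} (hM : 2 < M) (x : ℝ) : 1 ≤ 1 + x ^ 2 / (M * (M - 2)) := by
  have : 0 < M * (M - 2) := mul_pos (by linarith) (by linarith)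
  have : 0 ≤ x ^ 2 / (M * (M - 2)) := by positivity
  linarith

lemma hasDerivAt_bubble_base (M x : ℝ) :
    HasDerivAt (fun y : ℝ => 1 + y ^ 2 / (M * (M - 2))) (2 * x / (M * (M - 2))) x := by
  simpa using (((hasDerivAt_id x).pow 2).div_const (M * (M - 2))).const_add 1

lemma bubble_pos {M : ℝ} (hM : 2 < M) (x : ℝ) : 0 < bubble M x :=
  rpow_pos_of_pos (by linarith [one_le_bubble_base hM x]) _

lemma bubble_le_one {M : ℝ} (hM : 2 < M) (x : ℝ) : bubble M x ≤ 1 :=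
  rpow_le_one_of_one_le_of_nonpos (one_le_bubble_base hM x) (by linarith)

lemma bubble_antitoneOn {M : ℝ} (hM : 2 < M) : AntitoneOn (bubble M) (Ici 0) := by
  intro x hx y _ hxy
  have h : 0 < M * (M - 2) := mul_pos (by linarith) (by linarith)
  have hx' : (0 : ℝ) ≤ x := hx
  apply rpow_le_rpow_of_nonpos (by linarith [one_le_bubble_base hM x]) _ (by linarith)
  gcongr

lemma hasDerivAt_bubble {M : ℝ} (hM : 2 < M) (x : ℝ) :
    HasDerivAt (bubble M) (bubbleDeriv M x) x := by
  have hq := one_le_bubble_base hM x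
  have h := (hasDerivAt_bubble_base M x).rpow_const (p := -(M - 2) / 2)
    (Or.inl (by linarith))
  refine HasDerivAt.congr_deriv (f := bubble M) h ?_
  have h1 : M ≠ 0 := by linarith
  have h2 : M - 2 ≠ 0 := by linarith
  rw [bubbleDeriv, show -(M - 2) / 2 - 1 = -M / 2 by ring]
  field_simp

lemma hasDerivAt_bubbleDeriv {M x : ℝ} (hM : 2 < M) (hx : 0 < x) :
    HasDerivAt (bubbleDeriv M)
      (-((M - 1) / x) * bubbleDeriv M x - bubble M x ^ ((M + 2) / (M - 2))) x := by
  have hq := one_le_bubble_base hM x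
  have h1 : M ≠ 0 := by linarith
  have h2 : M - 2 ≠ 0 := by linarith
  have h3 : x ≠ 0 := hx.ne'
  have h := (((hasDerivAt_id x).div_const M).neg).mul
    ((hasDerivAt_bubble_base M x).rpow_const (p := -M / 2) (Or.inl (by linarith)))
  refine HasDerivAt.congr_deriv (f := bubbleDeriv M) h ?_
  rw [bubble, bubbleDeriv, ← rpow_mul (by linarith),
    show -(M - 2) / 2 * ((M + 2) / (M - 2)) = -M / 2 - 1 by field_simp; ring,
    rpow_sub_one (by linarith)]
  have h4 : 1 + x ^ 2 / (M * (M - 2)) ≠ 0 := by linarith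
  generalize (1 + x ^ 2 / (M * (M - 2))) ^ (-M / 2) = Q
  have h5 : M * (M - 2) + x ^ 2 ≠ 0 := by
    have : 0 < M * (M - 2) := mul_pos (by linarith) (by linarith)
    positivity
  simp only [id, Pi.neg_apply]
  field_simp
  ring

lemma bubble_zero (M : ℝ) : bubble M 0 = 1 := by simp [bubble]

lemma bubbleDeriv_zero (M : ℝ) : bubbleDeriv M 0 = 0 := by simp [bubbleDeriv]

lemma continuous_bubbleDeriv {M : ℝ} (hM : 2 < M) : Continuous (bubbleDeriv M) := by
  refine continuous_iff_continuousAt.2 fun x => ?_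
  exact (continuousAt_id.div_const M).neg.mul
    ((hasDerivAt_bubble_base M x).continuousAt.rpow_const
      (Or.inl (by linarith [one_le_bubble_base hM x])))

lemma abs_rpow_sub_rpow_le_of_exponents {y p q : ℝ} (hy : 0 < y) (hy1 : y ≤ 1) (hp : 1 ≤ p)
    (hpq : p ≤ q) : |y ^ p - y ^ q| ≤ q - p := by
  have h1 : y ^ q ≤ y ^ p := rpow_le_rpow_of_exponent_ge hy hy1 hpq
  rw [abs_of_nonneg (by linarith)]
  have h2 : y ^ q = y ^ p * y ^ (q - p) := by rw [← rpow_add hy]; ring_nf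
  have h3 : 1 + log y * (q - p) ≤ y ^ (q - p) := by
    rw [rpow_def_of_pos hy]; linarith [add_one_le_exp (log y * (q - p))]
  have h4 : 1 - y⁻¹ ≤ log y := one_sub_inv_le_log_of_pos hy
  have h5 : y ^ p ≤ y := by
    simpa using rpow_le_rpow_of_exponent_ge hy hy1 hp
  have h6 : 0 < y ^ p := rpow_pos_of_pos hy p
  have h7 : y * -log y ≤ 1 := by
    have : y * y⁻¹ = 1 := mul_inv_cancel₀ hy.ne'
    nlinarith
  have h8 : 0 ≤ -log y := by linarith [log_nonpos hy.le hy1]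
  have h9 : y ^ p * -log y ≤ 1 := (mul_le_mul_of_nonneg_right h5 h8).trans h7
  calc y ^ p - y ^ q = y ^ p * (1 - y ^ (q - p)) := by rw [h2]; ring
    _ ≤ y ^ p * (-log y * (q - p)) := by gcongr; linarith
    _ = (y ^ p * -log y) * (q - p) := by ring
    _ ≤ 1 * (q - p) := mul_le_mul_of_nonneg_right h9 (by linarith)
    _ = q - p := one_mul _

lemma abs_rpow_sub_rpow_le_of_bases {a b p : ℝ} (ha : a ∈ Icc (0 : ℝ) 1) (hb : b ∈ Icc (0 : ℝ) 1)
    (hp : 1 ≤ p) : |a ^ p - b ^ p| ≤ p * |a - b| := by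
  refine (convex_Icc (0 : ℝ) 1).norm_image_sub_le_of_norm_hasDerivWithin_le
    (f := fun x : ℝ => x ^ p) (f' := fun x => p * x ^ (p - 1))
    (fun x _ => (hasDerivAt_rpow_const (Or.inr hp)).hasDerivWithinAt) (fun x hx => ?_) hb ha
  rw [norm_of_nonneg (mul_nonneg (by linarith) (rpow_nonneg hx.1 _))]
  have := rpow_le_one hx.1 hx.2 (by linarith : 0 ≤ p - 1)
  nlinarith

/-- Gronwall estimate for a damped second order equation; the (possibly large) damping
coefficient `k` does not enter the bound. -/
lemma sq_add_sq_le_of_damped {d d' g k : ℝ → ℝ} {σ B p ω : ℝ} (hp : 0 ≤ p)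
    (hd : ∀ x ∈ Ico σ B, HasDerivAt d (d' x) x)
    (hd' : ∀ x ∈ Ico σ B, HasDerivAt d' (-k x * d' x - g x) x)
    (hk : ∀ x ∈ Ico σ B, 0 ≤ k x)
    (hg : ∀ x ∈ Ico σ B, |g x| ≤ p * |d x| + ω) {x : ℝ} (hx : x ∈ Ico σ B) :
    d x ^ 2 + d' x ^ 2 ≤ (d σ ^ 2 + d' σ ^ 2 + ω ^ 2) * exp ((2 + p) * (x - σ)) := by
  let h : ℝ → ℝ := fun y => (d y ^ 2 + d' y ^ 2 + ω ^ 2) * exp (-((2 + p) * (y - σ)))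
  have hh : ∀ y ∈ Ico σ B, HasDerivAt h
      ((2 * d y * d' y + 2 * d' y * (-k y * d' y - g y)) * exp (-((2 + p) * (y - σ)))
        + (d y ^ 2 + d' y ^ 2 + ω ^ 2) * (exp (-((2 + p) * (y - σ))) * -(2 + p))) y := by
    intro y hy
    have e1 : HasDerivAt (fun y => exp (-((2 + p) * (y - σ))))
        (exp (-((2 + p) * (y - σ))) * -(2 + p)) y := by
      simpa using ((((hasDerivAt_id y).sub_const σ).const_mul (2 + p)).neg).exp
    have e2 := ((((hd y hy).pow 2).add ((hd' y hy).pow 2)).add_const (ω ^ 2)).mul e1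
    exact HasDerivAt.congr_deriv (f := h) e2 (by simp)
  have hanti : AntitoneOn h (Ico σ B) := by
    refine antitoneOn_of_hasDerivWithinAt_nonpos (convex_Ico σ B)
      (fun y hy => (hh y hy).continuousAt.continuousWithinAt)
      (fun y hy => (hh y (interior_subset hy)).hasDerivWithinAt) (fun y hy => ?_)
    replace hy := interior_subset hy
    have hE := exp_pos (-((2 + p) * (y - σ)))
    have h1 := hk y hy
    have h2 := hg y hy
    have h3 : -(d' y * g y) ≤ |d' y| * (p * |d y| + ω) := by
      calc -(d' y * g y) ≤ |d' y * g y| := neg_le_abs _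
        _ = |d' y| * |g y| := abs_mul _ _
        _ ≤ _ := by gcongr
    have h4 : d y * d' y ≤ |d y| * |d' y| := by rw [← abs_mul]; exact le_abs_self _
    have h5 : 0 ≤ k y * d' y ^ 2 := by positivity
    have h6 : 2 * d y * d' y + 2 * d' y * (-k y * d' y - g y)
        ≤ (2 + p) * (d y ^ 2 + d' y ^ 2 + ω ^ 2) := by
      have h7 := sq_abs (d y)
      have h8 := sq_abs (d' y)
      nlinarith [sq_nonneg (|d y| - |d' y|), sq_nonneg (|d' y| - ω), mul_nonneg hp
        (sq_nonneg (|d y| - |d' y|)), mul_nonneg hp (sq_nonneg ω), sq_nonneg (|d y|), sq_nonneg ω]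
    nlinarith
  have h1 := hanti ⟨le_rfl, hx.1.trans_lt hx.2⟩ hx hx.1
  simp only [h, sub_self, mul_zero, exp_zero, exp_neg] at h1
  have hE := exp_pos ((2 + p) * (x - σ))
  rw [← div_eq_mul_inv, div_le_iff₀ hE] at h1
  nlinarith [sq_nonneg ω]

/-- The flux form of the Lane–Emden equation, unfolded on the open interval. -/
lemma laneEmden_hasDerivAt {M p : ℝ} {v : ℝ → ℝ} (hreg : ContDiffOn ℝ 2 v (Icc 0 1))
    (hode : ∀ x ∈ Ioo (0 : ℝ) 1, -(deriv (fun y : ℝ => y ^ (M - 1) * deriv v y) x)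
        = x ^ (M - 1) * |v x| ^ (p - 1) * v x) {x : ℝ} (hx : x ∈ Ioo (0 : ℝ) 1) :
    HasDerivAt v (derivWithin v (Icc 0 1) x) x ∧
      HasDerivAt (derivWithin v (Icc 0 1))
        (-((M - 1) / x) * derivWithin v (Icc 0 1) x - |v x| ^ (p - 1) * v x) x := by
  have hnhds : Icc (0 : ℝ) 1 ∈ 𝓝 x := Icc_mem_nhds hx.1 hx.2
  have hw : ContDiffOn ℝ 1 (derivWithin v (Icc 0 1)) (Icc 0 1) :=
    hreg.derivWithin (uniqueDiffOn_Icc zero_lt_one) (by norm_num)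
  have h1 : DifferentiableAt ℝ v x := (hreg.contDiffAt hnhds).differentiableAt (by norm_num)
  have h2 : DifferentiableAt ℝ (derivWithin v (Icc 0 1)) x :=
    (hw.contDiffAt hnhds).differentiableAt (by norm_num)
  refine ⟨by rw [derivWithin_of_mem_nhds hnhds]; exact h1.hasDerivAt, ?_⟩
  have heq : (fun y : ℝ => y ^ (M - 1) * deriv v y) =ᶠ[𝓝 x]
      fun y => y ^ (M - 1) * derivWithin v (Icc 0 1) y := by
    filter_upwards [Ioo_mem_nhds hx.1 hx.2] with y hy
    rw [derivWithin_of_mem_nhds (Icc_mem_nhds hy.1 hy.2)]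
  have h3 := ((hasDerivAt_rpow_const (x := x) (p := M - 1) (Or.inl hx.1.ne')).mul
    h2.hasDerivAt).deriv
  have h4 := hode x hx
  rw [heq.deriv_eq] at h4
  have h5 : deriv (fun y => y ^ (M - 1) * derivWithin v (Icc 0 1) y) x = _ := h3
  rw [h5, rpow_sub_one hx.1.ne'] at h4
  refine h2.hasDerivAt.congr_deriv ?_
  have h6 : 0 < x ^ (M - 1) := rpow_pos_of_pos hx.1 _
  have h7 := hx.1.ne'
  apply mul_left_cancel₀ h6.ne'
  field_simp at h4 ⊢
  linear_combination -h4

/-- Pohozaev identity on the unit ball. -/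
lemma laneEmden_pohozaev {M p : ℝ} (hM : 2 < M) (hp : 1 < p) {v w : ℝ → ℝ}
    (hvc : ContinuousOn v (Icc 0 1)) (hwc : ContinuousOn w (Icc 0 1))
    (hv : ∀ x ∈ Ioo (0 : ℝ) 1, HasDerivAt v (w x) x)
    (hw : ∀ x ∈ Ioo (0 : ℝ) 1,
      HasDerivAt w (-((M - 1) / x) * w x - |v x| ^ (p - 1) * v x) x)
    (hv1 : v 1 = 0) :
    w 1 ^ 2 / 2 = (M / (p + 1) - (M - 2) / 2) * ∫ x in (0 : ℝ)..1, x ^ (M - 1) * w x ^ 2 := by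
  set c := M / (p + 1) - (M - 2) / 2 with hc
  let Q : ℝ → ℝ := fun x => x ^ M * (w x ^ 2 / 2 + |v x| ^ (p + 1) / (p + 1))
    + ((M - 2) / 2 + c) * (x ^ (M - 1) * (v x * w x))
  have hxc : ∀ a : ℝ, 0 ≤ a → ContinuousOn (fun x : ℝ => x ^ a) (Icc 0 1) := fun a ha =>
    (continuous_rpow_const ha).continuousOn
  have hQc : ContinuousOn Q (Icc 0 1) :=
    ((hxc M (by linarith)).mul (((hwc.pow 2).div_const 2).add
      ((hvc.abs.rpow_const fun _ _ => Or.inr (by linarith)).div_const _))).add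
      (continuousOn_const.mul ((hxc (M - 1) (by linarith)).mul (hvc.mul hwc)))
  have hQ : ∀ x ∈ Ioo (0 : ℝ) 1, HasDerivAt Q (c * (x ^ (M - 1) * w x ^ 2)) x := by
    intro x hx
    have hx0 := hx.1.ne'
    have e1 := hasDerivAt_rpow_const (x := x) (p := M) (Or.inl hx0)
    have e2 := hasDerivAt_rpow_const (x := x) (p := M - 1) (Or.inl hx0)
    have e3 := (hasDerivAt_abs_rpow (v x) (p := p + 1) (by linarith)).comp x (hv x hx)
    have e4 := (e1.mul ((((hw x hx).pow 2).div_const 2).add (e3.div_const (p + 1)))).add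
      ((e2.mul ((hv x hx).mul (hw x hx))).const_mul ((M - 2) / 2 + c))
    refine HasDerivAt.congr_deriv (f := Q) e4 ?_
    have e5 : |v x| ^ (p + 1) = |v x| ^ (p - 1) * v x ^ 2 := by
      rw [← sq_abs (v x), ← rpow_two,
        ← rpow_add_of_nonneg (abs_nonneg _) (by linarith) (by norm_num)]
      ring_nf
    have e6 : x ^ M = x ^ (M - 1) * x := by
      rw [← rpow_add_one hx0]; ring_nf
    have hp1 : p + 1 ≠ 0 := by linarith
    simp only [Function.comp_def, Pi.pow_apply, Pi.add_apply, Pi.mul_apply]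
    rw [show p + 1 - 2 = p - 1 by ring, rpow_sub_one hx0 (M - 1), e5, e6]
    simp only [hc]
    field_simp
    ring
  have hint : IntervalIntegrable (fun x => c * (x ^ (M - 1) * w x ^ 2)) MeasureTheory.volume 0 1 :=
    ContinuousOn.intervalIntegrable_of_Icc zero_le_one
      (continuousOn_const.mul ((hxc (M - 1) (by linarith)).mul (hwc.pow 2)))
  have h := intervalIntegral.integral_eq_sub_of_hasDerivAt_of_le zero_le_one hQc hQ hint
  rw [intervalIntegral.integral_const_mul] at h
  rw [h]
  have hp1 : p + 1 ≠ 0 := by linarith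
  simp [Q, hv1, zero_rpow (show M ≠ 0 by linarith), zero_rpow (show M - 1 ≠ 0 by linarith),
    zero_rpow hp1]

/-- The scale invariant energy is monotone, so its value at a critical point is controlled by
its value at the boundary. -/
lemma laneEmden_energy_le {M p : ℝ} (hM : 2 < M) (hp : 1 < p) (hpM : p < (M + 2) / (M - 2))
    {v w : ℝ → ℝ}
    (hvc : ContinuousOn v (Icc 0 1)) (hwc : ContinuousOn w (Icc 0 1))
    (hv : ∀ x ∈ Ioo (0 : ℝ) 1, HasDerivAt v (w x) x)
    (hw : ∀ x ∈ Ioo (0 : ℝ) 1,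
      HasDerivAt w (-((M - 1) / x) * w x - |v x| ^ (p - 1) * v x) x)
    (hv1 : v 1 = 0) {s : ℝ} (hs : s ∈ Ioo (0 : ℝ) 1) (hws : w s = 0) :
    s ^ (4 / (p - 1) + 2) * |v s| ^ (p + 1) ≤ (p + 1) * (w 1 ^ 2 / 2) := by
  obtain ⟨α, hα⟩ : ∃ α, α = 2 / (p - 1) := ⟨_, rfl⟩
  have hα0 : 0 < α := by rw [hα]; exact div_pos two_pos (by linarith)
  have hαp : α * (p - 1) = 2 := by rw [hα]; exact div_mul_cancel₀ _ (by linarith)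
  have hε : 0 < 2 * α - (M - 2) := by
    rw [lt_div_iff₀ (by linarith)] at hpM
    by_contra hcon
    nlinarith
  rw [show 4 / (p - 1) = 2 * α by rw [hα]; ring]
  let E : ℝ → ℝ := fun x => x ^ (2 * α + 2) * (w x ^ 2 / 2 + |v x| ^ (p + 1) / (p + 1))
    + α * (x ^ (2 * α + 1) * (v x * w x)) + α * (2 * α - (M - 2)) / 2 * (x ^ (2 * α) * v x ^ 2)
  have hxc : ∀ a : ℝ, 0 ≤ a → ContinuousOn (fun x : ℝ => x ^ a) (Icc 0 1) := fun a ha =>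
    (continuous_rpow_const ha).continuousOn
  have hEc : ContinuousOn E (Icc 0 1) :=
    (((hxc _ (by linarith)).mul (((hwc.pow 2).div_const 2).add
      ((hvc.abs.rpow_const fun _ _ => Or.inr (by linarith)).div_const _))).add
      (continuousOn_const.mul ((hxc _ (by linarith)).mul (hvc.mul hwc)))).add
      (continuousOn_const.mul ((hxc _ (by linarith)).mul (hvc.pow 2)))
  have hE : ∀ x ∈ Ioo (0 : ℝ) 1, HasDerivAt E
      ((2 * α - (M - 2)) * (x ^ (2 * α) / x * (x * w x + α * v x) ^ 2)) x := by
    intro x hx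
    have hx0 := hx.1.ne'
    have e0 := hasDerivAt_rpow_const (x := x) (p := 2 * α) (Or.inl hx0)
    have e1 := hasDerivAt_rpow_const (x := x) (p := 2 * α + 1) (Or.inl hx0)
    have e2 := hasDerivAt_rpow_const (x := x) (p := 2 * α + 2) (Or.inl hx0)
    have e3 := (hasDerivAt_abs_rpow (v x) (p := p + 1) (by linarith)).comp x (hv x hx)
    have e4 := ((e2.mul ((((hw x hx).pow 2).div_const 2).add (e3.div_const (p + 1)))).add
      ((e1.mul ((hv x hx).mul (hw x hx))).const_mul α)).add
      ((e0.mul ((hv x hx).pow 2)).const_mul (α * (2 * α - (M - 2)) / 2))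
    refine HasDerivAt.congr_deriv (f := E) e4 ?_
    have e5 : |v x| ^ (p + 1) = |v x| ^ (p - 1) * v x ^ 2 := by
      rw [← sq_abs (v x), ← rpow_two,
        ← rpow_add_of_nonneg (abs_nonneg _) (by linarith) (by norm_num)]
      ring_nf
    have e6 : x ^ (2 * α + 1) = x ^ (2 * α) * x := rpow_add_one hx0 _
    have e7 : x ^ (2 * α + 2) = x ^ (2 * α) * x ^ 2 := by
      rw [rpow_add hx.1, rpow_two]
    have hp1 : p + 1 ≠ 0 := by linarith
    simp only [Function.comp_def, Pi.pow_apply, Pi.add_apply, Pi.mul_apply]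
    rw [show p + 1 - 2 = p - 1 by ring, show 2 * α + 2 - 1 = 2 * α + 1 by ring,
      show 2 * α + 1 - 1 = 2 * α by ring, rpow_sub_one hx0 (2 * α), e5, e6, e7]
    generalize |v x| ^ (p - 1) = F
    generalize x ^ (2 * α) = X
    field_simp
    linear_combination (-2 * X * x ^ 2 * F * v x ^ 2) * hαp
  have hmono : MonotoneOn E (Icc 0 1) := by
    refine monotoneOn_of_hasDerivWithinAt_nonneg (convex_Icc 0 1) hEc
      (fun x hx => (hE x (by simpa using hx)).hasDerivWithinAt) (fun x hx => ?_)
    have hx' : x ∈ Ioo (0 : ℝ) 1 := by simpa using hx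
    have := hx'.1
    positivity
  have h := hmono (Ioo_subset_Icc_self hs) ⟨zero_le_one, le_rfl⟩ hs.2.le
  have hp1 : p + 1 ≠ 0 := by linarith
  simp only [E, hws, hv1, one_rpow, abs_zero, zero_rpow hp1] at h
  have hs0 := hs.1
  have h1 : 0 ≤ α * (2 * α - (M - 2)) / 2 * (s ^ (2 * α) * v s ^ 2) := by positivity
  have h2 : s ^ (2 * α + 2) * (|v s| ^ (p + 1) / (p + 1)) ≤ w 1 ^ 2 / 2 := by
    norm_num at h
    linarith
  rw [← mul_div_assoc, div_le_iff₀ (by linarith)] at h2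
  linarith

/-- On a nodal interval `(a, b)`, a rescaled solution is close in `C¹` to the bubble to the right
of its rescaled extremal point `σ = s L`, with a bound depending only on `σ` and `p`. -/
lemma laneEmden_nodal_close {M p : ℝ} (hM : 2 < M) (hp : 1 < p) (hpM : p < (M + 2) / (M - 2))
    {v w : ℝ → ℝ} (hvc : ContinuousOn v (Icc 0 1))
    (hv : ∀ x ∈ Ioo (0 : ℝ) 1, HasDerivAt v (w x) x)
    (hw : ∀ x ∈ Ioo (0 : ℝ) 1,
      HasDerivAt w (-((M - 1) / x) * w x - |v x| ^ (p - 1) * v x) x)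
    {a b s μ τ L X η : ℝ} (ha : 0 ≤ a) (hb : b ≤ 1) (hvb : v b = 0) (hs : s ∈ Ioo a b)
    (hτ : |τ| = 1) (hsign : ∀ x ∈ Ioo a b, 0 < τ * v x)
    (hμ : μ = |v s|) (hmax : ∀ x ∈ Ioo a b, |v x| ≤ μ) (hws : w s = 0)
    (hL : L = μ ^ ((p - 1) / 2)) (hX : 0 ≤ X)
    (hη : η = ((1 - bubble M (s * L)) ^ 2 + bubbleDeriv M (s * L) ^ 2
      + ((M + 2) / (M - 2) - p) ^ 2) * exp ((2 + p) * X))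
    (hηX : η < bubble M X ^ 2) :
    X < b * L ∧ ∀ x ∈ Icc (s * L) X,
      (|v (x / L)| / μ - bubble M x) ^ 2
        + (deriv (fun y => |v (y / L)| / μ) x - bubbleDeriv M x) ^ 2 ≤ η := by
  have habs : ∀ x ∈ Ioo a b, |v x| = τ * v x := fun x hx => by
    rw [← abs_of_pos (hsign x hx), abs_mul, hτ, one_mul]
  have hμ0 : 0 < μ := by rw [hμ, habs s hs]; exact hsign s hs
  have hL0 : 0 < L := by rw [hL]; exact rpow_pos_of_pos hμ0 _
  have hL2 : L ^ 2 = μ ^ (p - 1) := by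
    rw [hL, ← rpow_natCast, ← rpow_mul hμ0.le]; norm_num
  have hs0 : 0 < s := ha.trans_lt hs.1
  have hσ0 : 0 < s * L := mul_pos hs0 hL0
  have hσb : s * L < b * L := mul_lt_mul_of_pos_right hs.2 hL0
  have hmem : ∀ x ∈ Ico (s * L) (b * L), x / L ∈ Ioo a b := fun x hx =>
    ⟨hs.1.trans_le ((le_div_iff₀ hL0).2 hx.1), (div_lt_iff₀ hL0).2 hx.2⟩
  have hIoo : ∀ x ∈ Ioo a b, x ∈ Ioo (0 : ℝ) 1 := fun x hx =>
    ⟨ha.trans_lt hx.1, hx.2.trans_le hb⟩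
  let u : ℝ → ℝ := fun y => τ * v (y / L) / μ
  let u' : ℝ → ℝ := fun y => τ * w (y / L) / (μ * L)
  have hu_abs : ∀ x ∈ Ico (s * L) (b * L), |v (x / L)| / μ = u x := fun x hx => by
    rw [habs _ (hmem x hx)]
  have hu : ∀ x ∈ Ico (s * L) (b * L), HasDerivAt u (u' x) x := fun x hx => by
    have h := (((hv _ (hIoo _ (hmem x hx))).comp x ((hasDerivAt_id x).div_const L)).const_mul
      τ).div_const μ
    refine HasDerivAt.congr_deriv (f := u) h ?_
    simp only [u']
    field_simp
  have hu01 : ∀ x ∈ Ico (s * L) (b * L), u x ∈ Icc (0 : ℝ) 1 := fun x hx => by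
    rw [← hu_abs x hx]
    exact ⟨by positivity, (div_le_one hμ0).2 (hmax _ (hmem x hx))⟩
  have hu' : ∀ x ∈ Ico (s * L) (b * L),
      HasDerivAt u' (-((M - 1) / x) * u' x - u x ^ p) x := fun x hx => by
    have hx0 : 0 < x := hσ0.trans_le hx.1
    have h := (((hw _ (hIoo _ (hmem x hx))).comp x ((hasDerivAt_id x).div_const L)).const_mul
      τ).div_const (μ * L)
    refine HasDerivAt.congr_deriv (f := u') h ?_
    have hvp : 0 < |v (x / L)| := by rw [habs _ (hmem x hx)]; exact hsign _ (hmem x hx)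
    have h1 : u x ^ p = |v (x / L)| ^ (p - 1) * (τ * v (x / L)) / (L ^ 2 * μ) := by
      rw [← hu_abs x hx, div_rpow hvp.le hμ0.le, hL2, ← habs _ (hmem x hx), ← rpow_add_one hvp.ne',
        ← rpow_add_one hμ0.ne']
      simp
    rw [h1]
    simp only [u']
    field_simp
  have hu'_deriv : ∀ x ∈ Ico (s * L) (b * L),
      deriv (fun y => |v (y / L)| / μ) x = u' x := fun x hx => by
    have hnhds : ∀ᶠ y in 𝓝 x, y / L ∈ Ioo a b :=
      (continuousAt_id.div_const L).eventually (isOpen_Ioo.mem_nhds (hmem x hx))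
    have heq : (fun y => |v (y / L)| / μ) =ᶠ[𝓝 x] u := by
      filter_upwards [hnhds] with y hy
      rw [habs _ hy]
    rw [heq.deriv_eq, (hu x hx).deriv]
  have hclose : ∀ x ∈ Ico (s * L) (b * L), x ≤ X →
      (u x - bubble M x) ^ 2 + (u' x - bubbleDeriv M x) ^ 2 ≤ η := fun x hx hxX => by
    have h := sq_add_sq_le_of_damped (d := fun y => u y - bubble M y)
      (d' := fun y => u' y - bubbleDeriv M y)
      (g := fun y => u y ^ p - bubble M y ^ ((M + 2) / (M - 2))) (k := fun y => (M - 1) / y)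
      (σ := s * L) (B := b * L) (p := p) (ω := (M + 2) / (M - 2) - p) (by linarith)
      (fun y hy => (hu y hy).sub (hasDerivAt_bubble hM y))
      (fun y hy => ((hu' y hy).sub (hasDerivAt_bubbleDeriv hM (hσ0.trans_le hy.1))).congr_deriv
        (by ring))
      (fun y hy => div_nonneg (by linarith) (hσ0.trans_le hy.1).le)
      (fun y hy => by
        calc |u y ^ p - bubble M y ^ ((M + 2) / (M - 2))|
            ≤ |u y ^ p - bubble M y ^ p| + |bubble M y ^ p - bubble M y ^ ((M + 2) / (M - 2))| :=
              abs_sub_le _ _ _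
          _ ≤ _ := add_le_add (abs_rpow_sub_rpow_le_of_bases (hu01 y hy)
              ⟨(bubble_pos hM y).le, bubble_le_one hM y⟩ hp.le)
              (abs_rpow_sub_rpow_le_of_exponents (bubble_pos hM y) (bubble_le_one hM y) hp.le
                hpM.le)) hx
    have huσ : u (s * L) = 1 := by
      rw [← hu_abs _ ⟨le_rfl, hσb⟩, mul_div_cancel_right₀ _ hL0.ne', ← hμ, div_self hμ0.ne']
    have hu'σ : u' (s * L) = 0 := by
      simp only [u', mul_div_cancel_right₀ _ hL0.ne', hws, mul_zero, zero_div]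
    simp only [huσ, hu'σ, zero_sub, neg_sq] at h
    rw [hη]
    refine h.trans ?_
    gcongr
    nlinarith
  have hXb : X < b * L := by
    by_contra! hcon
    have hub : Tendsto u (𝓝[<] (b * L)) (𝓝 0) := by
      have hbL : b * L / L = b := mul_div_cancel_right₀ _ hL0.ne'
      have hb0 : 0 < b := hs0.trans hs.2
      have h1 : Tendsto (fun y => y / L) (𝓝[<] (b * L)) (𝓝[Icc 0 1] b) := by
        refine tendsto_nhdsWithin_iff.2 ⟨?_, ?_⟩
        · have : Tendsto (fun y => y / L) (𝓝 (b * L)) (𝓝 (b * L / L)) :=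
            (continuous_id.div_const L).tendsto _
          rw [hbL] at this
          exact this.mono_left nhdsWithin_le_nhds
        · filter_upwards [Ioo_mem_nhdsLT hσb] with y hy
          exact Ioo_subset_Icc_self (hIoo _ (hmem y ⟨hy.1.le, hy.2⟩))
      have h2 := (((hvc b ⟨hb0.le, hb⟩).tendsto.comp h1).const_mul τ).div_const μ
      simpa [hvb] using h2
    have hlim : Tendsto (fun x => (u x - bubble M x) ^ 2) (𝓝[<] (b * L))
        (𝓝 ((0 - bubble M (b * L)) ^ 2)) :=
      (hub.sub ((hasDerivAt_bubble hM _).continuousAt.tendsto.mono_left nhdsWithin_le_nhds)).pow 2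
    have hle : (0 - bubble M (b * L)) ^ 2 ≤ η := by
      refine le_of_tendsto hlim ?_
      filter_upwards [Ioo_mem_nhdsLT hσb] with y hy
      nlinarith [hclose y ⟨hy.1.le, hy.2⟩ (hy.2.le.trans hcon),
        sq_nonneg (u' y - bubbleDeriv M y)]
    have hanti := bubble_antitoneOn hM (hσ0.trans hσb).le hX hcon
    nlinarith [bubble_pos hM X]
  refine ⟨hXb, fun x hx => ?_⟩
  have hx' : x ∈ Ico (s * L) (b * L) := ⟨hx.1, hx.2.trans_lt hXb⟩
  rw [hu_abs x hx', hu'_deriv x hx']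
  exact hclose x hx' hx.2

lemma tendsto_of_rpow_le {l : Filter ℝ} {σ e r : ℝ → ℝ} {q : ℝ} (hq : 0 < q)
    (he : Tendsto e l (𝓝 q)) (hr : Tendsto r l (𝓝 0)) (hσ : ∀ᶠ p in l, 0 < σ p)
    (h : ∀ᶠ p in l, σ p ^ e p ≤ r p) : Tendsto σ l (𝓝 0) := by
  have hlim : Tendsto (fun p => r p ^ (e p)⁻¹) l (𝓝 0) := by
    have := hr.rpow (he.inv₀ hq.ne') (Or.inr (inv_pos.2 hq))
    rwa [zero_rpow (inv_pos.2 hq).ne'] at this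
  refine squeeze_zero' (hσ.mono fun p hp => hp.le) ?_ hlim
  filter_upwards [hσ, h, he.eventually_const_lt hq] with p h1 h2 h3
  calc σ p = (σ p ^ e p) ^ (e p)⁻¹ := by rw [← rpow_mul h1.le, mul_inv_cancel₀ h3.ne', rpow_one]
    _ ≤ r p ^ (e p)⁻¹ := by gcongr

/-- under the same hypotheses as Statement 8, for every `i = 1, …, m-1` the
rescaled functions `ṽ_{i,p}(x) = |v_p(x/𝓜̃_{i,p})|/𝓜_{i,p}` (with `𝓜̃_{i,p} = 𝓜_{i,p}^{(p-1)/2}`)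
converge to `V_M` in `C¹_loc(0,∞)` as `p → p_M⁻`: every compact `K ⊂ (0,∞)` is eventually
contained in the rescaled nodal interval, and `ṽ_{i,p} → V_M`, `ṽ_{i,p}' → V_M'` uniformly
on `K`. -/
theorem stmt9 (M pM : ℝ) (hM : 2 < M) (hpM : pM = (M + 2) / (M - 2))
    (m : ℕ) (hm : 2 ≤ m)
    (v : ℝ → ℝ → ℝ) (t s Mx : ℝ → ℕ → ℝ)
    (hreg : ∀ p ∈ Set.Ioo 1 pM, ContDiffOn ℝ 2 (v p) (Set.Icc 0 1))
    (hode : ∀ p ∈ Set.Ioo 1 pM, ∀ x ∈ Set.Ioo (0 : ℝ) 1,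
      -(deriv (fun y : ℝ => y ^ (M - 1) * deriv (v p) y) x)
        = x ^ (M - 1) * |v p x| ^ (p - 1) * v p x)
    (hv0 : ∀ p ∈ Set.Ioo 1 pM, 0 < v p 0)
    (hd0 : ∀ p ∈ Set.Ioo 1 pM, deriv (v p) 0 = 0)
    (hv1 : ∀ p ∈ Set.Ioo 1 pM, v p 1 = 0)
    (ht0 : ∀ p ∈ Set.Ioo 1 pM, t p 0 = 0)
    (htm : ∀ p ∈ Set.Ioo 1 pM, t p m = 1)
    (htmono : ∀ p ∈ Set.Ioo 1 pM, ∀ i < m, t p i < t p (i + 1))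
    (htzero : ∀ p ∈ Set.Ioo 1 pM, ∀ i, 1 ≤ i → i ≤ m → v p (t p i) = 0)
    (hsign : ∀ p ∈ Set.Ioo 1 pM, ∀ i < m, ∀ x ∈ Set.Ioo (t p i) (t p (i + 1)),
      0 < (-1 : ℝ) ^ i * v p x)
    (hs : ∀ p ∈ Set.Ioo 1 pM, ∀ i < m, s p i ∈ Set.Ico (t p i) (t p (i + 1)))
    (hMx : ∀ p ∈ Set.Ioo 1 pM, ∀ i < m, Mx p i = |v p (s p i)|)
    (hMxmax : ∀ p ∈ Set.Ioo 1 pM, ∀ i < m,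
      ∀ x ∈ Set.Icc (t p i) (t p (i + 1)), |v p x| ≤ Mx p i)
    (C δ : ℝ) (hC : 0 < C) (hδ : 0 < δ)
    (henergy : ∀ p, pM - δ < p → 1 < p → p < pM →
      (∫ x in (0 : ℝ)..1, x ^ (M - 1) * (deriv (v p) x) ^ 2) ≤ C) :
    ∀ i, 1 ≤ i → i ≤ m - 1 →
      ∀ K : Set ℝ, IsCompact K → K ⊆ Set.Ioi 0 →
        (∀ᶠ p in 𝓝[<] pM,
          K ⊆ Set.Ioo (t p i * Mx p i ^ ((p - 1) / 2)) (t p (i + 1) * Mx p i ^ ((p - 1) / 2))) ∧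
        TendstoUniformlyOn
          (fun p x => |v p (x / Mx p i ^ ((p - 1) / 2))| / Mx p i)
          (fun x => (1 + x ^ 2 / (M * (M - 2))) ^ (-(M - 2) / 2)) (𝓝[<] pM) K ∧
        TendstoUniformlyOn
          (fun p x => deriv (fun y : ℝ => |v p (y / Mx p i ^ ((p - 1) / 2))| / Mx p i) x)
          (deriv (fun x : ℝ => (1 + x ^ 2 / (M * (M - 2))) ^ (-(M - 2) / 2))) (𝓝[<] pM) K := by
  intro i hi him K hK hK0
  have him' : i < m := by omega
  have hM2 : 0 < M - 2 := by linarith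
  have hpM1 : 1 < pM := by rw [hpM, one_lt_div hM2]; linarith
  have hev : ∀ᶠ p in 𝓝[<] pM, p ∈ Ioo 1 pM ∧ pM - δ < p := by
    filter_upwards [Ioo_mem_nhdsLT hpM1, Ioo_mem_nhdsLT (sub_lt_self pM hδ)] with p h1 h2
    exact ⟨h1, h2.1⟩
  obtain ⟨L, hL⟩ : ∃ L : ℝ → ℝ, ∀ p, L p = Mx p i ^ ((p - 1) / 2) := ⟨_, fun _ => rfl⟩
  simp only [← hL]
  -- elementary facts about the nodal interval
  have htle : ∀ p ∈ Ioo 1 pM, ∀ k ≤ m, ∀ j ≤ k, t p j ≤ t p k := by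
    intro p hp k
    induction k with
    | zero => intro _ j hj; rw [Nat.le_zero.1 hj]
    | succ k ih =>
      intro hk j hj
      rcases hj.lt_or_eq with h | h
      · exact (ih (by omega) j (by omega)).trans (htmono p hp k (by omega)).le
      · rw [h]
  have ht_nonneg : ∀ p ∈ Ioo 1 pM, 0 ≤ t p i := fun p hp => by
    rw [← ht0 p hp]; exact htle p hp i him'.le 0 (Nat.zero_le _)
  have ht_le_one : ∀ p ∈ Ioo 1 pM, t p (i + 1) ≤ 1 := fun p hp => by
    rw [← htm p hp]; exact htle p hp m le_rfl (i + 1) him'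
  have hτ : |(-1 : ℝ) ^ i| = 1 := by simp
  have hsi : ∀ p ∈ Ioo 1 pM, s p i ∈ Ioo (t p i) (t p (i + 1)) := fun p hp => by
    refine ⟨lt_of_le_of_ne (hs p hp i him').1 fun heq => ?_, (hs p hp i him').2⟩
    obtain ⟨x, hx⟩ := exists_between (htmono p hp i him')
    have h1 := hMxmax p hp i him' x (Ioo_subset_Icc_self hx)
    rw [hMx p hp i him', ← heq, htzero p hp i hi him'.le, abs_zero] at h1
    have h2 := hsign p hp i him' x hx
    rw [abs_nonpos_iff.1 h1, mul_zero] at h2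
    exact lt_irrefl _ h2
  have hs01 : ∀ p ∈ Ioo 1 pM, s p i ∈ Ioo (0 : ℝ) 1 := fun p hp =>
    ⟨(ht_nonneg p hp).trans_lt (hsi p hp).1, (hsi p hp).2.trans_le (ht_le_one p hp)⟩
  have hMx0 : ∀ p ∈ Ioo 1 pM, 0 < Mx p i := fun p hp => by
    rw [hMx p hp i him', abs_pos]
    exact fun h => by simpa [h] using hsign p hp i him' _ (hsi p hp)
  have hL0 : ∀ p ∈ Ioo 1 pM, 0 < L p := fun p hp => by
    rw [hL]; exact rpow_pos_of_pos (hMx0 p hp) _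
  -- the equation in terms of the one-sided derivative
  have hvc : ∀ p ∈ Ioo 1 pM, ContinuousOn (v p) (Icc 0 1) := fun p hp => (hreg p hp).continuousOn
  have hwc : ∀ p ∈ Ioo 1 pM, ContinuousOn (derivWithin (v p) (Icc 0 1)) (Icc 0 1) := fun p hp =>
    (hreg p hp).continuousOn_derivWithin (uniqueDiffOn_Icc zero_lt_one) (by norm_num)
  have hdv : ∀ p ∈ Ioo 1 pM, ∀ x ∈ Ioo (0 : ℝ) 1,
      HasDerivAt (v p) (derivWithin (v p) (Icc 0 1) x) x ∧
        HasDerivAt (derivWithin (v p) (Icc 0 1))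
          (-((M - 1) / x) * derivWithin (v p) (Icc 0 1) x - |v p x| ^ (p - 1) * v p x) x :=
    fun p hp x hx =>
    laneEmden_hasDerivAt (hreg p hp) (hode p hp) hx
  have hws : ∀ p ∈ Ioo 1 pM, derivWithin (v p) (Icc 0 1) (s p i) = 0 := fun p hp => by
    have hloc : IsLocalMax (fun x => (-1 : ℝ) ^ i * v p x) (s p i) := by
      filter_upwards [isOpen_Ioo.mem_nhds (hsi p hp)] with x hx
      have h1 : ∀ y ∈ Ioo (t p i) (t p (i + 1)), (-1 : ℝ) ^ i * v p y = |v p y| := fun y hy => by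
        rw [← abs_of_pos (hsign p hp i him' y hy), abs_mul, hτ, one_mul]
      rw [h1 x hx, h1 _ (hsi p hp), ← hMx p hp i him']
      exact hMxmax p hp i him' x (Ioo_subset_Icc_self hx)
    have h2 := hloc.hasDerivAt_eq_zero ((hdv p hp _ (hs01 p hp)).1.const_mul _)
    exact (mul_eq_zero.1 h2).resolve_left (pow_ne_zero _ (by norm_num))
  -- the rescaled extremal point tends to the origin
  have hσ : Tendsto (fun p => s p i * L p) (𝓝[<] pM) (𝓝 0) := by
    have hid : Tendsto (fun p : ℝ => p) (𝓝[<] pM) (𝓝 pM) := nhdsWithin_le_nhds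
    refine tendsto_of_rpow_le (e := fun p => 4 / (p - 1) + 2)
      (r := fun p => (p + 1) * ((M / (p + 1) - (M - 2) / 2) * C)) (q := 4 / (pM - 1) + 2)
      ?_ ?_ ?_ ?_ ?_
    · have : 0 < pM - 1 := by linarith
      positivity
    · exact (tendsto_const_nhds.div (hid.sub_const 1) (by linarith)).add_const 2
    · have h := (hid.add_const 1).mul (((tendsto_const_nhds (x := M)).div (hid.add_const 1)
        (by linarith)).sub_const ((M - 2) / 2) |>.mul_const C)
      have h0 : M / (pM + 1) - (M - 2) / 2 = 0 := by
        have h1 : pM + 1 = 2 * M / (M - 2) := by rw [hpM]; field_simp; ring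
        rw [h1]
        field_simp
        ring
      simpa [h0] using h
    · filter_upwards [hev] with p hp
      exact mul_pos (hs01 p hp.1).1 (hL0 p hp.1)
    · filter_upwards [hev] with p hp'
      have hp := hp'.1
      have hpM' : p < (M + 2) / (M - 2) := hpM ▸ hp.2
      have h1 := laneEmden_energy_le hM hp.1 hpM' (hvc p hp) (hwc p hp)
        (fun x hx => (hdv p hp x hx).1) (fun x hx => (hdv p hp x hx).2) (hv1 p hp)
        (hs01 p hp) (hws p hp)
      rw [laneEmden_pohozaev hM hp.1 (hvc p hp) (hwc p hp) (fun x hx => (hdv p hp x hx).1)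
        (fun x hx => (hdv p hp x hx).2) (hv1 p hp), ← hMx p hp i him'] at h1
      have h2 : (∫ x in (0 : ℝ)..1, x ^ (M - 1) * derivWithin (v p) (Icc 0 1) x ^ 2)
          = ∫ x in (0 : ℝ)..1, x ^ (M - 1) * deriv (v p) x ^ 2 := by
        refine intervalIntegral.integral_congr_Ioo_of_le zero_le_one fun x hx => ?_
        simp only [derivWithin_of_mem_nhds (Icc_mem_nhds hx.1 hx.2)]
      have h3 := henergy p hp'.2 hp.1 hp.2
      rw [← h2] at h3
      have hp1 : 0 < p + 1 := by linarith [hp.1]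
      have hp2 : p - 1 ≠ 0 := by linarith [hp.1]
      have h4 : 0 ≤ M / (p + 1) - (M - 2) / 2 := by
        rw [lt_div_iff₀ hM2] at hpM'
        rw [sub_nonneg, div_le_div_iff₀ two_pos hp1]
        nlinarith
      have h5 : (s p i * L p) ^ (4 / (p - 1) + 2)
          = s p i ^ (4 / (p - 1) + 2) * Mx p i ^ (p + 1) := by
        rw [mul_rpow (hs01 p hp).1.le (hL0 p hp).le, hL, ← rpow_mul (hMx0 p hp).le]
        congr 2
        field_simp
        ring
      rw [h5]
      exact h1.trans (by gcongr)
  obtain ⟨k, X, hk0, hX0, hKX⟩ : ∃ k X : ℝ, 0 < k ∧ 0 ≤ X ∧ K ⊆ Icc k X := by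
    rcases K.eq_empty_or_nonempty with rfl | hne
    · exact ⟨1, 1, one_pos, zero_le_one, empty_subset _⟩
    · have hinf := hK.sInf_mem hne
      have hsup := hK.sSup_mem hne
      exact ⟨sInf K, sSup K, hK0 hinf, (hK0 hsup).le, fun x hx =>
        ⟨csInf_le hK.bddBelow hx, le_csSup hK.bddAbove hx⟩⟩
  let η : ℝ → ℝ := fun p => ((1 - bubble M (s p i * L p)) ^ 2 + bubbleDeriv M (s p i * L p) ^ 2
      + ((M + 2) / (M - 2) - p) ^ 2) * exp ((2 + p) * X)
  have hη : Tendsto η (𝓝[<] pM) (𝓝 0) := by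
    have hid : Tendsto (fun p : ℝ => p) (𝓝[<] pM) (𝓝 pM) := nhdsWithin_le_nhds
    have h1 := (hasDerivAt_bubble hM 0).continuousAt.tendsto.comp hσ
    have h2 := ((continuous_bubbleDeriv hM).tendsto 0).comp hσ
    have h3 := (((h1.const_sub 1).pow 2).add (h2.pow 2)).add
      ((hid.const_sub ((M + 2) / (M - 2))).pow 2)
    have h4 := h3.mul ((continuous_exp.tendsto _).comp ((hid.const_add 2).mul_const X))
    simpa [η, bubble_zero, bubbleDeriv_zero, ← hpM] using h4
  have hmain : ∀ᶠ p in 𝓝[<] pM, t p i * L p < k ∧ X < t p (i + 1) * L p ∧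
      ∀ x ∈ Icc k X, (|v p (x / L p)| / Mx p i - bubble M x) ^ 2
        + (deriv (fun y => |v p (y / L p)| / Mx p i) x - bubbleDeriv M x) ^ 2 ≤ η p := by
    filter_upwards [hev, hσ.eventually_lt_const hk0,
      hη.eventually_lt_const (pow_pos (bubble_pos hM X) 2)] with p hp' hσk hηX
    have hp := hp'.1
    have h := laneEmden_nodal_close hM hp.1 (hpM ▸ hp.2) (hvc p hp)
      (fun x hx => (hdv p hp x hx).1) (fun x hx => (hdv p hp x hx).2) (ht_nonneg p hp)
      (ht_le_one p hp) (htzero p hp (i + 1) (by omega) him') (hsi p hp) hτ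
      (hsign p hp i him') (hMx p hp i him')
      (fun x hx => hMxmax p hp i him' x (Ioo_subset_Icc_self hx)) (hws p hp) (hL p) hX0 rfl hηX
    refine ⟨lt_trans ?_ hσk, h.1, fun x hx => h.2 x ⟨hσk.le.trans hx.1, hx.2⟩⟩
    exact mul_lt_mul_of_pos_right (hsi p hp).1 (hL0 p hp)
  refine ⟨?_, ?_, ?_⟩
  · filter_upwards [hmain] with p hp x hx
    exact ⟨hp.1.trans_le (hKX hx).1, (hKX hx).2.trans_lt hp.2.1⟩
  · refine Metric.tendstoUniformlyOn_iff.2 fun ε hε => ?_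
    filter_upwards [hmain, hη.eventually_lt_const (pow_pos hε 2)] with p hp hηε x hx
    rw [dist_comm, dist_eq_norm, norm_eq_abs]
    refine abs_lt_of_sq_lt_sq (lt_of_le_of_lt ?_ hηε) hε.le
    exact (le_add_of_nonneg_right (sq_nonneg _)).trans (hp.2.2 x (hKX hx))
  · have hderiv : (deriv fun x : ℝ => (1 + x ^ 2 / (M * (M - 2))) ^ (-(M - 2) / 2))
        = bubbleDeriv M := funext fun x => (hasDerivAt_bubble hM x).deriv
    rw [hderiv]
    refine Metric.tendstoUniformlyOn_iff.2 fun ε hε => ?_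
    filter_upwards [hmain, hη.eventually_lt_const (pow_pos hε 2)] with p hp hηε x hx
    rw [dist_comm, dist_eq_norm, norm_eq_abs]
    refine abs_lt_of_sq_lt_sq (lt_of_le_of_lt ?_ hηε) hε.le
    exact (le_add_of_nonneg_left (sq_nonneg _)).trans (hp.2.2 x (hKX hx))
end

section
/- Let M > 2 be real, p_M = (M+2)/(M-2), and m ≥ 2 an integer. For each p ∈ (1, p_M) let v_p be a C² solution on [0,1] of the generalized Lane–Emden equation with exponent p having exactly m nodal zones, with v_p(0) > 0, v_p'(0) = 0, v_p(1) = 0, and assume the uniform energy bound: there exist C > 0 and δ > 0 such that ∫_0^1 t^{M-1} v_p'(t)² dt ≤ C for all p ∈ (p_M − δ, p_M). Then, as p → p_M⁻: (a) t_{i+1,p} · 𝓜̃_{i,p} → +∞ for every i = 0, …, m−1; (b) s_{i,p} · 𝓜̃_{i,p} → 0 for every i = 1, …, m−1; (c) t_{i,p} · 𝓜̃_{i,p} → 0 for every i = 1, …, m−1. -/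
open Real Filter Set Topology

/-- `u` solves the radial Lane–Emden equation in dimension `M` with exponent `p` on `(0, 1)`,
and `g` is its derivative; both are continuous up to the boundary. -/
structure IsRadialSolution (M p : ℝ) (u g : ℝ → ℝ) : Prop where
  cont : ContinuousOn u (Icc 0 1)
  cont_deriv : ContinuousOn g (Icc 0 1)
  hasDerivAt : ∀ x ∈ Ioo (0 : ℝ) 1, HasDerivAt u (g x) x
  hasDerivAt_deriv : ∀ x ∈ Ioo (0 : ℝ) 1,
    HasDerivAt g (-(|u x| ^ (p - 1) * u x) - (M - 1) / x * g x) x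

/-- The logarithmic Emden–Fowler energy. -/
noncomputable def emdenEnergy (M p : ℝ) (u g : ℝ → ℝ) (x : ℝ) : ℝ :=
  x ^ (2 * (2 / (p - 1))) * ((2 / (p - 1) * u x + x * g x) ^ 2 / 2
    - 2 / (p - 1) * (M - 2 - 2 / (p - 1)) * u x ^ 2 / 2 + x ^ 2 * |u x| ^ (p + 1) / (p + 1))

/-- The Pohozaev functional. -/
noncomputable def pohozaev (M p : ℝ) (u g : ℝ → ℝ) (x : ℝ) : ℝ :=
  x ^ M * (g x ^ 2 / 2 + |u x| ^ (p + 1) / (p + 1)) + M / (p + 1) * (x ^ (M - 1) * (u x * g x))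

lemma abs_rpow_add_one_eq {p : ℝ} (hp : 1 < p) (a : ℝ) :
    |a| ^ (p + 1) = |a| ^ (p - 1) * a * a := by
  rcases eq_or_ne a 0 with rfl | ha
  · rw [abs_zero, zero_rpow (by linarith)]; ring
  · rw [show p + 1 = p - 1 + (2 : ℕ) by push_cast; ring, rpow_add (abs_pos.2 ha), rpow_natCast,
      sq_abs]
    ring

lemma HasDerivAt.abs_rpow_add_one {p : ℝ} (hp : 1 < p) {u : ℝ → ℝ} {u' x : ℝ}
    (h : HasDerivAt u u' x) :
    HasDerivAt (fun y => |u y| ^ (p + 1)) ((p + 1) * (|u x| ^ (p - 1) * u x) * u') x := by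
  have := (hasDerivAt_abs_rpow (u x) (p := p + 1) (by linarith)).comp x h
  refine this.congr_deriv ?_
  rw [show p + 1 - 2 = p - 1 by ring]; ring

namespace IsRadialSolution

variable {M p : ℝ} {u g : ℝ → ℝ}

lemma const_mul_sign (h : IsRadialSolution M p u g) {σ : ℝ} (hσ : |σ| = 1) :
    IsRadialSolution M p (fun x => σ * u x) (fun x => σ * g x) where
  cont := h.cont.const_mul σ
  cont_deriv := h.cont_deriv.const_mul σ
  hasDerivAt x hx := (h.hasDerivAt x hx).const_mul σ
  hasDerivAt_deriv x hx := by
    refine ((h.hasDerivAt_deriv x hx).const_mul σ).congr_deriv ?_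
    rw [abs_mul, hσ]; ring_nf

lemma hasDerivAt_flux (h : IsRadialSolution M p u g) {x : ℝ} (hx : x ∈ Ioo (0 : ℝ) 1) :
    HasDerivAt (fun y => y ^ (M - 1) * g y) (-(x ^ (M - 1) * (|u x| ^ (p - 1) * u x))) x := by
  refine ((hasDerivAt_rpow_const (p := M - 1) (Or.inl hx.1.ne')).mul
    (h.hasDerivAt_deriv x hx)).congr_deriv ?_
  rw [rpow_sub_one hx.1.ne']
  field_simp
  ring

lemma hasDerivAt_emdenEnergy (h : IsRadialSolution M p u g) (hp : 1 < p) {x : ℝ}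
    (hx : x ∈ Ioo (0 : ℝ) 1) :
    HasDerivAt (emdenEnergy M p u g) ((2 * (2 / (p - 1)) - (M - 2)) *
      (x ^ (2 * (2 / (p - 1))) / x) * (2 / (p - 1) * u x + x * g x) ^ 2) x := by
  have hu := h.hasDerivAt x hx
  have hg := h.hasDerivAt_deriv x hx
  have hpow := hasDerivAt_rpow_const (p := 2 * (2 / (p - 1))) (Or.inl hx.1.ne')
  have hA := ((((hu.const_mul (2 / (p - 1))).add ((hasDerivAt_id x).mul hg)).pow 2).div_const 2).sub
    (((hu.pow 2).const_mul (2 / (p - 1) * (M - 2 - 2 / (p - 1)))).div_const 2)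
  have hB := (((hasDerivAt_id x).pow 2).mul (hu.abs_rpow_add_one hp)).div_const (p + 1)
  have hp1 : p - 1 ≠ 0 := by linarith
  have hp2 : p + 1 ≠ 0 := by linarith
  have hx0 := hx.1.ne'
  refine (hpow.mul (hA.add hB)).congr_deriv ?_
  simp only [Pi.add_apply, Pi.sub_apply, Pi.mul_apply, Pi.pow_apply, id, abs_rpow_add_one_eq hp]
  rw [rpow_sub_one hx0]
  generalize x ^ (2 * (2 / (p - 1))) = y
  generalize |u x| ^ (p - 1) = z
  obtain ⟨q, rfl⟩ : ∃ q, p = q + 1 := ⟨p - 1, by ring⟩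
  simp only [add_sub_cancel_right, Nat.cast_ofNat, Nat.add_one_sub_one, pow_one] at *
  field_simp
  ring

lemma hasDerivAt_pohozaev (h : IsRadialSolution M p u g) (hp : 1 < p) {x : ℝ}
    (hx : x ∈ Ioo (0 : ℝ) 1) :
    HasDerivAt (pohozaev M p u g) ((M / (p + 1) - (M - 2) / 2) * (x ^ (M - 1) * g x ^ 2)) x := by
  have hu := h.hasDerivAt x hx
  have hg := h.hasDerivAt_deriv x hx
  have hpow := hasDerivAt_rpow_const (p := M) (Or.inl hx.1.ne')
  have hpow' := hasDerivAt_rpow_const (p := M - 1) (Or.inl hx.1.ne')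
  have hp2 : p + 1 ≠ 0 := by linarith
  have hx0 := hx.1.ne'
  refine ((hpow.mul
    (((hg.pow 2).div_const 2).add ((hu.abs_rpow_add_one hp).div_const (p + 1)))).add
    ((hpow'.mul (hu.mul hg)).const_mul (M / (p + 1)))).congr_deriv ?_
  simp only [Pi.add_apply, Pi.mul_apply, Pi.pow_apply, abs_rpow_add_one_eq hp]
  rw [rpow_sub_one hx0, rpow_sub_one hx0]
  generalize |u x| ^ (p - 1) = z
  field_simp
  rw [rpow_sub_one hx0]
  field_simp
  ring

lemma continuousOn_emdenEnergy (h : IsRadialSolution M p u g) (hp : 1 < p) :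
    ContinuousOn (emdenEnergy M p u g) (Icc 0 1) := by
  have hu := h.cont
  have hg := h.cont_deriv
  have hp1 : 0 < p - 1 := by linarith
  have h1 : 0 ≤ 2 * (2 / (p - 1)) := by positivity
  have hpow : ContinuousOn (fun x : ℝ => x ^ (2 * (2 / (p - 1)))) (Icc 0 1) :=
    (Real.continuous_rpow_const h1).continuousOn
  have habs : ContinuousOn (fun x : ℝ => |u x| ^ (p + 1)) (Icc 0 1) :=
    hu.abs.rpow_const fun _ _ => Or.inr (by linarith)
  unfold emdenEnergy
  fun_prop

lemma continuousOn_pohozaev (h : IsRadialSolution M p u g) (hM : 2 < M) (hp : 1 < p) :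
    ContinuousOn (pohozaev M p u g) (Icc 0 1) := by
  have hu := h.cont
  have hg := h.cont_deriv
  have hpow : ContinuousOn (fun x : ℝ => x ^ M) (Icc 0 1) :=
    (Real.continuous_rpow_const (by linarith)).continuousOn
  have hpow' : ContinuousOn (fun x : ℝ => x ^ (M - 1)) (Icc 0 1) :=
    (Real.continuous_rpow_const (by linarith)).continuousOn
  have habs : ContinuousOn (fun x : ℝ => |u x| ^ (p + 1)) (Icc 0 1) :=
    hu.abs.rpow_const fun _ _ => Or.inr (by linarith)
  unfold pohozaev
  fun_prop

/-- Pohozaev identity for a solution vanishing at `1`. -/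
lemma sq_deriv_one_eq (h : IsRadialSolution M p u g) (hM : 2 < M) (hp : 1 < p) (h1 : u 1 = 0) :
    g 1 ^ 2 = 2 * (M / (p + 1) - (M - 2) / 2) * ∫ x in (0 : ℝ)..1, x ^ (M - 1) * g x ^ 2 := by
  have hint : IntervalIntegrable (fun x => (M / (p + 1) - (M - 2) / 2) * (x ^ (M - 1) * g x ^ 2))
      MeasureTheory.volume 0 1 := by
    apply ContinuousOn.intervalIntegrable
    rw [uIcc_of_le zero_le_one]
    have hg := h.cont_deriv
    have hpow' : ContinuousOn (fun x : ℝ => x ^ (M - 1)) (Icc 0 1) :=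
      (Real.continuous_rpow_const (by linarith)).continuousOn
    fun_prop
  have := intervalIntegral.integral_eq_sub_of_hasDerivAt_of_le zero_le_one
    (h.continuousOn_pohozaev hM hp) (fun x hx => h.hasDerivAt_pohozaev hp hx) hint
  rw [intervalIntegral.integral_const_mul] at this
  have hP0 : pohozaev M p u g 0 = 0 := by
    simp [pohozaev, zero_rpow (show M ≠ 0 by linarith), zero_rpow (show M - 1 ≠ 0 by linarith)]
  have hP1 : pohozaev M p u g 1 = g 1 ^ 2 / 2 := by
    simp [pohozaev, h1, zero_rpow (show p + 1 ≠ 0 by linarith)]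
  rw [hP0, hP1] at this
  linarith

lemma emdenEnergy_le (h : IsRadialSolution M p u g) (hp : 1 < p)
    (hsub : M - 2 ≤ 2 * (2 / (p - 1))) (h1 : u 1 = 0) {x : ℝ} (hx : x ∈ Icc (0 : ℝ) 1) :
    emdenEnergy M p u g x ≤ g 1 ^ 2 / 2 := by
  have hmono : MonotoneOn (emdenEnergy M p u g) (Icc 0 1) := by
    refine monotoneOn_of_hasDerivWithinAt_nonneg (convex_Icc 0 1) (h.continuousOn_emdenEnergy hp)
      (f' := fun y => (2 * (2 / (p - 1)) - (M - 2)) *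
        (y ^ (2 * (2 / (p - 1))) / y) * (2 / (p - 1) * u y + y * g y) ^ 2)
      (fun y hy => ?_) (fun y hy => ?_)
    · rw [interior_Icc] at hy
      exact (h.hasDerivAt_emdenEnergy hp hy).hasDerivWithinAt
    · rw [interior_Icc] at hy
      have h0 := hy.1
      have : 0 ≤ 2 * (2 / (p - 1)) - (M - 2) := by linarith
      positivity
  refine (hmono hx (right_mem_Icc.2 zero_le_one) hx.2).trans_eq ?_
  simp [emdenEnergy, h1, zero_rpow (show p + 1 ≠ 0 by linarith)]

lemma rpow_mul_abs_rpow_le_of_critical (h : IsRadialSolution M p u g) (hp : 1 < p)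
    (hsub : M - 2 ≤ 2 * (2 / (p - 1))) (h1 : u 1 = 0) {x : ℝ} (hx : x ∈ Icc (0 : ℝ) 1)
    (hx0 : 0 < x) (hgx : g x = 0) :
    x ^ (2 * (2 / (p - 1)) + 2) * |u x| ^ (p + 1) ≤ (p + 1) / 2 * g 1 ^ 2 := by
  have hE := h.emdenEnergy_le hp hsub h1 hx
  have hα : 0 < 2 / (p - 1) := div_pos two_pos (by linarith)
  simp only [emdenEnergy, hgx] at hE
  generalize 2 / (p - 1) = α at *
  have hx2 : x ^ (2 * α + 2) = x ^ (2 * α) * x ^ 2 := by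
    rw [rpow_add hx0]; norm_num
  have hnn : 0 ≤ x ^ (2 * α) * (α * (2 * α - (M - 2)) * u x ^ 2 / 2) := by
    have : 0 ≤ 2 * α - (M - 2) := by linarith
    positivity
  have hp2 : 0 < p + 1 := by linarith
  have key : x ^ (2 * α + 2) * |u x| ^ (p + 1) / (p + 1) ≤ g 1 ^ 2 / 2 := by
    rw [hx2]
    refine le_trans (le_of_eq ?_) ((sub_le_sub hE hnn).trans_eq (sub_zero _))
    ring
  rw [div_le_iff₀ hp2] at key
  linarith

lemma rpow_mul_abs_deriv_le_of_zero (h : IsRadialSolution M p u g) (hp : 1 < p)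
    (hsub : M - 2 ≤ 2 * (2 / (p - 1))) (h1 : u 1 = 0) {x : ℝ} (hx : x ∈ Icc (0 : ℝ) 1)
    (hx0 : 0 < x) (hux : u x = 0) : x ^ (2 / (p - 1) + 1) * |g x| ≤ |g 1| := by
  have hE := h.emdenEnergy_le hp hsub h1 hx
  simp only [emdenEnergy, hux, abs_zero, zero_rpow (show p + 1 ≠ 0 by linarith)] at hE
  generalize 2 / (p - 1) = α at *
  have hx2 : x ^ (2 * α) = (x ^ α) ^ 2 := by
    rw [← rpow_natCast, ← rpow_mul hx0.le]; congr 1; push_cast; ring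
  have hx1 : x ^ (α + 1) = x ^ α * x := by rw [rpow_add hx0, rpow_one]
  rw [hx2] at hE
  rw [hx1, ← abs_of_pos (show 0 < x ^ α * x by positivity), ← abs_mul]
  refine sq_le_sq.1 ?_
  ring_nf at hE ⊢
  linarith

/-- Negative upper bound for the flux at the end of a positivity interval starting at a maximum point. -/
lemma flux_le (h : IsRadialSolution M p u g) (hM : 2 < M) (hp : 1 < p) {s T K r : ℝ}
    (hs : 0 ≤ s) (hT : T ≤ 1) (hsT : s < T) (hK : 0 < K) (hus : u s = K) (huT : u T = 0)
    (hpos : ∀ x ∈ Ioo s T, 0 < u x) (hle : ∀ x ∈ Icc s T, u x ≤ K)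
    (hflux : s ^ (M - 1) * g s = 0) (hr : 0 < r) (hKr : K ^ (p - 1) * r ^ 2 = 1)
    (hsr : s ≤ r / 2) :
    T ^ (M - 1) * g T ≤ -((K / 2) ^ (p - 1) * (K / 2) * r ^ M / (2 * M)) := by
  have hIcc : Icc s T ⊆ Icc 0 1 := Icc_subset_Icc hs hT
  have hIoo : Ioo s T ⊆ Ioo 0 1 := Ioo_subset_Ioo hs hT
  have hu := h.cont.mono hIcc
  have hfc : ContinuousOn (fun y => y ^ (M - 1) * g y) (Icc s T) :=
    ((Real.continuous_rpow_const (by linarith)).continuousOn).mul (h.cont_deriv.mono hIcc)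
  have hMc : Continuous (fun y : ℝ => y ^ M) := Real.continuous_rpow_const (by linarith)
  have hMd (c : ℝ) {x : ℝ} (hx : x ∈ Ioo s T) :
      HasDerivAt (fun y : ℝ => c * (y ^ M / M)) (c * x ^ (M - 1)) x := by
    refine (((hasDerivAt_rpow_const (p := M) (Or.inl (hIoo hx).1.ne')).div_const M).const_mul
      c).congr_deriv ?_
    field_simp
  have hflow : ∀ x ∈ Icc s T, -(K ^ (p - 1) * K * (x ^ M / M)) ≤ x ^ (M - 1) * g x := by
    have hmono : MonotoneOn (fun y => y ^ (M - 1) * g y + K ^ (p - 1) * K * (y ^ M / M))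
        (Icc s T) := by
      refine monotoneOn_of_hasDerivWithinAt_nonneg (convex_Icc s T) (hfc.add (by fun_prop))
        (f' := fun x => -(x ^ (M - 1) * (|u x| ^ (p - 1) * u x)) + K ^ (p - 1) * K * x ^ (M - 1))
        (fun y hy => ?_) (fun y hy => ?_)
      · rw [interior_Icc] at hy
        exact ((h.hasDerivAt_flux (hIoo hy)).add (hMd _ hy)).hasDerivWithinAt
      · rw [interior_Icc] at hy
        have h0 := hpos y hy
        have hyK := hle y (Ioo_subset_Icc_self hy)
        have hy0 := (hIoo hy).1
        have : |u y| ^ (p - 1) * u y ≤ K ^ (p - 1) * K := by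
          rw [abs_of_pos h0]
          have : u y ^ (p - 1) ≤ K ^ (p - 1) := rpow_le_rpow h0.le hyK (by linarith)
          gcongr
        have := mul_le_mul_of_nonneg_left this (rpow_nonneg hy0.le (M - 1))
        linarith
    intro x hx
    have := hmono (left_mem_Icc.2 hsT.le) hx hx.1
    simp only [hflux] at this
    have : 0 ≤ K ^ (p - 1) * K * (s ^ M / M) := by positivity
    linarith
  have hulow : ∀ x ∈ Icc s T, K - K ^ (p - 1) * K * (x ^ 2 / (2 * M))
      ≤ u x - K ^ (p - 1) * K * (s ^ 2 / (2 * M)) := by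
    have hmono : MonotoneOn (fun y => u y + K ^ (p - 1) * K * (y ^ 2 / (2 * M))) (Icc s T) := by
      refine monotoneOn_of_hasDerivWithinAt_nonneg (convex_Icc s T) (hu.add (by fun_prop))
        (f' := fun x => g x + K ^ (p - 1) * K * (x / M))
        (fun y hy => ?_) (fun y hy => ?_)
      · rw [interior_Icc] at hy
        refine HasDerivAt.hasDerivWithinAt ((h.hasDerivAt y (hIoo hy)).add ?_)
        refine ((((hasDerivAt_id y).pow 2).div_const (2 * M)).const_mul
          (K ^ (p - 1) * K)).congr_deriv ?_
        congr 1
        norm_num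
        field_simp
      · rw [interior_Icc] at hy
        have hy0 := (hIoo hy).1
        have hf := hflow y (Ioo_subset_Icc_self hy)
        rw [show y ^ M = y ^ (M - 1) * y by
          rw [← rpow_add_one hy0.ne']; ring_nf] at hf
        have hyM : 0 < y ^ (M - 1) := by positivity
        refine nonneg_of_mul_nonneg_right (a := y ^ (M - 1)) ?_ hyM
        have : K ^ (p - 1) * K * (y ^ (M - 1) * y / M)
          = y ^ (M - 1) * (K ^ (p - 1) * K * (y / M)) := by ring
        linarith
    intro x hx
    have := hmono (left_mem_Icc.2 hsT.le) hx hx.1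
    simp only [hus] at this
    linarith
  have huhalf : ∀ x ∈ Icc s T, x ≤ r → K / 2 ≤ u x := by
    intro x hx hxr
    have h1 := hulow x hx
    have hx0 : 0 ≤ x := hs.trans hx.1
    have h2 : 0 ≤ K ^ (p - 1) * K * (s ^ 2 / (2 * M)) := by positivity
    have h3 : K ^ (p - 1) * K * (x ^ 2 / (2 * M)) ≤ K ^ (p - 1) * K * (r ^ 2 / (2 * M)) := by gcongr
    have h4 : K ^ (p - 1) * K * (r ^ 2 / (2 * M)) = K / (2 * M) := by
      rw [show K ^ (p - 1) * K * (r ^ 2 / (2 * M)) = (K ^ (p - 1) * r ^ 2) * K / (2 * M) by ring,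
        hKr, one_mul]
    have h5 : K / (2 * M) ≤ K / 2 := by gcongr; linarith
    linarith
  have hrT : r < T := by
    by_contra hcon
    have := huhalf T (right_mem_Icc.2 hsT.le) (not_lt.1 hcon)
    linarith
  have hsr' : s < r := by linarith
  have hanti : AntitoneOn (fun y => y ^ (M - 1) * g y) (Icc s T) := by
    refine antitoneOn_of_hasDerivWithinAt_nonpos (convex_Icc s T) hfc
      (f' := fun x => -(x ^ (M - 1) * (|u x| ^ (p - 1) * u x)))
      (fun y hy => ?_) (fun y hy => ?_)
    · rw [interior_Icc] at hy
      exact (h.hasDerivAt_flux (hIoo hy)).hasDerivWithinAt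
    · rw [interior_Icc] at hy
      have h0 := hpos y hy
      have hy0 := (hIoo hy).1
      simp only [Left.neg_nonpos_iff]
      positivity
  have hfr : r ^ (M - 1) * g r
      ≤ (K / 2) ^ (p - 1) * (K / 2) * (s ^ M / M) - (K / 2) ^ (p - 1) * (K / 2) * (r ^ M / M) := by
    have hsub : Icc s r ⊆ Icc s T := Icc_subset_Icc_right hrT.le
    have hsub' : Ioo s r ⊆ Ioo s T := Ioo_subset_Ioo_right hrT.le
    have hanti' : AntitoneOn
        (fun y => y ^ (M - 1) * g y + (K / 2) ^ (p - 1) * (K / 2) * (y ^ M / M)) (Icc s r) := by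
      refine antitoneOn_of_hasDerivWithinAt_nonpos (convex_Icc s r)
        ((hfc.mono hsub).add (by fun_prop))
        (f' := fun x => -(x ^ (M - 1) * (|u x| ^ (p - 1) * u x))
          + (K / 2) ^ (p - 1) * (K / 2) * x ^ (M - 1))
        (fun y hy => ?_) (fun y hy => ?_)
      · rw [interior_Icc] at hy
        exact ((h.hasDerivAt_flux (hIoo (hsub' hy))).add (hMd _ (hsub' hy))).hasDerivWithinAt
      · rw [interior_Icc] at hy
        have h0 := huhalf y (hsub (Ioo_subset_Icc_self hy)) hy.2.le
        have hy0 := (hIoo (hsub' hy)).1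
        have : (K / 2) ^ (p - 1) * (K / 2) ≤ |u y| ^ (p - 1) * u y := by
          rw [abs_of_nonneg (by linarith)]
          have : (K / 2) ^ (p - 1) ≤ u y ^ (p - 1) :=
            rpow_le_rpow (by positivity) h0 (by linarith)
          have : 0 ≤ u y := by linarith
          gcongr
        have := mul_le_mul_of_nonneg_left this (rpow_nonneg hy0.le (M - 1))
        linarith
    have := hanti' (left_mem_Icc.2 hsr'.le) (right_mem_Icc.2 hsr'.le) hsr'.le
    simp only [hflux] at this
    linarith
  have hsM : s ^ M ≤ r ^ M / 2 := by
    calc s ^ M ≤ (r * (1 / 2)) ^ M := rpow_le_rpow hs (by linarith) (by linarith)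
      _ = r ^ M * (1 / 2) ^ M := mul_rpow hr.le (by norm_num)
      _ ≤ r ^ M * (1 / 2) ^ (1 : ℝ) := by
        gcongr ?_ * ?_
        exact rpow_le_rpow_of_exponent_ge (by norm_num) (by norm_num) (by linarith)
      _ = r ^ M / 2 := by rw [rpow_one]; ring
  have hTr : T ^ (M - 1) * g T ≤ r ^ (M - 1) * g r :=
    hanti ⟨hsr'.le, hrT.le⟩ (right_mem_Icc.2 hsT.le) hrT.le
  have hc : 0 ≤ (K / 2) ^ (p - 1) * (K / 2) / M := by positivity
  have := mul_le_mul_of_nonneg_left hsM hc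
  calc T ^ (M - 1) * g T ≤ _ := hTr.trans hfr
    _ = (K / 2) ^ (p - 1) * (K / 2) / M * s ^ M - (K / 2) ^ (p - 1) * (K / 2) / M * r ^ M := by ring
    _ ≤ (K / 2) ^ (p - 1) * (K / 2) / M * (r ^ M / 2)
      - (K / 2) ^ (p - 1) * (K / 2) / M * r ^ M := by linarith
    _ = _ := by ring

lemma of_contDiffOn (hu : ContDiffOn ℝ 2 u (Icc 0 1))
    (hode : ∀ x ∈ Ioo (0 : ℝ) 1, -(deriv (fun y : ℝ => y ^ (M - 1) * deriv u y) x)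
      = x ^ (M - 1) * |u x| ^ (p - 1) * u x) :
    IsRadialSolution M p u (derivWithin u (Icc 0 1)) := by
  have huniq : UniqueDiffOn ℝ (Icc (0 : ℝ) 1) := uniqueDiffOn_Icc zero_lt_one
  have hg : ContDiffOn ℝ 1 (derivWithin u (Icc 0 1)) (Icc 0 1) :=
    hu.derivWithin huniq (by norm_num)
  have hnhds : ∀ x ∈ Ioo (0 : ℝ) 1, Icc (0 : ℝ) 1 ∈ 𝓝 x := fun x hx => Icc_mem_nhds hx.1 hx.2
  have hderiv : ∀ x ∈ Ioo (0 : ℝ) 1, deriv u x = derivWithin u (Icc 0 1) x :=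
    fun x hx => (derivWithin_of_mem_nhds (hnhds x hx)).symm
  refine ⟨hu.continuousOn, hg.continuousOn, fun x hx => ?_, fun x hx => ?_⟩
  · rw [← hderiv x hx]
    exact ((hu.differentiableOn (by norm_num)).differentiableAt (hnhds x hx)).hasDerivAt
  · have hd := ((hg.differentiableOn (by norm_num)).differentiableAt (hnhds x hx)).hasDerivAt
    have hflux := (hasDerivAt_rpow_const (p := M - 1) (Or.inl hx.1.ne')).mul hd
    have heq : (fun y : ℝ => y ^ (M - 1) * deriv u y) =ᶠ[𝓝 x]
        (fun y : ℝ => y ^ (M - 1)) * derivWithin u (Icc 0 1) := by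
      filter_upwards [isOpen_Ioo.mem_nhds hx] with y hy
      simp [hderiv y hy]
    have hx' := hode x hx
    rw [heq.deriv_eq, hflux.deriv, rpow_sub_one hx.1.ne'] at hx'
    refine hd.congr_deriv ?_
    have hxM : 0 < x ^ (M - 1) := rpow_pos_of_pos hx.1 _
    have hx0 := hx.1.ne'
    refine mul_left_cancel₀ hxM.ne' ?_
    field_simp at hx' ⊢
    linarith

lemma scaled_critical_rpow_le (h : IsRadialSolution M p u g) (hp : 1 < p)
    (hsub : M - 2 ≤ 2 * (2 / (p - 1))) (h1 : u 1 = 0) {s : ℝ} (hs : s ∈ Icc (0 : ℝ) 1)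
    (hcrit : s = 0 ∨ g s = 0) (hus : 0 < u s) :
    (s * u s ^ ((p - 1) / 2)) ^ (2 * (2 / (p - 1)) + 2) ≤ (p + 1) / 2 * g 1 ^ 2 := by
  have hp1 : 0 < p - 1 := by linarith
  rcases hs.1.eq_or_lt with rfl | hs0
  · rw [zero_mul, zero_rpow (by positivity)]
    positivity
  · have hgs : g s = 0 := hcrit.resolve_left hs0.ne'
    refine le_trans (le_of_eq ?_) (h.rpow_mul_abs_rpow_le_of_critical hp hsub h1 hs hs0 hgs)
    rw [mul_rpow hs0.le (by positivity), ← rpow_mul hus.le, abs_of_pos hus]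
    congr 2
    field_simp
    ring

lemma le_scaled_zero_rpow (h : IsRadialSolution M p u g) (hM : 2 < M) (hp : 1 < p)
    (hsub : M - 2 ≤ 2 * (2 / (p - 1))) (h1 : u 1 = 0) {s T : ℝ}
    (hs : 0 ≤ s) (hT : T ≤ 1) (hsT : s < T) (hus : 0 < u s) (huT : u T = 0)
    (hpos : ∀ x ∈ Ioo s T, 0 < u x) (hle : ∀ x ∈ Icc s T, u x ≤ u s)
    (hcrit : s = 0 ∨ g s = 0) (hsmall : s * u s ^ ((p - 1) / 2) ≤ 1 / 2) :
    (1 / 2) ^ p / (2 * M) ≤ |g 1| * (T * u s ^ ((p - 1) / 2)) ^ (M - 2 - 2 / (p - 1)) := by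
  have hp1 : 0 < p - 1 := by linarith
  have hT0 : 0 < T := hs.trans_lt hsT
  set K := u s
  set L := K ^ ((p - 1) / 2) with hL
  have hL0 : 0 < L := by positivity
  have hLsq : K ^ (p - 1) = L ^ 2 := by
    rw [hL, ← rpow_natCast, ← rpow_mul hus.le]; congr 1; push_cast; ring
  have hflux : s ^ (M - 1) * g s = 0 := by
    rcases hcrit with rfl | h0
    · rw [zero_rpow (by linarith), zero_mul]
    · rw [h0, mul_zero]
  have hf := h.flux_le hM hp (r := L⁻¹) hs hT hsT hus rfl huT hpos hle hflux (by positivity)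
    (by rw [hLsq]; field_simp)
    (by rw [inv_eq_one_div, div_div, le_div_iff₀ (by positivity)]; linarith)
  have hz := h.rpow_mul_abs_deriv_le_of_zero hp hsub h1 ⟨hT0.le, hT⟩ hT0 huT
  have hTpow : T ^ (M - 1) = T ^ (2 / (p - 1) + 1) * T ^ (M - 2 - 2 / (p - 1)) := by
    rw [← rpow_add hT0]; ring_nf
  have hbound : (K / 2) ^ (p - 1) * (K / 2) * L⁻¹ ^ M / (2 * M)
      ≤ |g 1| * T ^ (M - 2 - 2 / (p - 1)) :=
    calc _ ≤ T ^ (M - 1) * |g T| := by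
          have : T ^ (M - 1) * -g T ≤ T ^ (M - 1) * |g T| := by
            gcongr; exact neg_le_abs _
          linarith
      _ = (T ^ (2 / (p - 1) + 1) * |g T|) * T ^ (M - 2 - 2 / (p - 1)) := by rw [hTpow]; ring
      _ ≤ _ := by gcongr
  have hscale : (K / 2) ^ (p - 1) * (K / 2) * L⁻¹ ^ M * L ^ (M - 2 - 2 / (p - 1)) = (1 / 2) ^ p := by
    have e1 : (K / 2) ^ (p - 1) * (K / 2) = K ^ p * (1 / 2) ^ p := by
      rw [← rpow_add_one (by positivity), sub_add_cancel, div_eq_mul_one_div,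
        mul_rpow hus.le (by norm_num)]
    have e2 : L⁻¹ ^ M * L ^ (M - 2 - 2 / (p - 1)) = K ^ (-p) := by
      rw [inv_rpow hL0.le, ← rpow_neg hL0.le, ← rpow_add hL0, hL, ← rpow_mul hus.le]
      congr 1
      field_simp
      ring
    rw [mul_assoc, e1, e2, rpow_neg hus.le]
    field_simp
  rw [mul_rpow hT0.le hL0.le, ← mul_assoc, ← hscale]
  calc _ = (K / 2) ^ (p - 1) * (K / 2) * L⁻¹ ^ M / (2 * M) * L ^ (M - 2 - 2 / (p - 1)) := by ring
    _ ≤ _ := by gcongr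

end IsRadialSolution

lemma tendsto_zero_of_rpow_le {l : Filter ℝ} {S e c : ℝ → ℝ} {e₀ : ℝ} (he₀ : 0 < e₀)
    (he : Tendsto e l (𝓝 e₀)) (hc : Tendsto c l (𝓝 0)) (hS : ∀ᶠ p in l, 0 ≤ S p)
    (hle : ∀ᶠ p in l, S p ^ e p ≤ c p) : Tendsto S l (𝓝 0) := by
  have hlim : Tendsto (fun p => c p ^ (e p)⁻¹) l (𝓝 0) := by
    have := hc.rpow (he.inv₀ he₀.ne') (Or.inr (inv_pos.2 he₀))
    rwa [zero_rpow (inv_pos.2 he₀).ne'] at this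
  refine tendsto_of_tendsto_of_tendsto_of_le_of_le' tendsto_const_nhds hlim hS ?_
  filter_upwards [hS, hle, he.eventually_const_lt he₀] with p h0 h1 h2
  calc S p = (S p ^ e p) ^ (e p)⁻¹ := (rpow_rpow_inv h0 h2.ne').symm
    _ ≤ c p ^ (e p)⁻¹ := rpow_le_rpow (rpow_nonneg h0 _) h1 (inv_nonneg.2 h2.le)

lemma tendsto_atTop_of_le_mul_rpow {l : Filter ℝ} {S e c d : ℝ → ℝ} {e₀ d₀ : ℝ} (he₀ : 0 < e₀)
    (hd₀ : 0 < d₀) (he : Tendsto e l (𝓝 e₀)) (hc : Tendsto c l (𝓝 0)) (hd : Tendsto d l (𝓝 d₀))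
    (hS : ∀ᶠ p in l, 0 < S p) (hle : ∀ᶠ p in l, d p ≤ c p * S p ^ e p) : Tendsto S l atTop := by
  have hinv : Tendsto (fun p => (S p)⁻¹) l (𝓝 0) := by
    have hcd : Tendsto (fun p => c p / d p) l (𝓝 0) := by
      have := hc.div hd hd₀.ne'
      rwa [zero_div] at this
    refine tendsto_zero_of_rpow_le he₀ he hcd (hS.mono fun p h => (inv_pos.2 h).le) ?_
    filter_upwards [hS, hle, hd.eventually_const_lt hd₀] with p h0 h1 h2
    have h3 : 0 < S p ^ e p := rpow_pos_of_pos h0 _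
    rw [inv_rpow h0.le, le_div_iff₀ h2, inv_mul_le_iff₀ h3]
    linarith
  have : Tendsto (fun p => (S p)⁻¹) l (𝓝[>] 0) :=
    tendsto_nhdsWithin_iff.2 ⟨hinv, hS.mono fun p h => inv_pos.2 h⟩
  exact this.inv_tendsto_nhdsGT_zero.congr fun p => inv_inv (S p)

/-- under the same hypotheses as Statement 8, with `𝓜̃_{i,p} = 𝓜_{i,p}^{(p-1)/2}`,
as `p → p_M⁻`: (a) `t_{i+1,p}·𝓜̃_{i,p} → +∞` for `i = 0,…,m-1`;
(b) `s_{i,p}·𝓜̃_{i,p} → 0` for `i = 1,…,m-1`; (c) `t_{i,p}·𝓜̃_{i,p} → 0` for `i = 1,…,m-1`. -/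
theorem stmt10 (M pM : ℝ) (hM : 2 < M) (hpM : pM = (M + 2) / (M - 2))
    (m : ℕ) (hm : 2 ≤ m)
    (v : ℝ → ℝ → ℝ) (t s Mx : ℝ → ℕ → ℝ)
    (hreg : ∀ p ∈ Set.Ioo 1 pM, ContDiffOn ℝ 2 (v p) (Set.Icc 0 1))
    (hode : ∀ p ∈ Set.Ioo 1 pM, ∀ x ∈ Set.Ioo (0 : ℝ) 1,
      -(deriv (fun y : ℝ => y ^ (M - 1) * deriv (v p) y) x)
        = x ^ (M - 1) * |v p x| ^ (p - 1) * v p x)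
    (hv0 : ∀ p ∈ Set.Ioo 1 pM, 0 < v p 0)
    (hd0 : ∀ p ∈ Set.Ioo 1 pM, deriv (v p) 0 = 0)
    (hv1 : ∀ p ∈ Set.Ioo 1 pM, v p 1 = 0)
    (ht0 : ∀ p ∈ Set.Ioo 1 pM, t p 0 = 0)
    (htm : ∀ p ∈ Set.Ioo 1 pM, t p m = 1)
    (htmono : ∀ p ∈ Set.Ioo 1 pM, ∀ i < m, t p i < t p (i + 1))
    (htzero : ∀ p ∈ Set.Ioo 1 pM, ∀ i, 1 ≤ i → i ≤ m → v p (t p i) = 0)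
    (hsign : ∀ p ∈ Set.Ioo 1 pM, ∀ i < m, ∀ x ∈ Set.Ioo (t p i) (t p (i + 1)),
      0 < (-1 : ℝ) ^ i * v p x)
    (hs : ∀ p ∈ Set.Ioo 1 pM, ∀ i < m, s p i ∈ Set.Ico (t p i) (t p (i + 1)))
    (hMx : ∀ p ∈ Set.Ioo 1 pM, ∀ i < m, Mx p i = |v p (s p i)|)
    (hMxmax : ∀ p ∈ Set.Ioo 1 pM, ∀ i < m,
      ∀ x ∈ Set.Icc (t p i) (t p (i + 1)), |v p x| ≤ Mx p i)
    (C δ : ℝ) (hC : 0 < C) (hδ : 0 < δ)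
    (henergy : ∀ p, pM - δ < p → 1 < p → p < pM →
      (∫ x in (0 : ℝ)..1, x ^ (M - 1) * (deriv (v p) x) ^ 2) ≤ C) :
    (∀ i < m,
      Tendsto (fun p => t p (i + 1) * Mx p i ^ ((p - 1) / 2)) (𝓝[<] pM) atTop) ∧
    (∀ i, 1 ≤ i → i ≤ m - 1 →
      Tendsto (fun p => s p i * Mx p i ^ ((p - 1) / 2)) (𝓝[<] pM) (𝓝 0)) ∧
    (∀ i, 1 ≤ i → i ≤ m - 1 →
      Tendsto (fun p => t p i * Mx p i ^ ((p - 1) / 2)) (𝓝[<] pM) (𝓝 0)) := by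
  have hM2 : 0 < M - 2 := by linarith
  have hpM1 : 1 < pM := by rw [hpM, lt_div_iff₀ hM2]; linarith
  have hsub : ∀ p ∈ Ioo 1 pM, M - 2 ≤ 2 * (2 / (p - 1)) := by
    intro p hp
    have hlt := hp.2
    rw [hpM, lt_div_iff₀ hM2] at hlt
    rw [← mul_div_assoc, le_div_iff₀ (by linarith [hp.1])]
    linarith
  have heps : ∀ p ∈ Ioo 1 pM, 0 ≤ M / (p + 1) - (M - 2) / 2 := by
    intro p hp
    have hlt := hp.2
    rw [hpM, lt_div_iff₀ hM2] at hlt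
    rw [sub_nonneg, div_le_div_iff₀ two_pos (by linarith [hp.1])]
    linarith
  set g : ℝ → ℝ → ℝ := fun p => derivWithin (v p) (Icc 0 1) with hgdef
  have hsol : ∀ p ∈ Ioo 1 pM, IsRadialSolution M p (v p) (g p) :=
    fun p hp => .of_contDiffOn (hreg p hp) (hode p hp)
  set η : ℝ → ℝ := fun p => 2 * (M / (p + 1) - (M - 2) / 2) * C with hη
  have hg1 : ∀ p ∈ Ioo 1 pM, pM - δ < p → g p 1 ^ 2 ≤ η p := by
    intro p hp hpδ
    rw [(hsol p hp).sq_deriv_one_eq hM hp.1 (hv1 p hp)]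
    have hint : ∫ x in (0 : ℝ)..1, x ^ (M - 1) * g p x ^ 2
        = ∫ x in (0 : ℝ)..1, x ^ (M - 1) * (deriv (v p) x) ^ 2 := by
      simp only [intervalIntegral.integral_of_le zero_le_one,
        MeasureTheory.integral_Ioc_eq_integral_Ioo]
      refine MeasureTheory.setIntegral_congr_fun measurableSet_Ioo fun x hx => ?_
      simp only [hgdef, derivWithin_of_mem_nhds (Icc_mem_nhds hx.1 hx.2)]
    rw [hint]
    exact mul_le_mul_of_nonneg_left (henergy p hpδ hp.1 hp.2)
      (mul_nonneg zero_le_two (heps p hp))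
  have ht_nonneg : ∀ p ∈ Ioo 1 pM, ∀ i ≤ m, 0 ≤ t p i := by
    intro p hp i
    induction i with
    | zero => intro _; exact (ht0 p hp).ge
    | succ i ih => intro hi; exact (ih (by omega)).trans (htmono p hp i (by omega)).le
  have ht_le : ∀ p ∈ Ioo 1 pM, ∀ j ≤ m, t p (m - j) ≤ 1 := by
    intro p hp j
    induction j with
    | zero => intro _; exact (htm p hp).le
    | succ j ih =>
      intro hj
      have h2 := htmono p hp (m - (j + 1)) (by omega)
      rw [show m - (j + 1) + 1 = m - j by omega] at h2
      exact h2.le.trans (ih (by omega))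
  have hev : ∀ᶠ p in 𝓝[<] pM, p ∈ Ioo 1 pM ∧ pM - δ < p := by
    filter_upwards [Ioo_mem_nhdsLT hpM1, Ioo_mem_nhdsLT (show pM - δ < pM by linarith)] with p h1 h2
    exact ⟨h1, h2.1⟩
  have hzone : ∀ i < m, ∀ p ∈ Ioo 1 pM, pM - δ < p →
      0 < Mx p i ∧ 0 ≤ s p i ∧ 0 < t p (i + 1) ∧
      (s p i * Mx p i ^ ((p - 1) / 2)) ^ (2 * (2 / (p - 1)) + 2) ≤ (p + 1) / 2 * η p ∧
      (s p i * Mx p i ^ ((p - 1) / 2) ≤ 1 / 2 → (1 / 2) ^ p / (2 * M) ≤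
        √(η p) * (t p (i + 1) * Mx p i ^ ((p - 1) / 2)) ^ (M - 2 - 2 / (p - 1))) := by
    intro i hi p hp hpδ
    have hσ : |(-1 : ℝ) ^ i| = 1 := by simp
    have hu := (hsol p hp).const_mul_sign hσ
    have hti := ht_nonneg p hp i hi.le
    have hti1 : t p (i + 1) ≤ 1 := by
      have := ht_le p hp (m - (i + 1)) (by omega)
      rwa [show m - (m - (i + 1)) = i + 1 by omega] at this
    have hlt := htmono p hp i hi
    have hsi := hs p hp i hi
    have hs0 : 0 ≤ s p i := hti.trans hsi.1
    have hMpos : 0 < Mx p i := by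
      obtain ⟨x, hx⟩ := exists_between hlt
      have hx' := hsign p hp i hi x hx
      have : v p x ≠ 0 := by rintro h0; simp [h0] at hx'
      exact (abs_pos.2 this).trans_le (hMxmax p hp i hi x (Ioo_subset_Icc_self hx))
    have habs : ∀ x, |(-1 : ℝ) ^ i * v p x| = |v p x| := fun x => by rw [abs_mul, hσ, one_mul]
    have hcases : (s p i = 0 ∧ i = 0) ∨ s p i ∈ Ioo (t p i) (t p (i + 1)) := by
      rcases hsi.1.eq_or_lt with heq | hlt'
      · left
        rcases Nat.eq_zero_or_pos i with rfl | hipos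
        · exact ⟨by rw [← heq, ht0 p hp], rfl⟩
        · have := hMx p hp i hi
          rw [← heq, htzero p hp i hipos hi.le, abs_zero] at this
          exact absurd this hMpos.ne'
      · exact Or.inr ⟨hlt', hsi.2⟩
    have hus : 0 < (-1 : ℝ) ^ i * v p (s p i) := by
      rcases hcases with ⟨h0, rfl⟩ | h0
      · simpa [h0] using hv0 p hp
      · exact hsign p hp i hi _ h0
    have hMeq : Mx p i = (-1 : ℝ) ^ i * v p (s p i) := by
      rw [hMx p hp i hi, ← habs, abs_of_pos hus]
    have hle : ∀ x ∈ Icc (t p i) (t p (i + 1)),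
        (-1 : ℝ) ^ i * v p x ≤ (-1 : ℝ) ^ i * v p (s p i) := by
      intro x hx
      rw [← hMeq]
      exact (le_abs_self _).trans ((habs x).trans_le (hMxmax p hp i hi x hx))
    have hcrit : s p i = 0 ∨ (-1 : ℝ) ^ i * g p (s p i) = 0 := by
      rcases hcases with h0 | h0
      · exact Or.inl h0.1
      · right
        have hmax : IsLocalMax (fun x => (-1 : ℝ) ^ i * v p x) (s p i) := by
          filter_upwards [Icc_mem_nhds h0.1 h0.2] with x hx using hle x hx
        exact hmax.hasDerivAt_eq_zero
          (hu.hasDerivAt _ ⟨hti.trans_lt h0.1, h0.2.trans_le hti1⟩)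
    have hu1 : (-1 : ℝ) ^ i * v p 1 = 0 := by rw [hv1 p hp, mul_zero]
    have hgsq : ((-1 : ℝ) ^ i * g p 1) ^ 2 ≤ η p := by
      rw [← sq_abs, abs_mul, hσ, one_mul, sq_abs]
      exact hg1 p hp hpδ
    have hp1 := hp.1
    refine ⟨hMpos, hs0, hti.trans_lt hlt, ?_, fun hsmall => ?_⟩
    · have := hu.scaled_critical_rpow_le hp.1 (hsub p hp) hu1 ⟨hs0, hsi.2.le.trans hti1⟩ hcrit hus
      simp only [← hMeq] at this
      exact this.trans (by gcongr)
    · have hmain := hu.le_scaled_zero_rpow hM hp.1 (hsub p hp) hu1 hs0 hti1 hsi.2 hus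
        (by rw [htzero p hp (i + 1) (by omega) (by omega), mul_zero])
        (fun x hx => hsign p hp i hi x ⟨hsi.1.trans_lt hx.1, hx.2⟩)
        (fun x hx => hle x ⟨hsi.1.trans hx.1, hx.2⟩) hcrit (by simpa only [← hMeq] using hsmall)
      simp only [← hMeq] at hmain
      refine hmain.trans ?_
      have := Real.abs_le_sqrt hgsq
      have hT0 : 0 < t p (i + 1) := hti.trans_lt hlt
      gcongr
  have hid : Tendsto (fun p : ℝ => p) (𝓝[<] pM) (𝓝 pM) := nhdsWithin_le_nhds
  have hpM1' : pM - 1 = 4 / (M - 2) := by rw [hpM]; field_simp; ring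
  have hpM2 : pM + 1 = 2 * M / (M - 2) := by rw [hpM]; field_simp; ring
  have hα : Tendsto (fun p : ℝ => 2 / (p - 1)) (𝓝[<] pM) (𝓝 ((M - 2) / 2)) := by
    have := (tendsto_const_nhds (x := (2 : ℝ))).div (hid.sub_const 1) (by linarith)
    rw [hpM1', show 2 / (4 / (M - 2)) = (M - 2) / 2 by field_simp; ring] at this
    exact this
  have hηlim : Tendsto η (𝓝[<] pM) (𝓝 0) := by
    have := ((((tendsto_const_nhds (x := M)).div (hid.add_const 1) (by linarith)).sub_const
      ((M - 2) / 2)).const_mul 2).mul_const C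
    rw [hpM2, show 2 * (M / (2 * M / (M - 2)) - (M - 2) / 2) * C = 0 by field_simp; ring] at this
    exact this
  have hS : ∀ i < m, Tendsto (fun p => s p i * Mx p i ^ ((p - 1) / 2)) (𝓝[<] pM) (𝓝 0) := by
    intro i hi
    refine tendsto_zero_of_rpow_le (e := fun p => 2 * (2 / (p - 1)) + 2)
      (c := fun p => (p + 1) / 2 * η p) (e₀ := 2 * ((M - 2) / 2) + 2) (by linarith)
      ((hα.const_mul 2).add_const 2) ?_ ?_ ?_
    · simpa using ((hid.add_const 1).div_const 2).mul hηlim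
    · filter_upwards [hev] with p hp
      obtain ⟨h1, h2, -⟩ := hzone i hi p hp.1 hp.2
      positivity
    · filter_upwards [hev] with p hp using (hzone i hi p hp.1 hp.2).2.2.2.1
  refine ⟨fun i hi => ?_, fun i h1 hi => hS i (by omega), fun i h1 hi => ?_⟩
  · refine tendsto_atTop_of_le_mul_rpow (e := fun p => M - 2 - 2 / (p - 1))
      (c := fun p => √(η p)) (d := fun p => (1 / 2) ^ p / (2 * M)) (e₀ := M - 2 - (M - 2) / 2)
      (d₀ := (1 / 2) ^ pM / (2 * M)) (by linarith) (by positivity) (hα.const_sub _) ?_ ?_ ?_ ?_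
    · simpa using hηlim.sqrt
    · exact ((tendsto_const_nhds (x := (1 / 2 : ℝ))).rpow hid (Or.inl (by norm_num))).div_const _
    · filter_upwards [hev] with p hp
      obtain ⟨h1, h2, h3, -⟩ := hzone i hi p hp.1 hp.2
      positivity
    · filter_upwards [hev, (hS i hi).eventually_le_const (show (0 : ℝ) < 1 / 2 by norm_num)]
        with p hp hsmall
      exact (hzone i hi p hp.1 hp.2).2.2.2.2 hsmall
  · have him : i < m := by omega
    refine tendsto_of_tendsto_of_tendsto_of_le_of_le' tendsto_const_nhds (hS i him) ?_ ?_
    · filter_upwards [hev] with p hp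
      have h1 := (hzone i him p hp.1 hp.2).1
      have h2 := ht_nonneg p hp.1 i him.le
      positivity
    · filter_upwards [hev] with p hp
      have h1 := (hzone i him p hp.1 hp.2).1
      have h2 := (hs p hp.1 i him).1
      gcongr
end

section
/- Let M > 2 be real and p_M = (M+2)/(M-2). For each p ∈ (1, p_M) let v_p be a C² positive radial solution: v_p ∈ C²([0,1]), v_p > 0 on [0,1), v_p(1) = 0, v_p'(0) = 0, solving -(t^{M-1} v_p'(t))' = t^{M-1} v_p(t)^{p} on (0,1). Then, as p → p_M⁻, 𝓜_{0,p} := v_p(0) → +∞, and the rescaled functions ṽ_{0,p}(t) = v_p(t / 𝓜̃_{0,p}) / 𝓜_{0,p}, with 𝓜̃_{0,p} = 𝓜_{0,p}^{(p-1)/2}, converge to V_M in C¹ locally on [0, +∞): for every R > 0, ṽ_{0,p} → V_M and ṽ_{0,p}' → V_M' uniformly on [0,R]. -/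
open Real Filter Set Topology

/-- On the unit interval, `q ↦ x ^ q` is `1`-Lipschitz for exponents at least `1`. -/
lemma abs_rpow_sub_rpow_exponent_le {x p q : ℝ} (hx0 : 0 ≤ x) (hx1 : x ≤ 1) (hp : 1 ≤ p)
    (hpq : p ≤ q) : |x ^ p - x ^ q| ≤ q - p := by
  rcases hx0.eq_or_lt with rfl | hx
  · rw [zero_rpow (by linarith), zero_rpow (by linarith)]
    simpa using hpq
  have hle : x ^ q ≤ x ^ p := rpow_le_rpow_of_exponent_ge hx hx1 hpq
  rw [abs_of_nonneg (by linarith)]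
  have hsplit : x ^ q = x ^ p * x ^ (q - p) := by
    rw [← rpow_add hx]
    congr 1
    ring
  have hexp : 1 + log x * (q - p) ≤ x ^ (q - p) := by
    rw [rpow_def_of_pos hx]
    linarith [add_one_le_exp (log x * (q - p))]
  have hlog : -log x ≤ x⁻¹ := by
    have := log_le_sub_one_of_pos (inv_pos.mpr hx)
    rw [log_inv] at this
    linarith
  have hone : x ^ p * x⁻¹ ≤ 1 := by
    rw [← rpow_neg_one, ← rpow_add hx]
    exact rpow_le_one hx0 hx1 (by linarith)
  have hp0 : 0 ≤ x ^ p := rpow_nonneg hx0 p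
  calc x ^ p - x ^ q = x ^ p * (1 - x ^ (q - p)) := by rw [hsplit]; ring
    _ ≤ x ^ p * (-log x * (q - p)) := by gcongr; linarith
    _ ≤ x ^ p * (x⁻¹ * (q - p)) := by gcongr
    _ = x ^ p * x⁻¹ * (q - p) := by ring
    _ ≤ 1 * (q - p) := by gcongr
    _ = q - p := one_mul _

/-- On the unit interval, `x ↦ x ^ q` is `q`-Lipschitz when `1 ≤ q`. -/
lemma abs_rpow_sub_rpow_base_le {x y q : ℝ} (hx : x ∈ Icc (0 : ℝ) 1) (hy : y ∈ Icc (0 : ℝ) 1)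
    (hq : 1 ≤ q) : |x ^ q - y ^ q| ≤ q * |x - y| := by
  refine (convex_Icc (0 : ℝ) 1).norm_image_sub_le_of_norm_hasDerivWithin_le (f := fun z => z ^ q)
    (f' := fun z => q * z ^ (q - 1))
    (fun z _ => (hasDerivAt_rpow_const (Or.inr hq)).hasDerivWithinAt) (fun z hz => ?_) hy hx
  have h0 : 0 ≤ z ^ (q - 1) := rpow_nonneg hz.1 _
  rw [norm_of_nonneg (by positivity)]
  exact mul_le_of_le_one_right (by linarith) (rpow_le_one hz.1 hz.2 (by linarith))

/-- Energy form of Grönwall's inequality for `d'' + (a / t) d' = -g` with zero initial data and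
`|g| ≤ ε + K |d|`; the singular damping term has a favourable sign. -/
lemma energy_le_of_damped_ode {d d₁ g : ℝ → ℝ} {a K ε T : ℝ} (ha : 0 ≤ a) (hK : 0 ≤ K)
    (hd : ContinuousOn d (Icc 0 T)) (hd₁ : ContinuousOn d₁ (Icc 0 T))
    (h0 : d 0 = 0) (h₁0 : d₁ 0 = 0)
    (hderiv : ∀ t ∈ Ioo 0 T, HasDerivAt d (d₁ t) t)
    (hderiv₁ : ∀ t ∈ Ioo 0 T, HasDerivAt d₁ (-(a / t) * d₁ t - g t) t)
    (hg : ∀ t ∈ Ioo 0 T, |g t| ≤ ε + K * |d t|) {t : ℝ} (ht : t ∈ Icc 0 T) :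
    d t ^ 2 + d₁ t ^ 2 ≤ ε ^ 2 * exp ((K + 2) * t) := by
  have hanti : AntitoneOn (fun t => (d t ^ 2 + d₁ t ^ 2 + ε ^ 2) * exp (-(K + 2) * t))
      (Icc 0 T) := by
    refine antitoneOn_of_hasDerivWithinAt_nonpos (convex_Icc 0 T) (by fun_prop)
      (f' := fun t => (2 * d t * d₁ t + 2 * d₁ t * (-(a / t) * d₁ t - g t)
        - (K + 2) * (d t ^ 2 + d₁ t ^ 2 + ε ^ 2)) * exp (-(K + 2) * t)) ?_ ?_
    · intro s hs
      rw [interior_Icc] at hs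
      have he : HasDerivAt (fun s => exp (-(K + 2) * s))
          (exp (-(K + 2) * s) * (-(K + 2))) s := by
        simpa using ((hasDerivAt_id s).const_mul (-(K + 2))).exp
      have := ((((hderiv s hs).pow 2).add ((hderiv₁ s hs).pow 2)).add_const (ε ^ 2)).mul he
      refine HasDerivAt.hasDerivWithinAt (this.congr_deriv ?_)
      simp only [Pi.add_apply, Pi.pow_apply]
      push_cast
      ring
    · intro s hs
      rw [interior_Icc] at hs
      refine mul_nonpos_of_nonpos_of_nonneg ?_ (exp_pos _).le
      have hdamp : 0 ≤ a / s * d₁ s ^ 2 := by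
        have := hs.1
        positivity
      have hgs : -(d₁ s * g s) ≤ |d₁ s| * (ε + K * |d s|) := by
        calc -(d₁ s * g s) ≤ |d₁ s * g s| := neg_le_abs _
          _ = |d₁ s| * |g s| := abs_mul _ _
          _ ≤ _ := by gcongr; exact hg s hs
      have hcross : d s * d₁ s ≤ |d s| * |d₁ s| := by
        rw [← abs_mul]
        exact le_abs_self _
      rw [← sq_abs (d s), ← sq_abs (d₁ s)]
      nlinarith [sq_nonneg (|d s| - |d₁ s|), sq_nonneg (|d₁ s| - ε),
        mul_nonneg hK (sq_nonneg (|d s| - |d₁ s|)), sq_nonneg ε,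
        mul_nonneg hK (sq_nonneg ε)]
  have h := hanti (left_mem_Icc.mpr (ht.1.trans ht.2)) ht ht.1
  simp only [h0, h₁0, mul_zero, exp_zero, mul_one] at h
  rw [neg_mul, exp_neg, ← div_eq_mul_inv, div_le_iff₀ (exp_pos _)] at h
  nlinarith [sq_nonneg ε]

lemma bubble_base_pos {M : ℝ} (hM : 2 < M) (x : ℝ) : 0 < 1 + x ^ 2 / (M * (M - 2)) := by
  have : 0 < M - 2 := by linarith
  positivity

lemma hasDerivAt_bubble_rpow {M : ℝ} (hM : 2 < M) (r x : ℝ) :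
    HasDerivAt (fun x : ℝ => (1 + x ^ 2 / (M * (M - 2))) ^ r)
      (2 * x / (M * (M - 2)) * r * (1 + x ^ 2 / (M * (M - 2))) ^ (r - 1)) x := by
  refine HasDerivAt.rpow_const ?_ (Or.inl (bubble_base_pos hM x).ne')
  simpa using ((hasDerivAt_pow 2 x).div_const (M * (M - 2))).const_add 1

lemma hasDerivAt_bubble_s11 {M : ℝ} (hM : 2 < M) (x : ℝ) :
    HasDerivAt (fun x : ℝ => (1 + x ^ 2 / (M * (M - 2))) ^ (-(M - 2) / 2))
      (-(x / M) * (1 + x ^ 2 / (M * (M - 2))) ^ (-M / 2)) x := by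
  have h2 : M - 2 ≠ 0 := by linarith
  have hM0 : M ≠ 0 := by linarith
  convert hasDerivAt_bubble_rpow hM (-(M - 2) / 2) x using 1
  rw [show -(M - 2) / 2 - 1 = -M / 2 by ring]
  field_simp

lemma hasDerivAt_bubble_deriv {M : ℝ} (hM : 2 < M) {x : ℝ} (hx : x ≠ 0) :
    HasDerivAt (fun x : ℝ => -(x / M) * (1 + x ^ 2 / (M * (M - 2))) ^ (-M / 2))
      (-((M - 1) / x) * (-(x / M) * (1 + x ^ 2 / (M * (M - 2))) ^ (-M / 2))
        - ((1 + x ^ 2 / (M * (M - 2))) ^ (-(M - 2) / 2)) ^ ((M + 2) / (M - 2))) x := by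
  have h2 : M - 2 ≠ 0 := by linarith
  have hM0 : M ≠ 0 := by linarith
  have hu := bubble_base_pos hM x
  refine (((hasDerivAt_id x).div_const M).neg.mul
    (hasDerivAt_bubble_rpow hM (-M / 2) x)).congr_deriv ?_
  rw [← rpow_mul hu.le, show -(M - 2) / 2 * ((M + 2) / (M - 2)) = -M / 2 - 1 by field_simp; ring]
  have hsplit : (1 + x ^ 2 / (M * (M - 2))) ^ (-M / 2)
      = (1 + x ^ 2 / (M * (M - 2))) * (1 + x ^ 2 / (M * (M - 2))) ^ (-M / 2 - 1) := by
    rw [rpow_sub_one hu.ne', mul_div_cancel₀ _ hu.ne']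
  simp only [Pi.neg_apply, id]
  rw [hsplit]
  generalize (1 + x ^ 2 / (M * (M - 2))) ^ (-M / 2 - 1) = y
  field_simp
  ring

lemma bubble_mem_Icc {M : ℝ} (hM : 2 < M) (x : ℝ) :
    (1 + x ^ 2 / (M * (M - 2))) ^ (-(M - 2) / 2) ∈ Icc (0 : ℝ) 1 := by
  have : 0 < M - 2 := by linarith
  refine ⟨rpow_nonneg (bubble_base_pos hM x).le _, rpow_le_one_of_one_le_of_nonpos ?_ (by linarith)⟩
  have : 0 ≤ x ^ 2 / (M * (M - 2)) := by positivity
  linarith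

/-- A `C²` solution of the radial equation in divergence form has a derivative that extends
continuously by zero to the origin and solves the equation in nondivergence form. -/
lemma exists_radial_derivative {M p : ℝ} (hM : 2 < M) (hp : 0 < p) {v : ℝ → ℝ}
    (hreg : ContDiffOn ℝ 2 v (Icc 0 1))
    (hode : ∀ x ∈ Ioo (0 : ℝ) 1,
      -(deriv (fun y : ℝ => y ^ (M - 1) * deriv v y) x) = x ^ (M - 1) * v x ^ p) :
    ∃ v₁ : ℝ → ℝ, ContinuousOn v₁ (Icc 0 1) ∧ v₁ 0 = 0 ∧
      (∀ x ∈ Ioo (0 : ℝ) 1, HasDerivAt v (v₁ x) x) ∧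
      ∀ x ∈ Ioo (0 : ℝ) 1, HasDerivAt v₁ (-((M - 1) / x) * v₁ x - v x ^ p) x := by
  have hu : UniqueDiffOn ℝ (Icc (0 : ℝ) 1) := uniqueDiffOn_Icc one_pos
  set v₁ := derivWithin v (Icc 0 1) with hv₁
  set v₂ := derivWithin v₁ (Icc 0 1) with hv₂
  have hreg₁ : ContDiffOn ℝ 1 v₁ (Icc 0 1) := hreg.derivWithin hu (by norm_num)
  have hc₂ : ContinuousOn v₂ (Icc 0 1) := hreg₁.continuousOn_derivWithin hu le_rfl
  have hd : ∀ x ∈ Ioo (0 : ℝ) 1, HasDerivAt v (v₁ x) x := fun x hx =>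
    ((hreg.differentiableOn (by norm_num)) x (Ioo_subset_Icc_self hx)).hasDerivWithinAt.hasDerivAt
      (Icc_mem_nhds hx.1 hx.2)
  have hd₁ : ∀ x ∈ Ioo (0 : ℝ) 1, HasDerivAt v₁ (v₂ x) x := fun x hx =>
    ((hreg₁.differentiableOn (by norm_num)) x (Ioo_subset_Icc_self hx)).hasDerivWithinAt.hasDerivAt
      (Icc_mem_nhds hx.1 hx.2)
  have hode' : ∀ x ∈ Ioo (0 : ℝ) 1, v₂ x = -((M - 1) / x) * v₁ x - v x ^ p := by
    intro x hx
    have hx0 : x ≠ 0 := hx.1.ne'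
    have hloc : (fun y : ℝ => y ^ (M - 1) * deriv v y) =ᶠ[𝓝 x] fun y => y ^ (M - 1) * v₁ y := by
      filter_upwards [isOpen_Ioo.mem_nhds hx] with y hy
      rw [(hd y hy).deriv]
    have hprod := ((hasDerivAt_rpow_const (p := M - 1) (Or.inl hx0)).mul (hd₁ x hx)).deriv
    have h := hode x hx
    rw [hloc.deriv_eq] at h
    erw [hprod] at h
    rw [rpow_sub_one hx0] at h
    have hpow : x ^ (M - 1) ≠ 0 := (rpow_pos_of_pos hx.1 _).ne'
    apply mul_left_cancel₀ hpow
    field_simp at h ⊢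
    linarith
  have hv₁0 : v₁ 0 = 0 := by
    have hmem : (0 : ℝ) ∈ Icc (0 : ℝ) 1 := by simp
    have heq : ∀ x ∈ Ioo (0 : ℝ) 1, (M - 1) * v₁ x = -(x * v₂ x) - x * v x ^ p := by
      intro x hx
      rw [hode' x hx]
      have hx0 : x ≠ 0 := hx.1.ne'
      field_simp
      ring
    have hcl : ContinuousOn (fun x => (M - 1) * v₁ x) (Icc 0 1) :=
      continuousOn_const.mul hreg₁.continuousOn
    have hcr : ContinuousOn (fun x => -(x * v₂ x) - x * v x ^ p) (Icc 0 1) :=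
      (continuousOn_id.mul hc₂).neg.sub
        (continuousOn_id.mul (hreg.continuousOn.rpow_const fun _ _ => Or.inr hp.le))
    have := (show EqOn _ _ (Ioo (0 : ℝ) 1) from heq).of_subset_closure hcl hcr
      Ioo_subset_Icc_self (by rw [closure_Ioo zero_ne_one]) hmem
    simp only [zero_mul, neg_zero, sub_zero] at this
    exact (mul_eq_zero.mp this).resolve_left (by linarith)
  exact ⟨v₁, hreg₁.continuousOn, hv₁0, hd, fun x hx => hode' x hx ▸ hd₁ x hx⟩

/-- A nonnegative solution of the radial equation is at most its value at the origin. -/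
lemma radial_solution_le_value_zero {M p : ℝ} (hM : 2 < M) {v v₁ : ℝ → ℝ}
    (hv : ContinuousOn v (Icc 0 1)) (hv₁ : ContinuousOn v₁ (Icc 0 1))
    (hpos : ∀ x ∈ Ioo (0 : ℝ) 1, 0 ≤ v x)
    (hd : ∀ x ∈ Ioo (0 : ℝ) 1, HasDerivAt v (v₁ x) x)
    (hd₁ : ∀ x ∈ Ioo (0 : ℝ) 1, HasDerivAt v₁ (-((M - 1) / x) * v₁ x - v x ^ p) x)
    {x : ℝ} (hx : x ∈ Icc (0 : ℝ) 1) : v x ≤ v 0 := by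
  have hmem : (0 : ℝ) ∈ Icc (0 : ℝ) 1 := by simp
  have hflux : AntitoneOn (fun x => x ^ (M - 1) * v₁ x) (Icc 0 1) := by
    refine antitoneOn_of_hasDerivWithinAt_nonpos (convex_Icc 0 1)
      (f' := fun x => -(x ^ (M - 1) * v x ^ p))
      ((continuousOn_id.rpow_const fun _ _ => Or.inr (by linarith)).mul hv₁) ?_ ?_
    · intro y hy
      rw [interior_Icc] at hy
      have hy0 : y ≠ 0 := hy.1.ne'
      refine HasDerivAt.hasDerivWithinAt (((hasDerivAt_rpow_const (p := M - 1)
        (Or.inl hy0)).mul (hd₁ y hy)).congr_deriv ?_)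
      rw [rpow_sub_one hy0]
      field_simp
      ring
    · intro y hy
      rw [interior_Icc] at hy
      have := mul_nonneg (rpow_nonneg hy.1.le (M - 1)) (rpow_nonneg (hpos y hy) p)
      linarith
  have hanti : AntitoneOn v (Icc 0 1) := by
    refine antitoneOn_of_hasDerivWithinAt_nonpos (convex_Icc 0 1) hv (f' := v₁) ?_ ?_
    · intro y hy
      rw [interior_Icc] at hy
      exact (hd y hy).hasDerivWithinAt
    · intro y hy
      rw [interior_Icc] at hy
      have h := hflux hmem (Ioo_subset_Icc_self hy) hy.1.le
      simp only [zero_rpow (show M - 1 ≠ 0 by linarith), zero_mul] at h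
      exact nonpos_of_mul_nonpos_right h (rpow_pos_of_pos hy.1 _)
  exact hanti hmem hx hx.1

/-- Quantitative comparison of a rescaled subcritical solution with the critical bubble. -/
lemma rescaled_solution_bubble_energy_le {M p : ℝ} (hM : 2 < M) (hp : 1 < p)
    (hpM : p ≤ (M + 2) / (M - 2)) {v : ℝ → ℝ}
    (hreg : ContDiffOn ℝ 2 v (Icc 0 1)) (hpos : ∀ x ∈ Ico (0 : ℝ) 1, 0 < v x)
    (hode : ∀ x ∈ Ioo (0 : ℝ) 1,
      -(deriv (fun y : ℝ => y ^ (M - 1) * deriv v y) x) = x ^ (M - 1) * v x ^ p) :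
    ∃ w₁ : ℝ → ℝ,
      (∀ t ∈ Ioo 0 (v 0 ^ ((p - 1) / 2)),
        HasDerivAt (fun y => v (y / v 0 ^ ((p - 1) / 2)) / v 0) (w₁ t) t) ∧
      ∀ t ∈ Icc 0 (v 0 ^ ((p - 1) / 2)),
        (v (t / v 0 ^ ((p - 1) / 2)) / v 0
            - (1 + t ^ 2 / (M * (M - 2))) ^ (-(M - 2) / 2)) ^ 2
          + (w₁ t - -(t / M) * (1 + t ^ 2 / (M * (M - 2))) ^ (-M / 2)) ^ 2
        ≤ ((M + 2) / (M - 2) - p) ^ 2 * exp (((M + 2) / (M - 2) + 2) * t) := by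
  obtain ⟨v₁, hv₁, hv₁0, hd, hd₁⟩ := exists_radial_derivative hM (by linarith) hreg hode
  have hv := hreg.continuousOn
  have hm : 0 < v 0 := hpos 0 (by simp)
  have hle := fun x (hx : x ∈ Icc (0 : ℝ) 1) => radial_solution_le_value_zero hM hv hv₁
    (fun x hx => (hpos x (Ioo_subset_Ico_self hx)).le) hd hd₁ hx
  set m := v 0 with hm_def
  set l := m ^ ((p - 1) / 2) with hl_def
  have hl : 0 < l := rpow_pos_of_pos hm _
  have hl2 : l ^ 2 * m = m ^ p := by
    rw [hl_def, ← rpow_natCast, ← rpow_mul hm.le, ← rpow_add_one hm.ne']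
    congr 1
    push_cast
    ring
  have hmaps : MapsTo (fun t => t / l) (Icc 0 l) (Icc 0 1) := fun t ht =>
    ⟨div_nonneg ht.1 hl.le, (div_le_one hl).mpr ht.2⟩
  have hmaps' : MapsTo (fun t => t / l) (Ioo 0 l) (Ioo 0 1) := fun t ht =>
    ⟨div_pos ht.1 hl, (div_lt_one hl).mpr ht.2⟩
  have hdiv : ∀ t, HasDerivAt (fun t => t / l) (1 / l) t := fun t =>
    (hasDerivAt_id t).div_const l
  have hw : ∀ t ∈ Ioo 0 l, HasDerivAt (fun y => v (y / l) / m) (v₁ (t / l) / (l * m)) t := by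
    intro t ht
    refine (((hd _ (hmaps' ht)).comp t (hdiv t)).div_const m).congr_deriv ?_
    field_simp
  refine ⟨fun t => v₁ (t / l) / (l * m), hw, fun t ht => ?_⟩
  set P := (M + 2) / (M - 2) with hP
  have hcd : ContinuousOn (fun t => t / l) (Icc 0 l) := by fun_prop
  refine energy_le_of_damped_ode (a := M - 1) (K := P)
    (d := fun t => v (t / l) / m - (1 + t ^ 2 / (M * (M - 2))) ^ (-(M - 2) / 2))
    (d₁ := fun t => v₁ (t / l) / (l * m) - -(t / M) * (1 + t ^ 2 / (M * (M - 2))) ^ (-M / 2))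
    (g := fun t => (v (t / l) / m) ^ p
      - ((1 + t ^ 2 / (M * (M - 2))) ^ (-(M - 2) / 2)) ^ P)
    (by linarith) (by linarith) ?_ ?_ ?_ ?_ ?_ ?_ ?_ ht
  · exact ((hv.comp hcd hmaps).div_const m).sub fun x _ =>
      (hasDerivAt_bubble_s11 hM x).continuousAt.continuousWithinAt
  · refine ((hv₁.comp hcd hmaps).div_const (l * m)).sub fun x _ => ?_
    exact (((continuous_id.div_const M).neg.continuousAt).mul
      (hasDerivAt_bubble_rpow hM (-M / 2) x).continuousAt).continuousWithinAt
  · simp [← hm_def, hm.ne']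
  · simp [hv₁0]
  · exact fun s hs => (hw s hs).sub (hasDerivAt_bubble_s11 hM s)
  · intro s hs
    have hs0 : s ≠ 0 := hs.1.ne'
    refine ((((hd₁ _ (hmaps' hs)).comp s (hdiv s)).div_const (l * m)).sub
      (hasDerivAt_bubble_deriv hM hs0)).congr_deriv ?_
    rw [div_rpow (hpos _ (Ioo_subset_Ico_self (hmaps' hs))).le hm.le, ← hl2]
    field_simp
    ring
  · intro s hs
    have hsI := hmaps (Ioo_subset_Icc_self hs)
    have hws : v (s / l) / m ∈ Icc (0 : ℝ) 1 :=
      ⟨div_nonneg (hpos _ (Ioo_subset_Ico_self (hmaps' hs))).le hm.le,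
        (div_le_one hm).mpr (hle _ hsI)⟩
    calc _ ≤ |(v (s / l) / m) ^ p - (v (s / l) / m) ^ P|
          + |(v (s / l) / m) ^ P - ((1 + s ^ 2 / (M * (M - 2))) ^ (-(M - 2) / 2)) ^ P| :=
          abs_sub_le _ _ _
      _ ≤ _ := add_le_add (abs_rpow_sub_rpow_exponent_le hws.1 hws.2 hp.le hpM)
          (abs_rpow_sub_rpow_base_le hws (bubble_mem_Icc hM s) (by linarith))

/-- for a family of positive C² radial solutions `v_p` (`v_p > 0` on `[0,1)`,
`v_p(1) = 0`, `v_p'(0) = 0`) of the generalized Lane–Emden equation with exponent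
`p ∈ (1, p_M)`, as `p → p_M⁻` one has `𝓜_{0,p} = v_p(0) → +∞` and the rescalings
`ṽ_{0,p}(x) = v_p(x/𝓜̃_{0,p})/𝓜_{0,p}` (with `𝓜̃_{0,p} = 𝓜_{0,p}^{(p-1)/2}`) converge to `V_M`
in `C¹_loc[0,∞)`: for every `R > 0`, `ṽ_{0,p} → V_M` and `ṽ_{0,p}' → V_M'` uniformly on `[0,R]`. -/
theorem stmt11 (M pM : ℝ) (hM : 2 < M) (hpM : pM = (M + 2) / (M - 2))
    (v : ℝ → ℝ → ℝ)
    (hreg : ∀ p ∈ Set.Ioo 1 pM, ContDiffOn ℝ 2 (v p) (Set.Icc 0 1))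
    (hpos : ∀ p ∈ Set.Ioo 1 pM, ∀ x ∈ Set.Ico (0 : ℝ) 1, 0 < v p x)
    (hv1 : ∀ p ∈ Set.Ioo 1 pM, v p 1 = 0)
    (hd0 : ∀ p ∈ Set.Ioo 1 pM, deriv (v p) 0 = 0)
    (hode : ∀ p ∈ Set.Ioo 1 pM, ∀ x ∈ Set.Ioo (0 : ℝ) 1,
      -(deriv (fun y : ℝ => y ^ (M - 1) * deriv (v p) y) x)
        = x ^ (M - 1) * v p x ^ p) :
    Tendsto (fun p => v p 0) (𝓝[<] pM) atTop ∧
    ∀ R > (0 : ℝ),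
      TendstoUniformlyOn
        (fun p x => v p (x / (v p 0) ^ ((p - 1) / 2)) / v p 0)
        (fun x => (1 + x ^ 2 / (M * (M - 2))) ^ (-(M - 2) / 2)) (𝓝[<] pM) (Set.Icc 0 R) ∧
      TendstoUniformlyOn
        (fun p x => deriv (fun y : ℝ => v p (y / (v p 0) ^ ((p - 1) / 2)) / v p 0) x)
        (deriv (fun x : ℝ => (1 + x ^ 2 / (M * (M - 2))) ^ (-(M - 2) / 2)))
        (𝓝[<] pM) (Set.Icc 0 R) := by
  have hM2 : 0 < M - 2 := by linarith
  have h1pM : 1 < pM := by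
    rw [hpM, lt_div_iff₀ hM2]
    linarith
  have hIoo : ∀ᶠ p in 𝓝[<] pM, p ∈ Ioo 1 pM := Ioo_mem_nhdsLT h1pM
  choose! w₁ hw₁ henergy using fun p (hp : p ∈ Ioo 1 pM) =>
    rescaled_solution_bubble_energy_le hM hp.1 (hpM ▸ hp.2.le) (hreg p hp) (hpos p hp) (hode p hp)
  simp only [← hpM] at henergy
  have hsmall : ∀ R δ : ℝ, 0 < δ →
      ∀ᶠ p in 𝓝[<] pM, (pM - p) ^ 2 * exp ((pM + 2) * R) < δ ^ 2 := by
    intro R δ hδ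
    have hcont : Continuous fun p : ℝ => (pM - p) ^ 2 * exp ((pM + 2) * R) := by fun_prop
    have hlim := (hcont.tendsto pM).mono_left (nhdsWithin_le_nhds (s := Iio pM))
    exact hlim.eventually_lt_const (by simpa using pow_pos hδ 2)
  have hlarge : ∀ R : ℝ, 0 < R → ∀ᶠ p in 𝓝[<] pM, R < v p 0 ^ ((p - 1) / 2) := by
    intro R hR
    have hVR := rpow_pos_of_pos (bubble_base_pos hM R) (-(M - 2) / 2)
    filter_upwards [hIoo, hsmall R _ hVR] with p hp hδ
    by_contra! hle
    have hl : 0 < v p 0 ^ ((p - 1) / 2) := rpow_pos_of_pos (hpos p hp 0 (by simp)) _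
    have h := henergy p hp _ (right_mem_Icc.mpr hl.le)
    rw [div_self hl.ne', hv1 p hp, zero_div, zero_sub, neg_sq] at h
    set l := v p 0 ^ ((p - 1) / 2)
    have hV : (1 + R ^ 2 / (M * (M - 2))) ^ (-(M - 2) / 2)
        ≤ (1 + l ^ 2 / (M * (M - 2))) ^ (-(M - 2) / 2) := by
      refine rpow_le_rpow_of_nonpos (bubble_base_pos hM l) ?_ (by linarith)
      gcongr
    have hexp : (pM - p) ^ 2 * exp ((pM + 2) * l) ≤ (pM - p) ^ 2 * exp ((pM + 2) * R) := by
      gcongr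
    have hV2 := pow_le_pow_left₀ hVR.le hV 2
    have hnonneg := sq_nonneg (w₁ p l - -(l / M) * (1 + l ^ 2 / (M * (M - 2))) ^ (-M / 2))
    linarith
  have hclose : ∀ R : ℝ, ∀ δ : ℝ, 0 < δ → ∀ᶠ p in 𝓝[<] pM, p ∈ Ioo 1 pM →
      ∀ t ∈ Icc 0 R, t ≤ v p 0 ^ ((p - 1) / 2) →
        |v p (t / v p 0 ^ ((p - 1) / 2)) / v p 0
            - (1 + t ^ 2 / (M * (M - 2))) ^ (-(M - 2) / 2)| < δ ∧
        |w₁ p t - -(t / M) * (1 + t ^ 2 / (M * (M - 2))) ^ (-M / 2)| < δ := by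
    intro R δ hδ
    filter_upwards [hsmall R δ hδ] with p hδp hp t ht htl
    have h := henergy p hp t ⟨ht.1, htl⟩
    have hexp : (pM - p) ^ 2 * exp ((pM + 2) * t) ≤ (pM - p) ^ 2 * exp ((pM + 2) * R) := by
      have := ht.2
      gcongr
    constructor <;> refine abs_lt_of_sq_lt_sq ?_ hδ.le
    · nlinarith [sq_nonneg (w₁ p t - -(t / M) * (1 + t ^ 2 / (M * (M - 2))) ^ (-M / 2))]
    · nlinarith [sq_nonneg (v p (t / v p 0 ^ ((p - 1) / 2)) / v p 0
        - (1 + t ^ 2 / (M * (M - 2))) ^ (-(M - 2) / 2))]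
  refine ⟨tendsto_atTop.mpr fun b => ?_, fun R hR => ⟨?_, ?_⟩⟩
  · have hB : 1 ≤ max 1 b := le_max_left _ _
    filter_upwards [hIoo, hlarge _ (rpow_pos_of_pos (one_pos.trans_le hB) ((pM - 1) / 2))]
      with p hp hl
    by_contra! hlt
    have hle : v p 0 ≤ max 1 b := hlt.le.trans (le_max_right _ _)
    have h1 : v p 0 ^ ((p - 1) / 2) ≤ max 1 b ^ ((p - 1) / 2) :=
      rpow_le_rpow (hpos p hp 0 (by simp)).le hle (by linarith [hp.1])
    have h2 : max 1 b ^ ((p - 1) / 2) ≤ max 1 b ^ ((pM - 1) / 2) :=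
      rpow_le_rpow_of_exponent_le hB (by linarith [hp.2])
    linarith
  · rw [Metric.tendstoUniformlyOn_iff]
    intro δ hδ
    filter_upwards [hIoo, hlarge R hR, hclose R δ hδ] with p hp hl h t ht
    rw [dist_comm, dist_eq]
    exact (h hp t ht (ht.2.trans hl.le)).1
  · rw [Metric.tendstoUniformlyOn_iff]
    intro δ hδ
    filter_upwards [hIoo, hlarge R hR, hclose R δ hδ] with p hp hl h t ht
    rw [dist_comm, dist_eq, (hasDerivAt_bubble_s11 hM t).deriv]
    rcases ht.1.eq_or_lt with rfl | ht0
    · have hzero : deriv (fun y => v p (y / v p 0 ^ ((p - 1) / 2)) / v p 0) 0 = 0 := by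
        simp only [deriv_div_const, div_eq_inv_mul _ (v p 0 ^ ((p - 1) / 2))]
        rw [deriv_comp_mul_left, mul_zero, hd0 p hp, smul_zero, zero_div]
      simpa [hzero] using hδ
    · rw [(hw₁ p hp t ⟨ht0, ht.2.trans_lt hl⟩).deriv]
      exact (h hp t ht (ht.2.trans hl.le)).2
end
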